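/- arXiv:1308.4341 — 3 statements merged into one kernel-verified Lean document; each statement's English description precedes it below -/
import Mathlib

section
/- Let k ≥ 1, n > (5k+4)/2, and let G be a connected simple graph of order n. If e(G) ≥ e(S_{n,k}), then G contains a path on 2k+2 vertices as a subgraph, unless G is isomorphic to S_{n,k}. -/
open Matrix BigOperators

noncomputable def edgeCount {V : Type*} (G : SimpleGraph V) : ℕ := Nat.card G.edgeSet

noncomputable def deg {V : Type*} (G : SimpleGraph V) (v : V) : ℕ := Nat.card (G.neighborSet v)

def HasPathOn {V : Type*} (G : SimpleGraph V) (l : ℕ) : Prop :=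
  ∃ (u v : V) (p : G.Walk u v), p.IsPath ∧ p.support.length = l

noncomputable def signlessLaplacian {V : Type*} [Fintype V] [DecidableEq V]
    (G : SimpleGraph V) : Matrix V V ℝ :=
  letI : DecidableRel G.Adj := Classical.decRel _
  Matrix.diagonal (fun v => (deg G v : ℝ)) + G.adjMatrix ℝ

theorem signlessLaplacian_isHermitian {V : Type*} [Fintype V] [DecidableEq V]
    (G : SimpleGraph V) : (signlessLaplacian G).IsHermitian := by
  letI : DecidableRel G.Adj := Classical.decRel _
  unfold signlessLaplacian
  refine (Matrix.isHermitian_diagonal _).add ?_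
  rw [Matrix.IsHermitian, Matrix.conjTranspose_eq_transpose_of_trivial]
  exact G.isSymm_adjMatrix

/-- The `Q`-index of a graph: the largest eigenvalue of its signless Laplacian. -/
noncomputable def qIndex {V : Type*} [Fintype V] [DecidableEq V] (G : SimpleGraph V) : ℝ :=
  ⨆ v, (signlessLaplacian_isHermitian G).eigenvalues v

noncomputable def adjMat {V : Type*} [Fintype V] (G : SimpleGraph V) : Matrix V V ℝ :=
  letI : DecidableRel G.Adj := Classical.decRel _
  G.adjMatrix ℝ

theorem adjMat_isHermitian {V : Type*} [Fintype V] (G : SimpleGraph V) :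
    (adjMat G).IsHermitian := by
  letI : DecidableRel G.Adj := Classical.decRel _
  unfold adjMat
  rw [Matrix.IsHermitian, Matrix.conjTranspose_eq_transpose_of_trivial]
  exact G.isSymm_adjMatrix

/-- The spectral radius `μ`: the largest eigenvalue of the adjacency matrix. -/
noncomputable def muIndex {V : Type*} [Fintype V] [DecidableEq V] (G : SimpleGraph V) : ℝ :=
  ⨆ v, (adjMat_isHermitian G).eigenvalues v

/-- `S_{n,k} = K_k ∨ \overline{K_{n-k}}`: the first `k` vertices form a clique joined to all. -/
def Snk (n k : ℕ) : SimpleGraph (Fin n) :=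
  SimpleGraph.fromRel (fun i j => (i : ℕ) < k ∨ (j : ℕ) < k)

/-- `S_{n,k}^+`: `S_{n,k}` plus one edge inside the independent set. -/
def SnkPlus (n k : ℕ) : SimpleGraph (Fin n) :=
  SimpleGraph.fromRel (fun i j => (i : ℕ) < k ∨ (j : ℕ) < k ∨ ((i : ℕ) = k ∧ (j : ℕ) = k + 1))

/-- `L_{t,k} = K_1 ∨ tK_k`: `t` cliques of order `k+1` sharing a common center `none`. -/
def LGraph (t k : ℕ) : SimpleGraph (Option (Fin t × Fin k)) :=
  SimpleGraph.fromRel (fun x y => x = none ∨ ∃ i a b, x = some (i, a) ∧ y = some (i, b))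

/-- `K_1 ∨ (sK_k ∪ K_m)`. -/
def K1JoinCliques (s k m : ℕ) : SimpleGraph (Option ((Fin s × Fin k) ⊕ Fin m)) :=
  SimpleGraph.fromRel (fun x y => x = none ∨
    (∃ i a b, x = some (Sum.inl (i, a)) ∧ y = some (Sum.inl (i, b))) ∨
    (∃ a b, x = some (Sum.inr a) ∧ y = some (Sum.inr b)))

/-- Two disjoint copies of `L_{s,k}` and `L_{t,k}` with their centers joined by an edge. -/
def DoubleL (s t k : ℕ) : SimpleGraph (Option (Fin s × Fin k) ⊕ Option (Fin t × Fin k)) :=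
  SimpleGraph.fromRel (fun x y =>
    (∃ a b, x = Sum.inl a ∧ y = Sum.inl b ∧ (LGraph s k).Adj a b) ∨
    (∃ a b, x = Sum.inr a ∧ y = Sum.inr b ∧ (LGraph t k).Adj a b) ∨
    (x = Sum.inl none ∧ y = Sum.inr none))

/-- `G` is (a copy of) a subgraph of `H`. -/
def IsSubgraphOf {V W : Type*} (G : SimpleGraph V) (H : SimpleGraph W) : Prop :=
  ∃ f : V ↪ W, ∀ a b, G.Adj a b → H.Adj (f a) (f b)

/-- `G` contains `m` pairwise disjoint edges. -/
def HasMatching {V : Type*} (G : SimpleGraph V) (m : ℕ) : Prop :=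
  ∃ M : Finset (Sym2 V), M.card = m ∧ (∀ e ∈ M, e ∈ G.edgeSet) ∧
    ∀ e ∈ M, ∀ f ∈ M, e ≠ f → ∀ v : V, ¬(v ∈ e ∧ v ∈ f)

/-- `G` is 2-connected: at least 3 vertices, and deleting any vertex leaves a connected graph. -/
def TwoConnected {V : Type*} [Fintype V] (G : SimpleGraph V) : Prop :=
  3 ≤ Fintype.card V ∧ ∀ v : V, (G.induce {w : V | w ≠ v}).Connected

namespace SimpleGraph

section

open scoped Classical

variable {V : Type*} {G : SimpleGraph V}

/-- The vertices of `l`, in this order, form a path of `G`. -/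
def IsPathList (G : SimpleGraph V) (l : List V) : Prop := l.IsChain G.Adj ∧ l.Nodup

theorem isPathList_append_iff {l₁ l₂ : List V} :
    G.IsPathList (l₁ ++ l₂) ↔ G.IsPathList l₁ ∧ G.IsPathList l₂ ∧ l₁.Disjoint l₂ ∧
      ∀ x ∈ l₁.getLast?, ∀ y ∈ l₂.head?, G.Adj x y := by
  simp only [IsPathList, List.isChain_append, List.nodup_append']
  tauto

theorem IsPathList.reverse {l : List V} (h : G.IsPathList l) : G.IsPathList l.reverse := by
  refine ⟨?_, List.nodup_reverse.2 h.2⟩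
  rw [List.isChain_reverse]
  exact h.1.imp fun _ _ h => h.symm

theorem IsPathList.assemble {B P Q : List V} (hB : G.IsPathList B) (hP : G.IsPathList P)
    (hQ : G.IsPathList Q) (hd : (B ++ (P ++ Q)).Nodup) (hne : P ≠ [])
    (hBP : ∀ b ∈ B.head?, ∀ p ∈ P.getLast?, G.Adj b p)
    (hPQ : ∀ a ∈ P.head?, ∀ q ∈ Q.head?, G.Adj a q) :
    G.IsPathList (B.reverse ++ (P.reverse ++ Q)) := by
  rw [List.nodup_append', List.nodup_append'] at hd
  obtain ⟨-, ⟨-, -, h1⟩, h2⟩ := hd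
  rw [isPathList_append_iff, isPathList_append_iff]
  refine ⟨hB.reverse, ⟨hP.reverse, hQ, ?_, ?_⟩, ?_, ?_⟩
  · intro v; simpa using @h1 v
  · simpa using hPQ
  · intro v; simpa using @h2 v
  · intro x hx y hy
    rw [List.getLast?_reverse] at hx
    rw [List.head?_append_of_ne_nil _ (by simpa using hne), List.head?_reverse] at hy
    exact hBP x hx y hy

theorem exists_split_last (p : V → Prop) {l : List V} (h : ∃ v ∈ l, p v) :
    ∃ l₁ c l₂, l = l₁ ++ c :: l₂ ∧ p c ∧ ∀ v ∈ l₂, ¬ p v := by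
  induction l with
  | nil => simp at h
  | cons a t ih =>
    by_cases ht : ∃ v ∈ t, p v
    · obtain ⟨l₁, c, l₂, rfl, hc, h2⟩ := ih ht
      exact ⟨a :: l₁, c, l₂, rfl, hc, h2⟩
    · push Not at ht
      refine ⟨[], a, t, rfl, ?_, ht⟩
      obtain ⟨v, hv, hpv⟩ := h
      rcases List.mem_cons.1 hv with rfl | hv
      · exact hpv
      · exact absurd hpv (ht v hv)

theorem exists_split_first (p : V → Prop) {l : List V} (h : ∃ v ∈ l, p v) :
    ∃ l₁ c l₂, l = l₁ ++ c :: l₂ ∧ p c ∧ ∀ v ∈ l₁, ¬ p v := by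
  obtain ⟨l₁, c, l₂, h1, hc, h2⟩ := exists_split_last p (l := l.reverse) (by simpa using h)
  refine ⟨l₂.reverse, c, l₁.reverse, ?_, hc, by simpa using h2⟩
  have := congrArg List.reverse h1
  simpa using this

/-- If no two consecutive entries `u, w` of a list satisfy `Y u` and `X w`, then `X` and `Y`
together hold at most (length - 1) times, up to the values of `X` at the first entry and of `Y`
at the last one. -/
theorem countP_add_countP_le (X Y : V → Prop) (h : V) (t : List V)
    (hc : (h :: t).IsChain fun u w => ¬ (Y u ∧ X w)) :
    (h :: t).countP (fun v => decide (X v)) + (h :: t).countP (fun v => decide (Y v)) ≤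
      t.length + (if X h then 1 else 0) + (if Y ((h :: t).getLast (by simp)) then 1 else 0) := by
  induction t generalizing h with
  | nil =>
    simp only [List.countP_cons, List.countP_nil, List.getLast_singleton, decide_eq_true_eq]
    by_cases h1 : X h <;> by_cases h2 : Y h <;> simp [h1, h2]
  | cons w t ih =>
    rw [List.isChain_cons_cons] at hc
    have := ih w hc.2
    rw [List.countP_cons (a := h), List.countP_cons (a := h),
      List.getLast_cons (by simp)]
    have h1 := hc.1
    simp only [List.length_cons, decide_eq_true_eq] at this ⊢
    split_ifs at this ⊢ <;> first | omega | tauto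

theorem isChain_of_forall_split {R : V → V → Prop} {l : List V}
    (h : ∀ l₁ u w l₂, l = l₁ ++ u :: w :: l₂ → R u w) : l.IsChain R := by
  rw [List.isChain_iff_forall_rel_of_append_cons_cons]
  intro a b l₁ l₂ h'
  exact h _ _ _ _ h'

theorem exists_isPathList_of_adj_mem {a b : V} {A B : List V} (hA : G.IsPathList (a :: A))
    (hB : G.IsPathList (b :: B)) (hd : ((b :: B) ++ (a :: A)).Nodup)
    (hcross : ∃ c ∈ a :: A, G.Adj b c) :
    ∃ l, G.IsPathList l ∧ ((a :: A).length + (b :: B).length ≤ l.length ∨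
      ((a :: A) ++ (b :: B)).countP (fun v => decide (G.Adj a v)) +
      ((a :: A) ++ (b :: B)).countP (fun v => decide (G.Adj b v)) + 1 ≤ l.length) := by
  by_contra! hno
  have hd' : ((a :: A) ++ (b :: B)).Nodup := List.nodup_append_comm.1 hd
  have hApair : (a :: A).IsChain fun u w => ¬ (G.Adj b u ∧ G.Adj a w) := by
    refine isChain_of_forall_split fun l₁ u w l₂ h => ?_
    rintro ⟨hu, hw⟩
    have e : a :: A = (l₁ ++ [u]) ++ (w :: l₂) := by simp [h]
    have hh : a ∈ (l₁ ++ [u]).head? := by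
      have := congrArg List.head? e
      rw [List.head?_append_of_ne_nil _ (by simp)] at this
      simp [← this]
    rw [e] at hA hd
    obtain ⟨h1, h2, -, -⟩ := isPathList_append_iff.1 hA
    have := hno _ (hB.assemble h1 h2 hd (by simp) (by simpa using hu)
      (by intro x hx; simpa [Option.mem_unique hx hh] using hw))
    have e' := congrArg List.length e
    simp at this e'
    omega
  have hBpair : (b :: B).IsChain fun u w => ¬ (G.Adj a u ∧ G.Adj b w) := by
    refine isChain_of_forall_split fun l₁ u w l₂ h => ?_
    rintro ⟨hu, hw⟩
    have e : b :: B = (l₁ ++ [u]) ++ (w :: l₂) := by simp [h]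
    have hh : b ∈ (l₁ ++ [u]).head? := by
      have := congrArg List.head? e
      rw [List.head?_append_of_ne_nil _ (by simp)] at this
      simp [← this]
    rw [e] at hB hd'
    obtain ⟨h1, h2, -, -⟩ := isPathList_append_iff.1 hB
    have := hno _ (hA.assemble h1 h2 hd' (by simp) (by simpa using hu)
      (by intro x hx; simpa [Option.mem_unique hx hh] using hw))
    have e' := congrArg List.length e
    simp at this e'
    omega
  have hBlast : ¬ G.Adj a ((b :: B).getLast (by simp)) := by
    intro h
    have := hno _ (hA.assemble (Q := []) hB ⟨by simp, by simp⟩ (by simpa using hd') (by simp)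
      (by
        intro x hx y hy
        rw [List.getLast?_eq_some_getLast (by simp)] at hy
        simp only [List.head?_cons, Option.mem_def, Option.some.injEq] at hx hy
        rw [← hx, ← hy]; exact h) (by simp))
    simp at this
    omega
  have cB := countP_add_countP_le (fun v => G.Adj b v) (fun v => G.Adj a v) b B hBpair
  rw [if_neg hBlast, if_neg (G.irrefl)] at cB
  obtain ⟨L₁, c, L₂, e, hc, hL₂⟩ := exists_split_last (fun v => G.Adj b v) hcross
  have e1 : a :: A = (L₁ ++ [c]) ++ L₂ := by simp [e]
  obtain ⟨t, ht⟩ : ∃ t, L₁ ++ [c] = a :: t := by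
    cases L₁ with
    | nil => exact ⟨[], by simp at e; simp [e.1]⟩
    | cons x L => exact ⟨L ++ [c], by simp at e; simp [e.1]⟩
  have cA := countP_add_countP_le (fun v => G.Adj a v) (fun v => G.Adj b v) a t
    (by rw [← ht]; rw [e1] at hApair; exact hApair.left_of_append)
  rw [if_neg (G.irrefl)] at cA
  have ht' : t.length = L₁.length := by simpa using (congrArg List.length ht).symm
  have cL : L₂.countP (fun v => decide (G.Adj b v)) = 0 := by
    rw [List.countP_eq_zero]; simpa using hL₂
  have hcA : ∀ p : V → Bool, (a :: A).countP p = (a :: t).countP p + L₂.countP p := by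
    intro p; rw [e1, ht, List.countP_append]
  obtain ⟨L₃, hL₃, hs, hcount⟩ : ∃ L₃ : List V, (∀ q ∈ L₃.head?, G.Adj a q) ∧ L₃ <:+ L₂ ∧
      L₂.countP (fun v => decide (G.Adj a v)) ≤ L₃.length := by
    by_cases hX : ∃ v ∈ L₂, G.Adj a v
    · obtain ⟨M, d, L₃, rfl, hd, hM⟩ := exists_split_first (fun v => G.Adj a v) hX
      refine ⟨d :: L₃, by simpa using hd, by simp, ?_⟩
      rw [List.countP_append, List.countP_eq_zero.2 (by simpa using hM), zero_add]
      exact List.countP_le_length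
    · refine ⟨[], by simp, by simp, ?_⟩
      rw [List.countP_eq_zero.2 (by simpa using hX)]
      simp
  rw [e1, ht] at hA hd
  obtain ⟨h1, h2, -, -⟩ := isPathList_append_iff.1 hA
  obtain ⟨M, hM⟩ := hs
  rw [← hM] at h2 hd
  have h3 := (isPathList_append_iff.1 h2).2.1
  have := (hno _ (hB.assemble h1 h3 (hd.sublist (by simp)) (by simp) (by
    intro x hx y hy
    rw [← ht] at hy
    simp at hx hy
    rw [← hx, ← hy]; exact hc) (by simpa using hL₃))).2
  rw [List.countP_append, List.countP_append, hcA, hcA, cL] at this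
  simp only [List.length_append, List.length_reverse, List.length_cons] at this
  split_ifs at cA <;> omega

theorem IsPathList.exists_ending_at {a c : V} {A : List V} (hA : G.IsPathList (a :: A))
    (hc : c ∈ a :: A) :
    ∃ l, G.IsPathList (l ++ [c]) ∧ (∀ v ∈ l ++ [c], v ∈ a :: A) ∧
      (a :: A).countP (fun v => decide (G.Adj a v)) ≤ l.length := by
  obtain ⟨L₁, L₂, e⟩ := List.append_of_mem hc
  have e1 : a :: A = (L₁ ++ [c]) ++ L₂ := by simp [e]
  have hh : a ∈ (L₁ ++ [c]).head? := by
    have := congrArg List.head? e1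
    rw [List.head?_append_of_ne_nil _ (by simp)] at this
    simp [← this]
  have hlt : (L₁ ++ [c]).countP (fun v => decide (G.Adj a v)) ≤ L₁.length := by
    obtain ⟨t, ht⟩ := List.head?_eq_some_iff.1 hh
    have hlen := congrArg List.length ht
    rw [ht, List.countP_cons_of_neg (by simp)]
    have := List.countP_le_length (p := fun v => decide (G.Adj a v)) (l := t)
    simp at hlen
    omega
  have hA' := hA
  rw [e1] at hA'
  obtain ⟨h1, h2, hdis, -⟩ := isPathList_append_iff.1 hA'
  by_cases hX : ∃ v ∈ L₂, G.Adj a v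
  · obtain ⟨M, d, L₃, rfl, hd, hM⟩ := exists_split_first (fun v => G.Adj a v) hX
    have h3 := (isPathList_append_iff.1 h2).2.1
    refine ⟨(d :: L₃).reverse ++ L₁, ?_, ?_, ?_⟩
    · rw [List.append_assoc, isPathList_append_iff]
      refine ⟨h3.reverse, h1, ?_, ?_⟩
      · intro v hv hv'
        exact hdis hv' (by simp at hv ⊢; tauto)
      · intro x hx y hy
        rw [Option.mem_unique hy hh]
        simp at hx
        rw [← hx]
        exact hd.symm
    · intro v hv
      rw [e]
      simp at hv ⊢
      tauto
    · rw [e1, List.countP_append, List.countP_append (l₁ := M),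
        List.countP_eq_zero (l := M).2 (by simpa using hM)]
      have : (d :: L₃).countP (fun v => decide (G.Adj a v)) ≤ (d :: L₃).length :=
        List.countP_le_length
      simp only [List.length_append, List.length_reverse]
      omega
  · refine ⟨L₁, h1, ?_, ?_⟩
    · intro v hv
      rw [e1]
      exact List.mem_append_left _ hv
    · rw [e1, List.countP_append, List.countP_eq_zero (l := L₂).2 (by simpa using hX)]
      omega

theorem Connected.exists_isPathList_between (hG : G.Connected) {A B : List V} (hA : A ≠ [])
    (hB : B ≠ []) (hd : A.Disjoint B) :
    ∃ c ∈ A, ∃ e ∈ B, ∃ R, G.IsPathList (c :: (R ++ [e])) ∧ (∀ v ∈ R, v ∉ A ∧ v ∉ B) := by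
  obtain ⟨a, A', rfl⟩ := List.exists_cons_of_ne_nil hA
  obtain ⟨b, B', rfl⟩ := List.exists_cons_of_ne_nil hB
  obtain ⟨p, hp⟩ := (hG.preconnected a b).exists_isPath
  have hl : G.IsPathList p.support := ⟨p.isChain_adj_support, hp.support_nodup⟩
  obtain ⟨l₁, c, l₂, e1, hc, h2⟩ := exists_split_last (fun v => v ∈ a :: A') (l := p.support)
    ⟨a, p.start_mem_support, by simp⟩
  have hbne : b ≠ c := by rintro rfl; exact hd hc (by simp)
  have hb2 : b ∈ l₂ := by
    have : (c :: l₂).getLast (by simp) = b := by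
      have h := p.getLast_support
      simp only [e1] at h
      rwa [List.getLast_append_of_ne_nil (by simp)] at h
    have hm : b ∈ c :: l₂ := by rw [← this]; exact List.getLast_mem _
    rcases List.mem_cons.1 hm with h | h
    · exact absurd h hbne
    · exact h
  obtain ⟨R, e, l₃, rfl, he, hR⟩ := exists_split_first (fun v => v ∈ b :: B') ⟨b, hb2, by simp⟩
  refine ⟨c, hc, e, he, R, ?_, fun v hv => ⟨h2 v (by simp [hv]), hR v hv⟩⟩
  rw [e1] at hl
  have h3 := (isPathList_append_iff.1 hl).2.1
  rw [show c :: (R ++ e :: l₃) = (c :: (R ++ [e])) ++ l₃ by simp] at h3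
  exact (isPathList_append_iff.1 h3).1

/-- Two disjoint paths in a connected graph, starting at `a` and `b`, can be recombined to a path
that is either as long as both together or longer than the number of neighbours of `a` and of `b`
on them. -/
theorem Connected.exists_isPathList_of_pair (hG : G.Connected) {a b : V} {A B : List V}
    (hA : G.IsPathList (a :: A)) (hB : G.IsPathList (b :: B))
    (hd : ((a :: A) ++ (b :: B)).Nodup) :
    ∃ l, G.IsPathList l ∧ ((a :: A).length + (b :: B).length ≤ l.length ∨
      ((a :: A) ++ (b :: B)).countP (fun v => decide (G.Adj a v)) +
      ((a :: A) ++ (b :: B)).countP (fun v => decide (G.Adj b v)) + 1 ≤ l.length) := by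
  by_cases h1 : ∃ c ∈ a :: A, G.Adj b c
  · exact exists_isPathList_of_adj_mem hA hB (List.nodup_append_comm.1 hd) h1
  by_cases h2 : ∃ c ∈ b :: B, G.Adj a c
  · obtain ⟨l, hl, h⟩ := exists_isPathList_of_adj_mem hB hA hd h2
    refine ⟨l, hl, ?_⟩
    simp only [List.countP_append] at h ⊢
    omega
  have hdis := (List.nodup_append'.1 hd).2.2
  obtain ⟨c, hc, e, he, R, hR, hRd⟩ := hG.exists_isPathList_between (by simp) (by simp) hdis
  obtain ⟨l, hl, hlA, hlc⟩ := hA.exists_ending_at hc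
  obtain ⟨m, hm, hmB, hmc⟩ := hB.exists_ending_at he
  rw [isPathList_append_iff] at hl hm
  have hR' := hR
  rw [show c :: (R ++ [e]) = (c :: R) ++ [e] by simp, isPathList_append_iff] at hR'
  refine ⟨l ++ (c :: (R ++ [e]) ++ m.reverse), ?_, Or.inr ?_⟩
  · rw [isPathList_append_iff, isPathList_append_iff]
    refine ⟨hl.1, ⟨hR, hm.1.reverse, ?_, ?_⟩, ?_, ?_⟩
    · intro v hv hv'
      simp at hv hv'
      have hvB := hmB v (by simp [hv'])
      rcases hv with rfl | hv | rfl
      · exact hdis hc hvB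
      · exact (hRd v hv).2 hvB
      · exact hm.2.2.1 hv' (by simp)
    · intro x hx y hy
      rw [show c :: (R ++ [e]) = (c :: R) ++ [e] by simp, List.getLast?_concat] at hx
      simp at hx hy
      have := hm.2.2.2 y (by simp [hy]) e (by simp)
      rw [← hx]
      exact this.symm
    · intro v hv hv'
      have hvA := hlA v (by simp [hv])
      simp at hv'
      rcases hv' with rfl | hv' | rfl | hv'
      · exact hl.2.2.1 hv (by simp)
      · exact (hRd v hv').1 hvA
      · exact hdis hvA he
      · exact hdis hvA (hmB v (by simp [hv']))
    · intro x hx y hy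
      simp at hy
      have := hl.2.2.2 x hx c (by simp)
      rwa [← hy]
  · rw [List.countP_append, List.countP_append]
    rw [List.countP_eq_zero (p := fun v => decide (G.Adj a v)) (l := b :: B).2 (by simpa using h2),
      List.countP_eq_zero (p := fun v => decide (G.Adj b v)) (l := a :: A).2 (by simpa using h1)]
    simp only [List.length_append, List.length_cons, List.length_reverse]
    omega

theorem card_filter_adj_le_countP {S : Finset V} {a : V} {l : List V}
    (h : ∀ v ∈ S, G.Adj a v → v ∈ l) :
    (S.filter (G.Adj a)).card ≤ l.countP (fun v => decide (G.Adj a v)) := by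
  have : S.filter (G.Adj a) ⊆ (l.filter (fun v => decide (G.Adj a v))).toFinset := by
    intro v hv
    simp at hv ⊢
    exact ⟨h v hv.1 hv.2, hv.2⟩
  refine (Finset.card_le_card this).trans ((List.toFinset_card_le _).trans ?_)
  rw [List.countP_eq_length_filter]

/-- There are disjoint paths starting at `x` and at `y` with at least `N` vertices in total. -/
def LinksTo (G : SimpleGraph V) (N : ℕ) (x y : V) : Prop :=
  ∃ A B : List V, G.IsPathList (x :: A) ∧ G.IsPathList (y :: B) ∧
    ((x :: A) ++ (y :: B)).Nodup ∧ N ≤ (x :: A).length + (y :: B).length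

theorem LinksTo.symm {N : ℕ} {x y : V} (h : G.LinksTo N x y) : G.LinksTo N y x := by
  obtain ⟨A, B, h1, h2, h3, h4⟩ := h
  exact ⟨B, A, h2, h1, List.nodup_append_comm.1 h3, by omega⟩

theorem linksTo_of_adj_notMem {N M : ℕ} (hno : ∀ l, G.IsPathList l → l.length < N) (hNM : N ≤ M)
    {x y z : V} {A B : List V} (h1 : G.IsPathList (x :: A)) (h2 : G.IsPathList (y :: B))
    (h3 : ((x :: A) ++ (y :: B)).Nodup) (h4 : M ≤ (x :: A).length + (y :: B).length)
    (hxz : G.Adj x z) (hz : z ∉ (x :: A) ++ (y :: B)) :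
    ¬ G.Adj z y ∧ z ≠ y ∧ G.LinksTo (M + 1) z y := by
  have hzA : G.IsPathList (z :: x :: A) := by
    refine ⟨List.isChain_cons_cons.2 ⟨hxz.symm, h1.1⟩, List.nodup_cons.2 ⟨?_, h1.2⟩⟩
    simp at hz ⊢; tauto
  have hnd : ((z :: x :: A) ++ (y :: B)).Nodup := by
    rw [List.cons_append, List.nodup_cons]; exact ⟨hz, h3⟩
  refine ⟨fun hzy => ?_, fun h => hz (by simp [h]), x :: A, B, hzA, h2, hnd, ?_⟩
  · have hP : G.IsPathList ((z :: x :: A).reverse ++ (y :: B)) := by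
      refine isPathList_append_iff.2 ⟨hzA.reverse, h2, ?_, ?_⟩
      · intro v hv
        exact (List.nodup_append'.1 hnd).2.2 (List.mem_reverse.1 hv)
      · intro u hu w hw
        rw [List.getLast?_reverse] at hu
        simp only [List.head?_cons, Option.mem_def, Option.some.injEq] at hu hw
        rwa [← hu, ← hw]
    have := hno _ hP
    simp at this h4
    omega
  · simp only [List.length_cons] at h4 ⊢; omega

theorem Connected.adj_of_minDegree [Fintype V] (hG : G.Connected) {N p q : ℕ}
    (hno : ∀ l, G.IsPathList l → l.length < N)
    (hmax : ∀ x y, x ≠ y → ¬ G.Adj x y → G.LinksTo N x y) {S T : Finset V}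
    (hS : ∀ x ∈ S, p ≤ (S.filter (G.Adj x)).card) (hT : ∀ y ∈ T, q ≤ (T.filter (G.Adj y)).card)
    (hpq : N ≤ p + q + 1) {x y : V} (hx : x ∈ S) (hy : y ∈ T) (hxy : x ≠ y) : G.Adj x y := by
  by_contra hadj
  have key : ∀ m, ∃ x ∈ S, ∃ y ∈ T, x ≠ y ∧ ¬ G.Adj x y ∧ G.LinksTo (N + m) x y := by
    intro m
    induction m with
    | zero => exact ⟨x, hx, y, hy, hxy, hadj, hmax x y hxy hadj⟩
    | succ m ih =>
      obtain ⟨x, hx, y, hy, hxy, hadj, A, B, h1, h2, h3, h4⟩ := ih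
      by_contra! hcon
      have hxS : ∀ z ∈ S, G.Adj x z → z ∈ (x :: A) ++ (y :: B) := by
        intro z hz hxz
        by_contra hzm
        obtain ⟨ha, hne, hl⟩ :=
          linksTo_of_adj_notMem hno (Nat.le_add_right N m) h1 h2 h3 h4 hxz hzm
        exact hcon z hz y hy hne ha hl
      have hyT : ∀ z ∈ T, G.Adj y z → z ∈ (x :: A) ++ (y :: B) := by
        intro z hz hyz
        by_contra hzm
        obtain ⟨ha, hne, hl⟩ :=
          linksTo_of_adj_notMem hno (Nat.le_add_right N m) h2 h1 (List.nodup_append_comm.1 h3)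
            (by omega) hyz (by simp at hzm ⊢; tauto)
        exact hcon x hx z hz hne.symm (fun h => ha h.symm) hl.symm
      obtain ⟨l, hl, h⟩ := hG.exists_isPathList_of_pair h1 h2 h3
      have := hno l hl
      have := card_filter_adj_le_countP hxS
      have := card_filter_adj_le_countP hyT
      have := hS x hx
      have := hT y hy
      omega
  obtain ⟨x, -, y, -, -, -, A, B, -, -, h3, h4⟩ := key (Fintype.card V + 1)
  have := h3.length_le_card
  rw [List.length_append] at this
  omega

/-- Twice the number of edges inside `W`. -/
noncomputable def adjPairs (G : SimpleGraph V) (W : Finset V) : ℕ :=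
  ∑ v ∈ W, (W.filter (G.Adj v)).card

theorem adjPairs_insert {W : Finset V} {v : V} (hv : v ∉ W) :
    G.adjPairs (insert v W) = G.adjPairs W + 2 * (W.filter (G.Adj v)).card := by
  have h1 : ∀ u ∈ W, ((insert v W).filter (G.Adj u)).card =
      (W.filter (G.Adj u)).card + if G.Adj v u then 1 else 0 := by
    intro u hu
    rw [Finset.filter_insert]
    by_cases h : G.Adj u v
    · rw [if_pos h, if_pos h.symm, Finset.card_insert_of_notMem (by simp [hv])]
    · rw [if_neg h, if_neg (fun h' => h h'.symm), add_zero]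
  rw [adjPairs, Finset.sum_insert hv, Finset.sum_congr rfl h1, Finset.sum_add_distrib,
    Finset.filter_insert, if_neg (G.irrefl), Finset.sum_boole, adjPairs]
  simp
  ring

theorem adjPairs_le_card_mul (W : Finset V) : G.adjPairs W ≤ W.card * (W.card - 1) := by
  rw [adjPairs]
  refine (Finset.sum_le_card_nsmul W _ (W.card - 1) fun v hv => ?_).trans_eq (smul_eq_mul ..)
  rw [← Finset.card_erase_of_mem hv]
  refine Finset.card_le_card fun u hu => ?_
  simp at hu ⊢
  exact ⟨hu.2.ne', hu.1⟩

section Fintype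

variable [Fintype V]

/-- The union of all vertex sets inducing a subgraph of minimum degree greater than `α`. -/
noncomputable def core (G : SimpleGraph V) (α : ℕ) : Finset V :=
  Finset.univ.filter fun v => ∃ S : Finset V, (∀ u ∈ S, α < (S.filter (G.Adj u)).card) ∧ v ∈ S

theorem subset_core {α : ℕ} {S : Finset V} (hS : ∀ u ∈ S, α < (S.filter (G.Adj u)).card) :
    S ⊆ G.core α := by
  intro v hv
  simp only [core, Finset.mem_filter, Finset.mem_univ, true_and]
  exact ⟨S, hS, hv⟩

theorem lt_card_filter_core {α : ℕ} {v : V} (hv : v ∈ G.core α) :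
    α < ((G.core α).filter (G.Adj v)).card := by
  have h := hv
  simp only [core, Finset.mem_filter, Finset.mem_univ, true_and] at h
  obtain ⟨S, hS, hvS⟩ := h
  exact (hS v hvS).trans_le (Finset.card_le_card (Finset.filter_subset_filter _ (subset_core hS)))

theorem exists_adjPairs_erase {α : ℕ} {W : Finset V} (hW : ¬ W ⊆ G.core α) :
    ∃ v ∈ W, ((W.erase v).filter (G.Adj v)).card ≤ α ∧
      (∀ S ⊆ W, (∀ u ∈ S, α < (S.filter (G.Adj u)).card) → v ∉ S) ∧
      G.adjPairs W = G.adjPairs (W.erase v) + 2 * ((W.erase v).filter (G.Adj v)).card := by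
  have : ∃ v ∈ W, (W.filter (G.Adj v)).card ≤ α := by
    by_contra! h
    exact hW (subset_core h)
  obtain ⟨v, hv, hd⟩ := this
  refine ⟨v, hv, ?_, ?_, ?_⟩
  · exact (Finset.card_le_card (Finset.filter_subset_filter _ (Finset.erase_subset _ _))).trans hd
  · intro S hSW hS hvS
    have := Finset.card_le_card (Finset.filter_subset_filter (G.Adj v) hSW)
    have := hS v hvS
    omega
  · rw [← adjPairs_insert (Finset.notMem_erase v W), Finset.insert_erase hv]

theorem adjPairs_le_of_core_subset (α : ℕ) (W : Finset V) (hW : G.core α ⊆ W) :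
    G.adjPairs W + 2 * α * (G.core α).card ≤ G.adjPairs (G.core α) + 2 * α * W.card := by
  induction W using Finset.strongInduction with
  | H W ih =>
    by_cases h : W ⊆ G.core α
    · rw [Finset.Subset.antisymm h hW]
    · obtain ⟨v, hv, hd, hnot, he⟩ := exists_adjPairs_erase h
      have hvc := hnot _ hW fun u hu => lt_card_filter_core hu
      have := ih _ (Finset.erase_ssubset hv) (Finset.subset_erase.2 ⟨hW, hvc⟩)
      rw [he, ← Finset.card_erase_add_one hv]
      nlinarith

theorem adjPairs_le_of_core_eq_empty {k : ℕ} (hcore : G.core k = ∅) (j : ℕ) (W : Finset V)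
    (hW : W.card = k + j) : G.adjPairs W ≤ k * (k - 1) + 2 * k * j := by
  induction j generalizing W with
  | zero => simpa [hW] using G.adjPairs_le_card_mul W
  | succ j ih =>
    have hne : ¬ W ⊆ G.core k := by
      rw [hcore, Finset.subset_empty]
      rintro rfl
      simp at hW
    obtain ⟨v, hv, hd, -, he⟩ := exists_adjPairs_erase hne
    have := ih (W.erase v) (by rw [Finset.card_erase_of_mem hv]; omega)
    rw [he]
    nlinarith

end Fintype

theorem IsPathList.insert_middle {l₁ l₂ : List V} {v : V} (hl : G.IsPathList (l₁ ++ l₂))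
    (hv : v ∉ l₁ ++ l₂) (h1 : ∀ u ∈ l₁.getLast?, G.Adj v u) (h2 : ∀ u ∈ l₂.head?, G.Adj v u) :
    G.IsPathList (l₁ ++ v :: l₂) := by
  obtain ⟨ha, hb, hd, -⟩ := isPathList_append_iff.1 hl
  rw [List.mem_append, not_or] at hv
  refine isPathList_append_iff.2 ⟨ha, ⟨List.isChain_cons.2 ⟨h2, hb.1⟩,
    List.nodup_cons.2 ⟨hv.2, hb.2⟩⟩, ?_, ?_⟩
  · intro u hu hu'
    rcases List.mem_cons.1 hu' with rfl | hu'
    · exact hv.1 hu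
    · exact hd hu hu'
  · intro u hu w hw
    simp only [List.head?_cons, Option.mem_def, Option.some.injEq] at hw
    rw [← hw]
    exact (h1 u hu).symm

theorem IsPathList.two_mul_countP_lt {l : List V} {v : V} (hl : G.IsPathList l) (hne : l ≠ [])
    (hv : v ∉ l) (hno : ∀ l', G.IsPathList l' → ¬ ∀ u, u ∈ l' ↔ u = v ∨ u ∈ l) :
    (∀ u ∈ l.head?, ¬ G.Adj v u) ∧ (∀ u ∈ l.getLast?, ¬ G.Adj v u) ∧
      (l.IsChain fun u w => ¬ (G.Adj v u ∧ G.Adj v w)) ∧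
      2 * l.countP (fun u => decide (G.Adj v u)) < l.length := by
  have h1 : ∀ u ∈ l.head?, ¬ G.Adj v u := by
    intro u hu h
    refine hno _ (IsPathList.insert_middle (l₁ := []) (by simpa using hl) (by simpa using hv)
      (by simp) (fun w hw => by rwa [Option.mem_unique hw hu])) (by simp)
  have h2 : ∀ u ∈ l.getLast?, ¬ G.Adj v u := by
    intro u hu h
    refine hno _ (IsPathList.insert_middle (l₂ := []) (by simpa using hl) (by simpa using hv)
      (fun w hw => by rwa [Option.mem_unique hw hu]) (by simp)) (by simp [or_comm])
  have h3 : l.IsChain fun u w => ¬ (G.Adj v u ∧ G.Adj v w) := by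
    refine isChain_of_forall_split fun l₁ u w l₂ h => ?_
    rintro ⟨hu, hw⟩
    have e : l = (l₁ ++ [u]) ++ (w :: l₂) := by simp [h]
    rw [e] at hl hv
    refine hno _ (hl.insert_middle hv (by simpa using hu) (by simpa using hw)) ?_
    intro x
    simp [e]
    tauto
  refine ⟨h1, h2, h3, ?_⟩
  obtain ⟨a, t, rfl⟩ := List.exists_cons_of_ne_nil hne
  have := countP_add_countP_le (fun u => G.Adj v u) (fun u => G.Adj v u) a t h3
  rw [if_neg (h1 a (by simp)), if_neg (h2 _ (List.getLast?_eq_some_getLast (by simp)))] at this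
  rw [List.length_cons]
  omega

theorem IsPathList.adj_or_adj_of_tight {l : List V} {v : V}
    (h1 : ∀ u ∈ l.head?, ¬ G.Adj v u) (h2 : ∀ u ∈ l.getLast?, ¬ G.Adj v u)
    (h3 : l.IsChain fun u w => ¬ (G.Adj v u ∧ G.Adj v w))
    (ht : l.length ≤ 2 * l.countP (fun u => decide (G.Adj v u)) + 1)
    {l₁ l₂ : List V} {u w : V} (h : l = l₁ ++ u :: w :: l₂) : G.Adj v u ∨ G.Adj v w := by
  by_contra! hcon
  have e : l = (l₁ ++ [u]) ++ (w :: l₂) := by simp [h]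
  obtain ⟨a, t, hat⟩ := List.exists_cons_of_ne_nil (l := l₁ ++ [u]) (by simp)
  have h3' := h3
  rw [e] at h3'
  have ha : ¬ G.Adj v a := h1 a (by rw [e, hat]; simp)
  have hlast : ¬ G.Adj v ((a :: t).getLast (by simp)) := by
    simp only [← hat, List.getLast_append_singleton]
    exact hcon.1
  have c1 := countP_add_countP_le (fun u => G.Adj v u) (fun u => G.Adj v u) a t
    (hat ▸ h3'.left_of_append)
  have c2 := countP_add_countP_le (fun u => G.Adj v u) (fun u => G.Adj v u) w l₂
    h3'.right_of_append
  rw [if_neg ha, if_neg hlast] at c1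
  rw [if_neg hcon.2, if_neg (h2 _ (by
    rw [e, List.getLast?_append_of_ne_nil _ (by simp), List.getLast?_eq_some_getLast (by simp)]
    exact rfl))] at c2
  rw [e, List.countP_append, hat, List.length_append, List.length_cons, List.length_cons] at ht
  omega

theorem IsPathList.not_adj_of_tight {l : List V} {v : V} (hl : G.IsPathList l) (hne : l ≠ [])
    (hv : v ∉ l) (hno : ∀ l', G.IsPathList l' → ¬ ∀ u, u ∈ l' ↔ u = v ∨ u ∈ l)
    (ht : l.length ≤ 2 * l.countP (fun u => decide (G.Adj v u)) + 1)
    {p q : V} (hp : p ∈ l) (hq : q ∈ l) (hvp : ¬ G.Adj v p) (hvq : ¬ G.Adj v q) :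
    ¬ G.Adj p q := by
  obtain ⟨h1, h2, h3, -⟩ := hl.two_mul_countP_lt hne hv hno
  have main : ∀ l₁ l₂ l₃ : List V, ∀ p q, l = l₁ ++ p :: (l₂ ++ q :: l₃) → ¬ G.Adj v p →
      ¬ G.Adj v q → ¬ G.Adj p q := by
    intro l₁ l₂ l₃ p q e hvp hvq hpq
    rcases List.eq_nil_or_concat' l₂ with rfl | ⟨m, z, rfl⟩
    · exact (adj_or_adj_of_tight h1 h2 h3 ht (by simpa using e)).elim hvp hvq
    have hz : G.Adj v z := (adj_or_adj_of_tight h1 h2 h3 ht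
      (show l = (l₁ ++ p :: m) ++ z :: q :: l₃ by simp [e])).resolve_right hvq
    have hlast : ∀ x ∈ l₁.getLast?, G.Adj v x := by
      rcases List.eq_nil_or_concat' l₁ with rfl | ⟨m', w, rfl⟩
      · simp
      · have := (adj_or_adj_of_tight h1 h2 h3 ht
          (show l = m' ++ w :: p :: ((m ++ [z]) ++ q :: l₃) by simp [e])).resolve_right hvp
        simpa using this
    have e' : l = l₁ ++ ((p :: (m ++ [z])) ++ (q :: l₃)) := by simp [e]
    rw [e', isPathList_append_iff, isPathList_append_iff] at hl
    obtain ⟨p1, ⟨p2, p3, d23, -⟩, d1, -⟩ := hl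
    have hQ : G.IsPathList ((p :: (m ++ [z])).reverse ++ (q :: l₃)) := by
      refine isPathList_append_iff.2 ⟨p2.reverse, p3, ?_, ?_⟩
      · exact fun u hu => d23 (List.mem_reverse.1 hu)
      · intro x hx y hy
        rw [List.getLast?_reverse] at hx
        simp only [List.head?_cons, Option.mem_def, Option.some.injEq] at hx hy
        rwa [← hx, ← hy]
    rw [e'] at hv
    refine hno (l₁ ++ v :: ((p :: (m ++ [z])).reverse ++ (q :: l₃)))
      (isPathList_append_iff.2 ⟨p1, ⟨List.isChain_cons.2 ⟨?_, hQ.1⟩,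
        List.nodup_cons.2 ⟨?_, hQ.2⟩⟩, ?_, ?_⟩) ?_
    · intro y hy
      simp only [List.reverse_cons, List.reverse_append, List.reverse_nil, List.nil_append,
        List.cons_append, List.head?_cons, Option.mem_def, Option.some.injEq] at hy
      rwa [← hy]
    · simp at hv ⊢
      tauto
    · intro u hu hu'
      rcases List.mem_cons.1 hu' with rfl | hu'
      · exact hv (List.mem_append_left _ hu)
      · refine d1 hu ?_
        simp at hu' ⊢
        tauto
    · intro x hx y hy
      simp only [List.head?_cons, Option.mem_def, Option.some.injEq] at hy
      rw [← hy]
      exact (hlast x hx).symm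
    · intro u
      simp [e']
      tauto
  obtain ⟨l₁, l₂, rfl⟩ := List.append_of_mem hp
  rcases List.mem_append.1 hq with hq | hq
  · obtain ⟨m₁, m₂, rfl⟩ := List.append_of_mem hq
    exact fun h => main m₁ m₂ l₂ q p (by simp) hvq hvp h.symm
  · rcases List.mem_cons.1 hq with rfl | hq
    · exact G.irrefl
    · obtain ⟨m₁, m₂, rfl⟩ := List.append_of_mem hq
      exact main l₁ m₁ m₂ p q rfl hvp hvq

theorem exists_isPathList_of_bipartite (C : Finset V) : ∀ (D : Finset V) (w : V), w ∉ C → w ∉ D →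
    Disjoint C D → C.card ≤ D.card → (∀ c ∈ C, ∀ d ∈ insert w D, G.Adj c d) →
    ∃ l, G.IsPathList (w :: l) ∧ (∀ v ∈ l, v ∈ C ∨ v ∈ D) ∧ l.length = 2 * C.card := by
  induction C using Finset.induction_on with
  | empty => exact fun D w _ _ _ _ _ => ⟨[], ⟨by simp, by simp⟩, by simp, by simp⟩
  | insert c C hc ih =>
    intro D w hwC hwD hdis hcard hadj
    rw [Finset.card_insert_of_notMem hc] at hcard ⊢
    obtain ⟨d, hd⟩ : D.Nonempty := Finset.card_pos.1 (by omega)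
    have hcD : c ∉ D := Finset.disjoint_left.1 hdis (by simp)
    have hdC : d ∉ insert c C := Finset.disjoint_right.1 hdis hd
    rw [Finset.mem_insert, not_or] at hdC hwC
    obtain ⟨l, hl, hmem, hlen⟩ := ih (D.erase d) d hdC.2 (by simp)
      (hdis.mono (Finset.subset_insert _ _) (Finset.erase_subset _ _))
      (by rw [Finset.card_erase_of_mem hd]; omega)
      (fun x hx y hy => hadj x (by simp [hx]) y (by
        rw [Finset.insert_erase hd] at hy
        simp [hy]))
    have hcw := hadj c (by simp) w (by simp)
    have hcd := hadj c (by simp) d (by simp [hd])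
    refine ⟨c :: d :: l, ⟨?_, ?_⟩, ?_, by simp; omega⟩
    · exact List.isChain_cons_cons.2 ⟨hcw.symm, List.isChain_cons_cons.2 ⟨hcd, hl.1⟩⟩
    · have hn := hl.2
      rw [List.nodup_cons] at hn
      have hcl : c ∉ l := fun h => (hmem c h).elim hc fun h => hcD (Finset.mem_of_mem_erase h)
      have hwl : w ∉ l := fun h => (hmem w h).elim hwC.2 fun h => hwD (Finset.mem_of_mem_erase h)
      have hwd : w ≠ d := fun h => hwD (h ▸ hd)
      simp only [List.nodup_cons, List.mem_cons, not_or]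
      exact ⟨⟨hwC.1, hwd, hwl⟩, ⟨hcd.ne, hcl⟩, hn⟩
    · intro v hv
      simp only [List.mem_cons] at hv
      rcases hv with rfl | rfl | hv
      · simp
      · simp [hd]
      · rcases hmem v hv with h | h
        · simp [h]
        · exact Or.inr (Finset.mem_of_mem_erase h)

/-- Inside `W`, the graph is the join of a clique on `k` vertices and an independent set. -/
def IsCliqueJoinIndep (G : SimpleGraph V) (k : ℕ) (W : Finset V) : Prop :=
  ∃ K ⊆ W, K.card = k ∧ ∀ u ∈ W, ∀ w ∈ W, u ≠ w → (G.Adj u w ↔ u ∈ K ∨ w ∈ K)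

theorem isCliqueJoinIndep_of_adjPairs {k j : ℕ} {W K : Finset V} (hKW : K ⊆ W)
    (hK : K.card = k) (hW : W.card = k + j) (hindep : ∀ u ∈ W, ∀ w ∈ W, G.Adj u w → u ∈ K ∨ w ∈ K)
    (he : k * (k - 1) + 2 * k * j ≤ G.adjPairs W) : G.IsCliqueJoinIndep k W := by
  have hsplit : ∀ f : V → ℕ, ∑ v ∈ W, f v = ∑ v ∈ W \ K, f v + ∑ v ∈ K, f v := fun f =>
    (Finset.sum_sdiff hKW).symm
  have hle : ∀ v ∈ K, (W.filter (G.Adj v)).card ≤ k + j - 1 := by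
    intro v hv
    rw [← hW, ← Finset.card_erase_of_mem (hKW hv)]
    refine Finset.card_le_card fun u hu => ?_
    simp at hu ⊢
    exact ⟨hu.2.ne', hu.1⟩
  have hle' : ∑ v ∈ W \ K, (W.filter (G.Adj v)).card ≤ j * k := by
    have hc : (W \ K).card = j := by rw [Finset.card_sdiff_of_subset hKW]; omega
    rw [← hc, ← smul_eq_mul]
    refine Finset.sum_le_card_nsmul _ _ _ fun v hv => ?_
    rw [← hK]
    refine Finset.card_le_card fun u hu => ?_
    rw [Finset.mem_sdiff] at hv
    rw [Finset.mem_filter] at hu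
    exact (hindep v hv.1 u hu.1 hu.2).resolve_left hv.2
  have hsum : ∑ v ∈ K, (W.filter (G.Adj v)).card = ∑ v ∈ K, (k + j - 1) := by
    refine le_antisymm (Finset.sum_le_sum hle) ?_
    rw [adjPairs, hsplit] at he
    rw [Finset.sum_const, hK, smul_eq_mul]
    have : k * (k + j - 1) + j * k = k * (k - 1) + 2 * k * j := by
      rcases k with _ | k
      · simp
      · rw [show k + 1 + j - 1 = k + j by omega, Nat.add_sub_cancel]; ring
    omega
  have hfull := (Finset.sum_eq_sum_iff_of_le hle).1 hsum
  have hadj : ∀ u ∈ K, ∀ w ∈ W, u ≠ w → G.Adj u w := by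
    intro u hu w hw huw
    have hsub : W.filter (G.Adj u) ⊆ W.erase u := fun x hx => by
      simp at hx ⊢
      exact ⟨hx.2.ne', hx.1⟩
    have := Finset.eq_of_subset_of_card_le hsub
      (by rw [hfull u hu, Finset.card_erase_of_mem (hKW hu), hW])
    have hw' : w ∈ W.filter (G.Adj u) := by
      rw [this]
      exact Finset.mem_erase.2 ⟨huw.symm, hw⟩
    exact (Finset.mem_filter.1 hw').2
  refine ⟨K, hKW, hK, fun u hu w hw huw => ⟨hindep u hu w hw, ?_⟩⟩
  rintro (h | h)
  · exact hadj u h w hw huw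
  · exact (hadj w h u hu huw.symm).symm

theorem IsCliqueJoinIndep.insert {k : ℕ} {W : Finset V} {v : V} (h : G.IsCliqueJoinIndep k W)
    (hno : ∀ l, G.IsPathList l → l.length < 2 * k + 2) (hW : 2 * k + 2 ≤ W.card) (hv : v ∉ W)
    (hd : (W.filter (G.Adj v)).card = k) : G.IsCliqueJoinIndep k (insert v W) := by
  obtain ⟨K, hKW, hK, hadj⟩ := h
  have hsub : W.filter (G.Adj v) ⊆ K := by
    intro w hw
    rw [Finset.mem_filter] at hw
    by_contra hwK
    obtain ⟨l, hl, hmem, hlen⟩ := exists_isPathList_of_bipartite (G := G) K ((W \ K).erase w) w hwK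
      (by simp) (Finset.disjoint_left.2 fun x hx hx' => by simp at hx'; tauto)
      (by
        rw [Finset.card_erase_of_mem (by simp [hw.1, hwK]), Finset.card_sdiff_of_subset hKW]
        omega)
      (by
        intro c hc d hd
        rw [Finset.insert_erase (by simp [hw.1, hwK]), Finset.mem_sdiff] at hd
        exact (hadj c (hKW hc) d hd.1 (by rintro rfl; exact hd.2 hc)).2 (Or.inl hc))
    have hvl : v ∉ w :: l := by
      intro h
      rcases List.mem_cons.1 h with h | h
      · exact hv (h ▸ hw.1)
      · rcases hmem v h with h | h
        · exact hv (hKW h)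
        · simp at h; tauto
    have := hno (v :: w :: l) ⟨List.isChain_cons_cons.2 ⟨hw.2, hl.1⟩,
      List.nodup_cons.2 ⟨hvl, hl.2⟩⟩
    simp at this
    omega
  have heq := Finset.eq_of_subset_of_card_le hsub (by rw [hd, hK])
  have hvK : v ∉ K := fun h => hv (hKW h)
  have hvadj : ∀ w ∈ W, G.Adj v w ↔ w ∈ K := by
    intro w hw
    rw [← heq]
    simp [hw]
  refine ⟨K, hKW.trans (Finset.subset_insert _ _), hK, ?_⟩
  intro u hu w hw huw
  rw [Finset.mem_insert] at hu hw
  rcases hu with rfl | hu <;> rcases hw with rfl | hw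
  · exact absurd rfl huw
  · simp [hvadj w hw, hvK]
  · rw [G.adj_comm, hvadj u hu]
    simp [hvK]
  · exact hadj u hu w hw huw

theorem length_eq_card_of_mem_iff {l : List V} {W : Finset V} (hl : l.Nodup)
    (h : ∀ u, u ∈ l ↔ u ∈ W) : l.length = W.card := by
  rw [← List.toFinset_card_of_nodup hl]
  congr 1
  ext u
  simp [h]

theorem countP_eq_card_filter {l : List V} {W : Finset V} (hl : l.Nodup)
    (h : ∀ u, u ∈ l ↔ u ∈ W) (p : V → Prop) :
    l.countP (fun u => decide (p u)) = (W.filter p).card := by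
  rw [List.countP_eq_length_filter]
  exact length_eq_card_of_mem_iff (hl.filter _) (by simp [h])

section Fintype

variable [Fintype V]

theorem exists_erase_of_adjPairs {k j : ℕ} (hcore : G.core k = ∅) {W : Finset V}
    (hW : W.card = k + (j + 1)) (he : k * (k - 1) + 2 * k * (j + 1) ≤ G.adjPairs W) :
    ∃ v W', v ∉ W' ∧ W = insert v W' ∧ W'.card = k + j ∧ (W'.filter (G.Adj v)).card = k ∧
      k * (k - 1) + 2 * k * j ≤ G.adjPairs W' := by
  have hne : ¬ W ⊆ G.core k := by
    rw [hcore, Finset.subset_empty]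
    rintro rfl
    simp at hW
  obtain ⟨v, hv, hd, -, hev⟩ := exists_adjPairs_erase hne
  have hc : (W.erase v).card = k + j := by rw [Finset.card_erase_of_mem hv]; omega
  have := adjPairs_le_of_core_eq_empty hcore j (W.erase v) hc
  refine ⟨v, W.erase v, by simp, (Finset.insert_erase hv).symm, hc, ?_, ?_⟩ <;> nlinarith

theorem exists_spanning_isPathList {k j : ℕ} (hk : 1 ≤ k) (hj : j ≤ k + 1) (hcore : G.core k = ∅)
    {W : Finset V} (hW : W.card = k + j) (he : k * (k - 1) + 2 * k * j ≤ G.adjPairs W) :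
    ∃ l, G.IsPathList l ∧ ∀ u, u ∈ l ↔ u ∈ W := by
  induction j generalizing W with
  | zero =>
    obtain ⟨K, hKW, hK, hadj⟩ := isCliqueJoinIndep_of_adjPairs (G := G) (K := W) (k := k) (j := 0)
      subset_rfl hW hW (fun u hu w hw _ => Or.inl hu) he
    have hKe : K = W := Finset.eq_of_subset_of_card_le hKW (by omega)
    refine ⟨W.toList, ⟨List.Pairwise.isChain ?_, W.nodup_toList⟩, by simp⟩
    refine W.nodup_toList.imp_of_mem ?_
    intro u w hu hw huw
    rw [Finset.mem_toList] at hu hw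
    exact (hadj u hu w hw huw).2 (Or.inl (hKe ▸ hu))
  | succ j ih =>
    obtain ⟨v, W', hv, rfl, hc, hd, he'⟩ := exists_erase_of_adjPairs hcore hW he
    obtain ⟨l, hl, hmem⟩ := ih (by omega) hc he'
    by_contra! hcon
    have hlen := length_eq_card_of_mem_iff hl.2 hmem
    have := (hl.two_mul_countP_lt (v := v) (by rintro rfl; simp at hlen; omega) (by simpa [hmem])
      (fun l' hl' h => by
        obtain ⟨u, hu⟩ := hcon l' hl'
        simp [h, hmem] at hu
        tauto)).2.2.2
    rw [countP_eq_card_filter hl.2 hmem, hd] at this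
    omega

theorem isCliqueJoinIndep_of_core_eq_empty {k j : ℕ} (hk : 1 ≤ k) (hj : k + 2 ≤ j)
    (hno : ∀ l, G.IsPathList l → l.length < 2 * k + 2) (hcore : G.core k = ∅)
    {W : Finset V} (hW : W.card = k + j) (he : k * (k - 1) + 2 * k * j ≤ G.adjPairs W) :
    G.IsCliqueJoinIndep k W := by
  induction j, hj using Nat.le_induction generalizing W with
  | base =>
    have hW' := hW
    have he' := he
    obtain ⟨v, W', hv, rfl, hc, hd, heW⟩ := exists_erase_of_adjPairs hcore hW he
    obtain ⟨l, hl, hmem⟩ := exists_spanning_isPathList hk le_rfl hcore hc heW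
    have hlen := length_eq_card_of_mem_iff hl.2 hmem
    have hne : l ≠ [] := by rintro rfl; simp at hlen; omega
    have hvl : v ∉ l := by simpa [hmem]
    have hno' : ∀ l', G.IsPathList l' → ¬ ∀ u, u ∈ l' ↔ u = v ∨ u ∈ l := by
      intro l' hl' h
      have h1 := hno l' hl'
      have := length_eq_card_of_mem_iff (W := insert v W') hl'.2 (by simp [h, hmem])
      omega
    have ht : l.length ≤ 2 * l.countP (fun u => decide (G.Adj v u)) + 1 := by
      rw [countP_eq_card_filter hl.2 hmem, hd]
      omega
    refine isCliqueJoinIndep_of_adjPairs (K := W'.filter (G.Adj v))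
      ((Finset.filter_subset _ _).trans (Finset.subset_insert _ _)) hd hW' ?_ he'
    intro u hu w hw huw
    rw [Finset.mem_insert] at hu hw
    simp only [Finset.mem_filter]
    rcases hu with rfl | hu <;> rcases hw with rfl | hw
    · exact absurd huw G.irrefl
    · exact Or.inr ⟨hw, huw⟩
    · exact Or.inl ⟨hu, huw.symm⟩
    · by_contra! hcon
      exact hl.not_adj_of_tight hne hvl hno' ht ((hmem u).2 hu) ((hmem w).2 hw)
        (hcon.1 hu) (hcon.2 hw) huw
  | succ j hj ih =>
    obtain ⟨v, W', hv, rfl, hc, hd, he'⟩ := exists_erase_of_adjPairs hcore hW he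
    exact (ih hc he').insert hno (by omega) hv hd

theorem Connected.isCliqueJoinIndep_univ (hG : G.Connected) {k : ℕ} (hk : 1 ≤ k)
    (hn : 5 * k + 4 < 2 * Fintype.card V)
    (hno : ∀ l, G.IsPathList l → l.length < 2 * k + 2)
    (hmax : ∀ x y, x ≠ y → ¬ G.Adj x y → G.LinksTo (2 * k + 2) x y)
    (he : k * (k - 1) + 2 * k * (Fintype.card V - k) ≤ G.adjPairs Finset.univ) :
    G.IsCliqueJoinIndep k Finset.univ := by
  rcases (G.core k).eq_empty_or_nonempty with hcore | ⟨v, hv⟩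
  · exact isCliqueJoinIndep_of_core_eq_empty hk (j := Fintype.card V - k) (by omega) hno hcore
      (by rw [Finset.card_univ]; omega) he
  exfalso
  have hdeg : ∀ x ∈ G.core k, k + 1 ≤ ((G.core k).filter (G.Adj x)).card :=
    fun x hx => lt_card_filter_core hx
  have hclique : ∀ x ∈ G.core k, ∀ y ∈ G.core k, x ≠ y → G.Adj x y := fun x hx y hy hxy =>
    hG.adj_of_minDegree hno hmax hdeg hdeg (by omega) hx hy hxy
  have hfilter : ∀ x ∈ G.core k, (G.core k).filter (G.Adj x) = (G.core k).erase x := by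
    intro x hx
    ext y
    simp only [Finset.mem_filter, Finset.mem_erase]
    exact ⟨fun h => ⟨h.2.ne', h.1⟩, fun h => ⟨h.2, hclique x hx y h.2 h.1.symm⟩⟩
  have hr1 : k + 2 ≤ (G.core k).card := by
    have h1 := hdeg v hv
    rw [hfilter v hv, Finset.card_erase_of_mem hv] at h1
    omega
  have hr2 : (G.core k).card ≤ 2 * k + 1 := by
    have := hno (G.core k).toList ⟨List.Pairwise.isChain
      ((G.core k).nodup_toList.imp_of_mem fun {u w} hu hw huw =>
        hclique u (Finset.mem_toList.1 hu) w (Finset.mem_toList.1 hw) huw), Finset.nodup_toList _⟩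
    rw [Finset.length_toList] at this
    omega
  obtain ⟨α, hα⟩ : ∃ α, (G.core k).card + α = 2 * k + 1 := ⟨2 * k + 1 - (G.core k).card, by omega⟩
  have hsub : G.core k ⊆ G.core α := subset_core fun u hu => by
    have := hdeg u hu
    omega
  have hcore : G.core α = G.core k := by
    refine Finset.Subset.antisymm (fun y hy => ?_) hsub
    by_contra hyk
    have hyadj : ∀ x ∈ G.core k, G.Adj x y := fun x hx =>
      hG.adj_of_minDegree hno hmax (p := (G.core k).card - 1) (q := α + 1)
        (fun z hz => by rw [hfilter z hz, Finset.card_erase_of_mem hz])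
        (fun z hz => lt_card_filter_core hz) (by omega) hx hy (by rintro rfl; exact hyk hx)
    refine hyk (subset_core (S := insert y (G.core k)) ?_ (Finset.mem_insert_self _ _))
    intro u hu
    rcases Finset.mem_insert.1 hu with rfl | hu
    · have : G.core k ⊆ (insert u (G.core k)).filter (G.Adj u) := fun x hx => by
        simp [hx, (hyadj x hx).symm]
      have := Finset.card_le_card this
      omega
    · exact (hdeg u hu).trans
        (Finset.card_le_card (Finset.filter_subset_filter _ (Finset.subset_insert _ _)))
  have h1 := adjPairs_le_of_core_subset (G := G) α Finset.univ (Finset.subset_univ _)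
  have h2 := G.adjPairs_le_card_mul (G.core k)
  rw [hcore, Finset.card_univ] at h1
  generalize (G.core k).card = r at *
  generalize Fintype.card V = n at *
  obtain ⟨j, rfl⟩ : ∃ j, n = k + j := ⟨n - k, by omega⟩
  obtain ⟨i, rfl⟩ : ∃ i, r = k + 2 + i := ⟨r - (k + 2), by omega⟩
  obtain ⟨k, rfl⟩ : ∃ k', k = k' + 1 := ⟨k - 1, by omega⟩
  simp only [Nat.add_sub_cancel_left, Nat.add_sub_cancel] at he
  rw [show k + 1 + 2 + i - 1 = k + 2 + i by omega] at h2
  obtain rfl : k = i + α := by omega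
  nlinarith

end Fintype

theorem linksTo_of_isPathList_sup_edge {N : ℕ} (hno : ∀ l, G.IsPathList l → l.length < N) {x y : V}
    {l : List V} (hl : (G ⊔ edge x y).IsPathList l) (hlen : N ≤ l.length) : G.LinksTo N x y := by
  have hnc : ¬ l.IsChain G.Adj := fun h => by
    have := hno l ⟨h, hl.2⟩
    omega
  rw [List.isChain_iff_forall_rel_of_append_cons_cons] at hnc
  push Not at hnc
  obtain ⟨u, w, l₁, l₂, rfl, huw⟩ := hnc
  have e : l₁ ++ u :: w :: l₂ = (l₁ ++ [u]) ++ (w :: l₂) := by simp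
  have hl' := hl
  rw [e, isPathList_append_iff] at hl'
  obtain ⟨h1, h2, hd, h3⟩ := hl'
  have hadj := h3 u (by simp) w (by simp)
  rw [sup_adj, edge_adj] at hadj
  have hxy := (hadj.resolve_left huw).1
  have p1 : G.IsPathList (l₁ ++ [u]) := by
    refine ⟨h1.1.imp_of_mem_imp ?_, h1.2⟩
    intro a b ha hb hab
    rw [sup_adj, edge_adj] at hab
    refine hab.resolve_right fun h => ?_
    have hw : w ∉ l₁ ++ [u] := fun h => hd h (by simp)
    rcases h.1 with ⟨rfl, rfl⟩ | ⟨rfl, rfl⟩ <;> rcases hxy with ⟨-, rfl⟩ | ⟨-, rfl⟩ <;> tauto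
  have p2 : G.IsPathList (w :: l₂) := by
    refine ⟨h2.1.imp_of_mem_imp ?_, h2.2⟩
    intro a b ha hb hab
    rw [sup_adj, edge_adj] at hab
    refine hab.resolve_right fun h => ?_
    have hu : u ∉ w :: l₂ := fun h => hd (by simp) h
    rcases h.1 with ⟨rfl, rfl⟩ | ⟨rfl, rfl⟩ <;> rcases hxy with ⟨rfl, -⟩ | ⟨rfl, -⟩ <;> tauto
  have hlink : G.LinksTo N u w := by
    refine ⟨l₁.reverse, l₂, by simpa using p1.reverse, p2, ?_, by simp at hlen ⊢; omega⟩
    have hn := hl.2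
    rw [e, List.nodup_append'] at hn
    rw [List.nodup_append', show u :: l₁.reverse = (l₁ ++ [u]).reverse by simp]
    exact ⟨List.nodup_reverse.2 hn.1, hn.2.1, fun v hv => hd (List.mem_reverse.1 hv)⟩
  rcases hxy with ⟨rfl, rfl⟩ | ⟨rfl, rfl⟩
  · exact hlink
  · exact hlink.symm

theorem IsCliqueJoinIndep.adjPairs_eq {k : ℕ} {W : Finset V} (h : G.IsCliqueJoinIndep k W) :
    G.adjPairs W = k * (k - 1) + 2 * k * (W.card - k) := by
  obtain ⟨K, hKW, hK, hadj⟩ := h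
  have h1 : ∀ v ∈ K, (W.filter (G.Adj v)).card = W.card - 1 := by
    intro v hv
    rw [← Finset.card_erase_of_mem (hKW hv)]
    congr 1
    ext u
    simp only [Finset.mem_filter, Finset.mem_erase]
    exact ⟨fun h => ⟨h.2.ne', h.1⟩,
      fun h => ⟨h.2, (hadj v (hKW hv) u h.2 h.1.symm).2 (Or.inl hv)⟩⟩
  have h2 : ∀ v ∈ W \ K, (W.filter (G.Adj v)).card = k := by
    intro v hv
    rw [Finset.mem_sdiff] at hv
    rw [← hK]
    congr 1
    ext u
    simp only [Finset.mem_filter]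
    refine ⟨fun h => ((hadj v hv.1 u h.1 h.2.ne).1 h.2).resolve_left hv.2, fun h => ⟨hKW h, ?_⟩⟩
    exact (hadj v hv.1 u (hKW h) (by rintro rfl; exact hv.2 h)).2 (Or.inr h)
  rw [adjPairs, ← Finset.sum_sdiff hKW, Finset.sum_congr rfl h1, Finset.sum_congr rfl h2,
    Finset.sum_const, Finset.sum_const, Finset.card_sdiff_of_subset hKW, hK]
  obtain ⟨j, hj⟩ : ∃ j, W.card = k + j := ⟨W.card - k, by have := Finset.card_le_card hKW; omega⟩
  rw [hj, Nat.add_sub_cancel_left, smul_eq_mul, smul_eq_mul]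
  rcases k with _ | k
  · simp
  · rw [show k + 1 + j - 1 = k + j by omega, Nat.add_sub_cancel]; ring

variable [Fintype V]

theorem IsCliqueJoinIndep.nonempty_iso {H : SimpleGraph V} {k : ℕ}
    (hG : G.IsCliqueJoinIndep k Finset.univ) (hH : H.IsCliqueJoinIndep k Finset.univ) :
    Nonempty (G ≃g H) := by
  obtain ⟨K, -, hK, hadj⟩ := hG
  obtain ⟨L, -, hL, hadj'⟩ := hH
  let e : {v // v ∈ K} ≃ {v // v ∈ L} := Finset.equivOfCardEq (hK.trans hL.symm)
  have hmem : ∀ v, e.extendSubtype v ∈ L ↔ v ∈ K := fun v =>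
    ⟨fun h => by
      by_contra hv
      exact e.extendSubtype_not_mem v hv h, fun h => e.extendSubtype_mem v h⟩
  refine ⟨⟨e.extendSubtype, ?_⟩⟩
  intro u w
  by_cases huw : u = w
  · simp [huw]
  · rw [hadj' _ (by simp) _ (by simp) (by simpa using huw), hadj u (by simp) w (by simp) huw,
      hmem, hmem]

theorem two_mul_card_edgeSet : 2 * Nat.card G.edgeSet = G.adjPairs Finset.univ := by
  rw [Nat.card_eq_fintype_card, ← edgeFinset_card, ← sum_degrees_eq_twice_card_edges, adjPairs]
  refine Finset.sum_congr rfl fun v _ => ?_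
  rw [← card_neighborFinset_eq_degree, neighborFinset_eq_filter]

theorem Connected.isCliqueJoinIndep_of_adjPairs (hG : G.Connected) {k : ℕ} (hk : 1 ≤ k)
    (hn : 5 * k + 4 < 2 * Fintype.card V)
    (hno : ∀ l, G.IsPathList l → l.length < 2 * k + 2)
    (he : k * (k - 1) + 2 * k * (Fintype.card V - k) ≤ G.adjPairs Finset.univ) :
    G.IsCliqueJoinIndep k Finset.univ := by
  obtain ⟨G', hle, hmax⟩ := Finite.exists_le_maximal
    (p := fun H : SimpleGraph V => ∀ l, H.IsPathList l → l.length < 2 * k + 2) hno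
  have hlink : ∀ x y, x ≠ y → ¬ G'.Adj x y → G'.LinksTo (2 * k + 2) x y := by
    intro x y hxy hadj
    by_contra hcon
    have hlt := G'.lt_sup_edge x y hxy hadj
    refine hmax.not_prop_of_gt hlt fun l hl => ?_
    by_contra! hlen
    exact hcon (linksTo_of_isPathList_sup_edge hmax.prop hl hlen)
  have hmono : G.adjPairs Finset.univ ≤ G'.adjPairs Finset.univ :=
    Finset.sum_le_sum fun v _ => Finset.card_le_card
      (Finset.monotone_filter_right _ fun u _ hu => hle hu)
  have h' := (hG.mono hle).isCliqueJoinIndep_univ hk hn hmax.prop hlink (he.trans hmono)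
  have heq : G = G' := by
    have hcard := h'.adjPairs_eq
    rw [← two_mul_card_edgeSet, Finset.card_univ] at hcard
    rw [← two_mul_card_edgeSet] at he
    rw [← edgeSet_inj]
    refine Set.eq_of_subset_of_ncard_le (edgeSet_mono hle) ?_
    rw [← Nat.card_coe_set_eq, ← Nat.card_coe_set_eq]
    omega
  rwa [heq]

end

end SimpleGraph

theorem isCliqueJoinIndep_Snk {n k : ℕ} (h : k ≤ n) :
    (Snk n k).IsCliqueJoinIndep k Finset.univ := by
  refine ⟨Finset.univ.filter fun i : Fin n => (i : ℕ) < k, Finset.subset_univ _, ?_, ?_⟩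
  · rw [Fin.card_filter_val_lt, min_eq_right h]
  · intro u _ w _ huw
    simp only [Snk, SimpleGraph.fromRel_adj, Finset.mem_filter, Finset.mem_univ, true_and]
    tauto

theorem hasPathOn_of_isPathList {V : Type*} {G : SimpleGraph V} {m : ℕ} (hm : m ≠ 0) {l : List V}
    (hl : G.IsPathList l) (hlen : m ≤ l.length) : HasPathOn G m := by
  have hne : l.take m ≠ [] := by
    rw [← List.length_pos_iff, List.length_take]
    omega
  refine ⟨_, _, SimpleGraph.Walk.ofSupport (l.take m) hne (hl.1.take m), ?_, ?_⟩
  · rw [SimpleGraph.Walk.isPath_def, SimpleGraph.Walk.support_ofSupport]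
    exact hl.2.sublist (List.take_sublist _ _)
  · rw [SimpleGraph.Walk.support_ofSupport, List.length_take, min_eq_left hlen]

/-- Balister–Győri–Lehel–Schelp (i): a connected graph of order `n > (5k+4)/2`
with `e(G) ≥ e(S_{n,k})` contains `P_{2k+2}` unless `G ≅ S_{n,k}`. -/
theorem stmt_12 (k n : ℕ) (hk : 1 ≤ k) (hn : 5 * k + 4 < 2 * n) (G : SimpleGraph (Fin n))
    (hconn : G.Connected) (he : edgeCount (Snk n k) ≤ edgeCount G) :
    HasPathOn G (2 * k + 2) ∨ Nonempty (G ≃g Snk n k) := by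
  by_cases hpath : ∃ l, G.IsPathList l ∧ 2 * k + 2 ≤ l.length
  · obtain ⟨l, hl, hlen⟩ := hpath
    exact Or.inl (hasPathOn_of_isPathList (by omega) hl hlen)
  push Not at hpath
  have hS := isCliqueJoinIndep_Snk (n := n) (k := k) (by omega)
  have hcard := hS.adjPairs_eq
  rw [← SimpleGraph.two_mul_card_edgeSet] at hcard
  unfold edgeCount at he
  refine Or.inr ((hconn.isCliqueJoinIndep_of_adjPairs hk (by simpa using hn) hpath ?_).nonempty_iso
    hS)
  rw [← SimpleGraph.two_mul_card_edgeSet, ← Finset.card_univ, ← hcard]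
  omega
end

section
/- Let k ≥ 1, n > (5k+4)/2, and let G be a connected simple graph of order n. If e(G) ≥ e(S_{n,k}^+), then G contains a path on 2k+3 vertices as a subgraph, unless G is isomorphic to S_{n,k}^+. -/
open Matrix BigOperators

open SimpleGraph

section Lists

variable {X : Type*}

theorem List.exists_first_split {p : X → Prop} {l : List X} (h : ∃ a ∈ l, p a) :
    ∃ l₁ a l₂, l = l₁ ++ a :: l₂ ∧ p a ∧ ∀ b ∈ l₁, ¬ p b := by
  induction l with
  | nil => simp at h
  | cons c t ih =>
    by_cases hc : p c
    · exact ⟨[], c, t, rfl, hc, by simp⟩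
    · obtain ⟨l₁, a, l₂, rfl, ha, hl⟩ := ih (by simpa [hc] using h)
      exact ⟨c :: l₁, a, l₂, rfl, ha, by simpa [hc] using hl⟩

theorem List.exists_last_split {p : X → Prop} {l : List X} (h : ∃ a ∈ l, p a) :
    ∃ l₁ a l₂, l = l₁ ++ a :: l₂ ∧ p a ∧ ∀ b ∈ l₂, ¬ p b := by
  obtain ⟨l₁, a, l₂, hl, ha, hb⟩ := List.exists_first_split (l := l.reverse) (by simpa using h)
  exact ⟨l₂.reverse, a, l₁.reverse, by simpa using congrArg List.reverse hl, ha, by simpa using hb⟩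

theorem List.countP_add_countP_le_of_head (p q : X → Prop) [DecidablePred p] [DecidablePred q]
    {l : List X} (h : l.IsChain fun u v => ¬ (q u ∧ p v)) (hl : ∀ a ∈ l.head?, ¬ p a) :
    l.countP p + l.countP q ≤ l.length := by
  have key : l.countP p + l.countP q ≤ l.length + if ∃ a ∈ l.head?, p a then 1 else 0 := by
    clear hl
    induction l with
    | nil => simp
    | cons a t ih =>
      cases t with
      | nil =>
        by_cases h1 : p a <;> by_cases h2 : q a <;> simp [h1, h2]
      | cons b t =>
        have h' := (List.isChain_cons_cons.1 h)
        have := ih h'.2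
        have h'' := h'.1
        rw [List.countP_cons (a := a), List.countP_cons (a := a)]
        by_cases h1 : p a <;> by_cases h2 : q a <;> by_cases h3 : p b <;>
          simp [h1, h2, h3] at this h'' ⊢ <;> omega
  rw [if_neg (by rintro ⟨a, ha, hpa⟩; exact hl a ha hpa)] at key
  exact key

theorem List.countP_add_countP_le_of_getLast (p q : X → Prop) [DecidablePred p] [DecidablePred q]
    {l : List X} (h : l.IsChain fun u v => ¬ (q u ∧ p v)) (hl : ∀ a ∈ l.getLast?, ¬ q a) :
    l.countP p + l.countP q ≤ l.length := by
  have := List.countP_add_countP_le_of_head q p (l := l.reverse)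
    (List.isChain_reverse.2 (h.imp fun a b hab hc => hab ⟨hc.2, hc.1⟩)) (by simpa using hl)
  simp only [List.countP_reverse, List.length_reverse] at this
  omega

theorem List.exists_minimal_crossing (p q : X → Prop) (P₁ : List X) (v : X) (P₂ : List X) (u : X)
    (P₃ : List X) (hv : q v) (hu : p u) :
    ∃ Q₁ v' Q₂ u' Q₃, P₁ ++ v :: (P₂ ++ u :: P₃) = Q₁ ++ v' :: (Q₂ ++ u' :: Q₃) ∧ q v' ∧ p u' ∧
      ∀ z ∈ Q₂, ¬ p z ∧ ¬ q z := by
  by_cases h : ∀ z ∈ P₂, ¬ p z ∧ ¬ q z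
  · exact ⟨P₁, v, P₂, u, P₃, rfl, hv, hu, h⟩
  · obtain ⟨z, hz, hpq⟩ : ∃ z ∈ P₂, p z ∨ q z := by
      by_contra! h'
      exact h h'
    obtain ⟨A, B, rfl⟩ := List.append_of_mem hz
    rcases hpq with hp | hq
    · have := exists_minimal_crossing p q P₁ v A z (B ++ u :: P₃) hv hp
      simpa using this
    · have := exists_minimal_crossing p q (P₁ ++ v :: A) z B u P₃ hq hu
      simpa using this
termination_by P₂.length
decreasing_by all_goals simp_all <;> omega

end Lists

section Cycles

variable {X : Type*}

/-- A list of distinct vertices, consecutive ones adjacent, whose last vertex is adjacent to the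
first. -/
def IsCycleList (Γ : SimpleGraph X) (C : List X) : Prop :=
  C.IsChain Γ.Adj ∧ C.Nodup ∧ ∀ a ∈ C.head?, ∀ b ∈ C.getLast?, Γ.Adj b a

theorem SimpleGraph.isChain_adj_reverse {Γ : SimpleGraph X} {l : List X} :
    l.reverse.IsChain Γ.Adj ↔ l.IsChain Γ.Adj := by
  rw [List.isChain_reverse]
  simp only [Γ.adj_comm]

open Classical in
/-- Pósa's rotation: two crossing chords at the ends of a path give a long cycle. -/
theorem exists_cycle_of_crossing {Γ : SimpleGraph X} {P : List X} {x y : X}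
    (hP : P.IsChain Γ.Adj) (hnd : P.Nodup) (hx : P.head? = some x) (hy : P.getLast? = some y)
    {P₁ P₂ P₃ : List X} {v u : X} (hcr : P = P₁ ++ v :: (P₂ ++ u :: P₃))
    (hv : Γ.Adj y v) (hu : Γ.Adj x u) :
    ∃ C, IsCycleList Γ C ∧ C ⊆ P ∧
      (C.length = P.length ∨ P.countP (Γ.Adj x) + P.countP (Γ.Adj y) ≤ C.length) := by
  have build : ∀ Q₁ v' Q₂ u' Q₃, P = Q₁ ++ v' :: (Q₂ ++ u' :: Q₃) → Γ.Adj y v' → Γ.Adj x u' →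
      IsCycleList Γ ((Q₁ ++ [v']) ++ (u' :: Q₃).reverse) := by
    rintro Q₁ v' Q₂ u' Q₃ rfl hv' hu'
    have h1 : (Q₁ ++ [v']).IsChain Γ.Adj := hP.prefix ⟨Q₂ ++ u' :: Q₃, by simp⟩
    have h2 : (u' :: Q₃).IsChain Γ.Adj := hP.suffix ⟨Q₁ ++ v' :: Q₂, by simp⟩
    refine ⟨?_, ?_, ?_⟩
    · refine List.IsChain.append h1 (SimpleGraph.isChain_adj_reverse.2 h2) ?_
      have : (u' :: Q₃).getLast? = some y := by
        rw [← hy]; simp [List.getLast?_append, List.getLast?_cons]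
      rw [List.head?_reverse, this]
      simpa using hv'.symm
    · have : (Q₁ ++ [v'] ++ u' :: Q₃).Nodup := by
        refine hnd.sublist ?_
        simp
      refine (List.Perm.nodup_iff ?_).1 this
      exact List.Perm.append_left _ (List.reverse_perm _).symm
    · have : (Q₁ ++ [v'] ++ (u' :: Q₃).reverse).head? = some x := by
        rw [← hx]; cases Q₁ <;> simp
      have h3 : (Q₁ ++ [v'] ++ (u' :: Q₃).reverse).getLast? = some u' := by
        rw [List.getLast?_append, List.getLast?_reverse]; simp
      rw [this, h3]
      simpa using hu'.symm
  by_cases hch : P.IsChain fun a b => ¬ (Γ.Adj y a ∧ Γ.Adj x b)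
  · obtain ⟨Q₁, v', Q₂, u', Q₃, hQ, hv', hu', hmin⟩ :=
      List.exists_minimal_crossing (Γ.Adj x) (Γ.Adj y) P₁ v P₂ u P₃ hv hu
    rw [← hcr] at hQ
    refine ⟨_, build _ _ _ _ _ hQ hv' hu', ?_, Or.inr ?_⟩
    · rw [hQ]; intro z; simp; tauto
    · have c1 := List.countP_add_countP_le_of_head (Γ.Adj x) (Γ.Adj y) (l := Q₁ ++ [v'])
        (hch.prefix ⟨Q₂ ++ u' :: Q₃, by simp [hQ]⟩) (by
          have : (Q₁ ++ [v']).head? = some x := by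
            rw [← hx, hQ]; cases Q₁ <;> simp
          rw [this]; simp)
      have c2 := List.countP_add_countP_le_of_getLast (Γ.Adj x) (Γ.Adj y) (l := u' :: Q₃)
        (hch.suffix ⟨Q₁ ++ v' :: Q₂, by simp [hQ]⟩) (by
          have : (u' :: Q₃).getLast? = some y := by
            rw [← hy, hQ]; simp [List.getLast?_append, List.getLast?_cons]
          rw [this]; simp)
      have d1 : Q₂.countP (Γ.Adj x) = 0 := by
        rw [List.countP_eq_zero]; simpa using fun z hz => (hmin z hz).1
      have d2 : Q₂.countP (Γ.Adj y) = 0 := by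
        rw [List.countP_eq_zero]; simpa using fun z hz => (hmin z hz).2
      have e : P = (Q₁ ++ [v']) ++ (Q₂ ++ (u' :: Q₃)) := by simp [hQ]
      rw [e]
      simp only [List.countP_append, d1, d2, List.length_append, List.length_reverse] at c1 c2 ⊢
      omega
  · rw [List.isChain_iff_forall_rel_of_append_cons_cons] at hch
    push Not at hch
    obtain ⟨a, b, l₁, l₂, hl, ha, hb⟩ := hch
    refine ⟨_, build l₁ a [] b l₂ (by simpa using hl) ha hb, ?_, Or.inl ?_⟩
    · rw [hl]; intro z; simp; tauto
    · rw [hl]; simp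

end Cycles

section Cone

variable {V : Type*}

theorem List.countP_lt_length_of_mem {X : Type*} {p : X → Bool} {l : List X} {a : X} (ha : a ∈ l)
    (hp : ¬ p a) : l.countP p < l.length :=
  lt_of_le_of_ne List.countP_le_length fun h => hp (List.countP_eq_length.1 h a ha)

theorem List.exists_append_head {X : Type*} (p : X → Prop) (l : List X) :
    ∃ l₁ l₂, l = l₁ ++ l₂ ∧ (∀ b ∈ l₁, ¬ p b) ∧ ∀ a ∈ l₂.head?, p a := by
  by_cases h : ∃ a ∈ l, p a
  · obtain ⟨l₁, a, l₂, rfl, ha, hl⟩ := List.exists_first_split h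
    exact ⟨l₁, a :: l₂, rfl, hl, by simpa using ha⟩
  · push Not at h
    exact ⟨l, [], by simp, h, by simp⟩

theorem List.exists_append_getLast {X : Type*} (p : X → Prop) (l : List X) :
    ∃ l₁ l₂, l = l₁ ++ l₂ ∧ (∀ b ∈ l₂, ¬ p b) ∧ ∀ a ∈ l₁.getLast?, p a := by
  by_cases h : ∃ a ∈ l, p a
  · obtain ⟨l₁, a, l₂, rfl, ha, hl⟩ := List.exists_last_split h
    exact ⟨l₁ ++ [a], l₂, by simp, hl, by simpa using ha⟩
  · push Not at h
    exact ⟨[], l, by simp, h, by simp⟩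

/-- The graph obtained from `G` by adding a vertex `none` adjacent to all other vertices. -/
def SimpleGraph.cone (G : SimpleGraph V) : SimpleGraph (Option V) where
  Adj a b := match a, b with
    | none, none => False
    | some u, some v => G.Adj u v
    | _, _ => True
  symm := ⟨by
    rintro (_ | u) (_ | v) h
    · exact h
    · trivial
    · trivial
    · exact G.symm.1 _ _ h⟩
  loopless := ⟨by
    rintro (_ | u) h
    · exact h
    · exact G.loopless.irrefl u h⟩

@[simp] theorem SimpleGraph.cone_adj_some {G : SimpleGraph V} {u v : V} :
    G.cone.Adj (some u) (some v) ↔ G.Adj u v := Iff.rfl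

@[simp] theorem SimpleGraph.cone_adj_some_none {G : SimpleGraph V} {u : V} :
    G.cone.Adj (some u) none := trivial

@[simp] theorem SimpleGraph.cone_adj_none_some {G : SimpleGraph V} {u : V} :
    G.cone.Adj none (some u) := trivial

theorem SimpleGraph.Connected.exists_path_between {G : SimpleGraph V} (hG : G.Connected)
    {A B : V → Prop} {x y : V} (hx : A x) (hy : B y) (hAB : ∀ v, A v → ¬ B v) :
    ∃ u Q v, A u ∧ B v ∧ (u :: Q ++ [v]).IsChain G.Adj ∧ (u :: Q ++ [v]).Nodup ∧
      ∀ z ∈ Q, ¬ A z ∧ ¬ B z := by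
  classical
  obtain ⟨w⟩ := hG.preconnected x y
  have hp := w.toPath.2
  obtain ⟨l₁, v, l₂, hl, hv, hl₁⟩ := List.exists_first_split (p := B)
    (l := (w.toPath : G.Walk x y).support) ⟨y, Walk.end_mem_support _, hy⟩
  have hc := Walk.isChain_adj_support (w.toPath : G.Walk x y)
  have hnd := hp.support_nodup
  have hxl : x ∈ l₁ := by
    have h1 : (w.toPath : G.Walk x y).support.head? = some x := by
      rw [← Walk.cons_tail_support]; rfl
    rw [hl] at h1
    cases l₁ with
    | nil =>
      simp at h1
      exact absurd hv (h1 ▸ hAB x hx)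
    | cons a t => simp at h1; simp [h1]
  obtain ⟨m₁, u, Q, rfl, hu, hQ⟩ := List.exists_last_split (p := A) ⟨x, hxl, hx⟩
  rw [hl] at hc hnd
  refine ⟨u, Q, v, hu, hv, hc.infix ⟨m₁, l₂, by simp⟩, hnd.sublist
    (List.IsInfix.sublist ⟨m₁, l₂, by simp⟩), fun z hz => ⟨hQ z hz, hl₁ z (by simp [hz])⟩⟩

open Classical in
theorem exists_cycle_of_no_crossing {G : SimpleGraph V} (hG : G.Connected) {P : List (Option V)}
    {x y : V} (hP : P.IsChain G.cone.Adj) (hnd : P.Nodup) (hx : P.head? = some (some x))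
    (hy : P.getLast? = some (some y)) (hw : none ∈ P)
    (hnc : ∀ P₁ v P₂ u P₃, P = P₁ ++ v :: (P₂ ++ u :: P₃) → G.cone.Adj (some y) v →
      ¬ G.cone.Adj (some x) u) :
    ∃ C, IsCycleList G.cone C ∧
      P.countP (G.cone.Adj (some x)) + P.countP (G.cone.Adj (some y)) ≤ C.length := by
  obtain ⟨Pa, Pb, rfl⟩ := List.append_of_mem hw
  have hYa : ∀ v ∈ Pa, ¬ G.cone.Adj (some y) v := by
    intro v hv hyv
    obtain ⟨A, B, rfl⟩ := List.append_of_mem hv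
    exact hnc A v B none Pb (by simp) hyv (by simp)
  have hXb : ∀ v ∈ Pb, ¬ G.cone.Adj (some x) v := by
    intro v hv hxv
    obtain ⟨A, B, rfl⟩ := List.append_of_mem hv
    exact hnc Pa none A v B (by simp) (by simp) hxv
  have hxa : some x ∈ Pa := by
    cases Pa with
    | nil => simp at hx
    | cons a t => simp at hx; simp [hx]
  have hyb : some y ∈ Pb := by
    rcases List.eq_nil_or_concat Pb with rfl | ⟨t, a, rfl⟩
    · simp at hy
    · rw [List.getLast?_append] at hy
      simp [List.getLast?_cons] at hy; simp [hy]
  obtain ⟨u, Q, v, hu, hv, hQc, hQn, hQ⟩ := hG.exists_path_between (A := fun a => some a ∈ Pa)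
    (B := fun a => some a ∈ Pb) hxa hyb (fun a ha hb => by
      have := (List.nodup_append.1 hnd).2.2 _ ha (some a) (by simp [hb])
      exact this rfl)
  obtain ⟨A₁, A₂, rfl⟩ := List.append_of_mem hu
  obtain ⟨D₁, D₂, rfl⟩ := List.append_of_mem hv
  obtain ⟨B₁, M₁, rfl, hB₁, hM₁⟩ := List.exists_append_head (G.cone.Adj (some x)) A₂
  obtain ⟨M₂, E₁, rfl, hE₁, hM₂⟩ := List.exists_append_getLast (G.cone.Adj (some y)) D₁
  have k1 : (A₁ ++ [some u]).IsChain G.cone.Adj :=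
    hP.prefix ⟨B₁ ++ M₁ ++ none :: (M₂ ++ E₁ ++ some v :: D₂), by simp⟩
  have k3 : ([some v] ++ D₂).IsChain G.cone.Adj :=
    hP.suffix ⟨(A₁ ++ some u :: (B₁ ++ M₁)) ++ none :: (M₂ ++ E₁), by simp⟩
  have k4 : (M₁ ++ none :: M₂).IsChain G.cone.Adj :=
    hP.infix ⟨A₁ ++ some u :: B₁, E₁ ++ some v :: D₂, by simp⟩
  have k2 : ([some u] ++ (Q.map some ++ [some v])).IsChain G.cone.Adj := by
    have : ((u :: Q ++ [v]).map some).IsChain G.cone.Adj := by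
      rw [List.isChain_map]; exact hQc
    simpa using this
  have k12 := List.IsChain.append_overlap k1 k2 (by simp)
  have k123 := List.IsChain.append_overlap (l₁ := A₁ ++ [some u] ++ Q.map some) (l₂ := [some v])
    (by simpa using k12) k3 (by simp)
  have hlast3 : ([some v] ++ D₂).getLast? = some (some y) := by
    rw [← hy]; simp [List.getLast?_append, List.getLast?_cons]
  have hhead1 : (A₁ ++ [some u]).head? = some (some x) := by
    rw [← hx]; cases A₁ <;> simp
  have hxm : some x ∈ A₁ ++ [some u] := List.mem_of_mem_head? hhead1
  have hym : some y ∈ [some v] ++ D₂ := List.mem_of_getLast? hlast3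
  refine ⟨(A₁ ++ [some u] ++ Q.map some ++ [some v] ++ D₂) ++ (M₁ ++ none :: M₂).reverse,
    ⟨?_, ?_, ?_⟩, ?_⟩
  · refine List.IsChain.append k123 (SimpleGraph.isChain_adj_reverse.2 k4) ?_
    have : (A₁ ++ [some u] ++ Q.map some ++ [some v] ++ D₂).getLast? = some (some y) := by
      rw [List.append_assoc _ [some v], List.getLast?_append, hlast3]; rfl
    rw [this]
    rintro a ⟨⟩ b hb
    rw [List.head?_reverse, List.getLast?_append] at hb
    rcases List.eq_nil_or_concat M₂ with rfl | ⟨t, c, rfl⟩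
    · simp at hb; subst hb; simp
    · simp [List.getLast?_cons] at hb hM₂
      subst hb; exact hM₂
  · have h1 : (A₁ ++ [some u] ++ (M₁ ++ none :: M₂) ++ ([some v] ++ D₂)).Nodup := by
      refine hnd.sublist ?_
      simp only [List.append_assoc, List.cons_append, List.nil_append]
      refine List.Sublist.append_left (List.Sublist.cons_cons _ ?_) _
      refine (List.Sublist.append_left ?_ _).trans (List.sublist_append_right _ _)
      refine List.Sublist.cons_cons _ (List.Sublist.append_left (List.sublist_append_right _ _) _)
    have h2 : (Q.map some ++ (A₁ ++ [some u] ++ (M₁ ++ none :: M₂) ++ ([some v] ++ D₂))).Nodup := by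
      refine List.nodup_append.2 ⟨?_, h1, ?_⟩
      · refine List.Nodup.map (Option.some_injective _) ?_
        exact hQn.sublist (List.IsInfix.sublist ⟨[u], [v], by simp⟩)
      · rintro a ha b hb rfl
        obtain ⟨q, hq, rfl⟩ := List.mem_map.1 ha
        have := hQ q hq
        simp at this hb
        tauto
    refine (List.Perm.nodup_iff ?_).1 h2
    rw [List.perm_iff_count]
    intro a
    simp only [List.count_append, List.count_reverse]
    omega
  · intro a ha b hb
    have h1 : (A₁ ++ [some u] ++ Q.map some ++ [some v] ++ D₂ ++
        (M₁ ++ none :: M₂).reverse).head? = some (some x) := by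
      rw [← hx]; cases A₁ <;> simp
    rw [h1] at ha
    cases ha
    rw [List.getLast?_append, List.getLast?_reverse] at hb
    cases M₁ with
    | nil => simp at hb; subst hb; simp
    | cons c t =>
      simp at hb hM₁
      subst hb
      exact hM₁.symm
  · have c1 := List.countP_lt_length_of_mem (p := fun b => decide (G.cone.Adj (some x) b)) hxm
      (by simp)
    have c2 := List.countP_lt_length_of_mem (p := fun b => decide (G.cone.Adj (some y) b)) hym
      (by simp)
    have z1 : B₁.countP (fun b => decide (G.cone.Adj (some x) b)) = 0 :=
      List.countP_eq_zero.2 (by simpa using hB₁)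
    have z2 : E₁.countP (fun b => decide (G.cone.Adj (some y) b)) = 0 :=
      List.countP_eq_zero.2 (by simpa using hE₁)
    have z3 : (M₂ ++ E₁ ++ some v :: D₂).countP (fun b => decide (G.cone.Adj (some x) b)) = 0 :=
      List.countP_eq_zero.2 fun b hb => by simpa using hXb b hb
    have z4 : (A₁ ++ some u :: (B₁ ++ M₁)).countP (fun b => decide (G.cone.Adj (some y) b)) = 0 :=
      List.countP_eq_zero.2 fun b hb => by simpa using hYa b hb
    have l1 := List.countP_le_length (p := fun b => decide (G.cone.Adj (some x) b)) (l := M₁)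
    have l2 := List.countP_le_length (p := fun b => decide (G.cone.Adj (some y) b)) (l := M₂)
    simp only [List.countP_append, List.countP_cons, List.countP_nil, List.length_append,
      List.length_reverse, List.length_cons, List.length_map, List.length_nil,
      SimpleGraph.cone_adj_some_none, decide_true, if_true] at c1 c2 z3 z4 ⊢
    omega

end Cone

section PathFree

variable {V : Type*}

/-- Every path of `G` with all its vertices in `T` has fewer than `m` vertices. -/
def PathFree (T : Finset V) (m : ℕ) (G : SimpleGraph V) : Prop :=
  ∀ l : List V, l.IsChain G.Adj → l.Nodup → (∀ v ∈ l, v ∈ T) → l.length < m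

theorem List.exists_eq_map_some {l : List (Option V)} (h : none ∉ l) :
    ∃ l' : List V, l = l'.map some := by
  induction l with
  | nil => exact ⟨[], rfl⟩
  | cons a t ih =>
    simp only [List.mem_cons, not_or] at h
    obtain ⟨t', rfl⟩ := ih h.2
    obtain ⟨b, rfl⟩ := Option.ne_none_iff_exists'.1 (Ne.symm h.1)
    exact ⟨b :: t', rfl⟩

theorem PathFree.length_le_of_isCycleList {T : Finset V} {m : ℕ} {G : SimpleGraph V}
    (hG : PathFree T m G) {C : List (Option V)} (hC : IsCycleList G.cone C)
    (hT : ∀ v, some v ∈ C → v ∈ T) : C.length ≤ m := by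
  have key : ∀ D : List (Option V), D.IsChain G.cone.Adj → D.Nodup →
      (∀ v, some v ∈ D → v ∈ T) → none ∉ D → D.length < m := by
    intro D h1 h2 h3 h4
    obtain ⟨l, rfl⟩ := List.exists_eq_map_some h4
    rw [List.isChain_map] at h1
    rw [List.length_map]
    exact hG l h1 h2.of_map fun v hv => h3 v (List.mem_map_of_mem hv)
  obtain ⟨h1, h2, h3⟩ := hC
  by_cases hn : none ∈ C
  · obtain ⟨C₁, C₂, rfl⟩ := List.append_of_mem hn
    have h2' := List.nodup_middle.1 h2
    have := key (C₂ ++ C₁) ?_ ?_ ?_ ?_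
    · simp only [List.length_append, List.length_cons] at this ⊢; omega
    · refine List.IsChain.append (h1.suffix ⟨C₁ ++ [none], by simp⟩) h1.left_of_append ?_
      intro a ha b hb
      refine h3 b ?_ a ?_
      · rw [List.head?_append, hb]; rfl
      · rw [List.getLast?_append, List.getLast?_cons, ha]; rfl
    · exact List.nodup_append_comm.1 h2'.of_cons
    · intro v hv; apply hT; simp at hv ⊢; tauto
    · have := (List.nodup_cons.1 h2').1; simp at this ⊢; tauto
  · exact (key C h1 h2 hT hn).le

theorem PathFree.exists_maximal [Finite V] {T : Finset V} {m : ℕ} {G : SimpleGraph V}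
    (hG : PathFree T m G) : ∃ Γ, G ≤ Γ ∧ Maximal (PathFree T m) Γ :=
  Finite.exists_le_maximal hG

theorem exists_path_of_maximal {T : Finset V} {m : ℕ} {G : SimpleGraph V}
    (hG : Maximal (PathFree T m) G) {x y : V} (hxy : x ≠ y) (hadj : ¬ G.Adj x y) :
    ∃ P : List (Option V), P.IsChain G.cone.Adj ∧ P.Nodup ∧ P.head? = some (some x) ∧
      P.getLast? = some (some y) ∧ none ∈ P ∧ (∀ v, some v ∈ P → v ∈ T) ∧ m + 1 ≤ P.length := by
  have hnf : ¬ PathFree T m (G ⊔ edge x y) := by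
    intro h
    have h1 : G ⊔ edge x y ≤ G := hG.2 h le_sup_left
    exact hadj (h1 (Or.inr ((edge_adj x y x y).2 ⟨Or.inl ⟨rfl, rfl⟩, hxy⟩)))
  unfold PathFree at hnf
  push Not at hnf
  obtain ⟨l, hc, hnd, hlT, hlm⟩ := hnf
  have hnc : ¬ l.IsChain G.Adj := fun h => absurd (hG.1 l h hnd hlT) (by omega)
  rw [List.isChain_iff_forall_rel_of_append_cons_cons] at hnc
  push Not at hnc
  obtain ⟨a, b, l₁, l₂, rfl, hab⟩ := hnc
  have hab' : (a = x ∧ b = y) ∨ (a = y ∧ b = x) := by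
    have h1 : (G ⊔ edge x y).Adj a b := List.isChain_iff_forall_rel_of_append_cons_cons.1 hc rfl
    rcases h1 with h1 | h1
    · exact absurd h1 hab
    · exact ((edge_adj x y a b).1 h1).1
  have hlift : ∀ s : List V, s.IsChain (G ⊔ edge x y).Adj → (a ∉ s ∨ b ∉ s) → s.IsChain G.Adj := by
    intro s hs hsn
    refine hs.imp_of_mem_imp fun u v hu hv huv => ?_
    rcases huv with h1 | h1
    · exact h1
    · have := ((edge_adj x y u v).1 h1).1
      exfalso
      rcases hab' with ⟨rfl, rfl⟩ | ⟨rfl, rfl⟩ <;> rcases this with ⟨rfl, rfl⟩ | ⟨rfl, rfl⟩ <;>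
        tauto
  have hnd' : (l₁ ++ [a] ++ b :: l₂).Nodup := by simpa using hnd
  have hdis := (List.nodup_append.1 hnd').2.2
  have k1 : (l₁ ++ [a]).IsChain G.Adj := hlift _ (hc.prefix ⟨b :: l₂, by simp⟩)
    (Or.inr fun h => hdis b h b (by simp) rfl)
  have k2 : (b :: l₂).IsChain G.Adj := hlift _ (hc.suffix ⟨l₁ ++ [a], by simp⟩)
    (Or.inl fun h => hdis a (by simp) a h rfl)
  have main : ∃ P : List (Option V), P.IsChain G.cone.Adj ∧ P.Nodup ∧ P.head? = some (some a) ∧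
      P.getLast? = some (some b) ∧ none ∈ P ∧ (∀ v, some v ∈ P → v ∈ T) ∧ m + 1 ≤ P.length := by
    have j1 : ((l₁ ++ [a]).reverse.map some).IsChain G.cone.Adj := by
      rw [List.isChain_map]; exact SimpleGraph.isChain_adj_reverse.2 k1
    have j2 : ((b :: l₂).reverse.map some).IsChain G.cone.Adj := by
      rw [List.isChain_map]; exact SimpleGraph.isChain_adj_reverse.2 k2
    refine ⟨(l₁ ++ [a]).reverse.map some ++ none :: (b :: l₂).reverse.map some,
      ?_, ?_, ?_, ?_, ?_, ?_, ?_⟩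
    · refine List.IsChain.append j1 (List.IsChain.cons j2 ?_) ?_
      · intro c hc
        obtain ⟨d, -, rfl⟩ := List.mem_map.1 (List.mem_of_mem_head? hc)
        simp
      · intro c hc d hd
        obtain ⟨e, -, rfl⟩ := List.mem_map.1 (List.mem_of_getLast? hc)
        simp at hd
        subst hd; simp
    · rw [List.nodup_middle, List.nodup_cons]
      refine ⟨by simp, ?_⟩
      rw [← List.map_append]
      refine List.Nodup.map (Option.some_injective _) ?_
      refine (List.Perm.nodup_iff ?_).1 hnd'
      exact List.Perm.append (List.reverse_perm _).symm (List.reverse_perm _).symm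
    · simp
    · rw [List.getLast?_append, List.getLast?_cons]; simp
    · simp
    · intro v hv
      apply hlT
      simp at hv ⊢
      tauto
    · simp at hlm ⊢; omega
  obtain ⟨P, h1, h2, h3, h4, h5, h6, h7⟩ := main
  rcases hab' with ⟨rfl, rfl⟩ | ⟨rfl, rfl⟩
  · exact ⟨P, h1, h2, h3, h4, h5, h6, h7⟩
  · exact ⟨P.reverse, SimpleGraph.isChain_adj_reverse.2 h1, List.nodup_reverse.2 h2,
      by simpa using h4, by simpa using h3, by simpa using h5, by simpa using h6, by simpa using h7⟩

open Classical in
theorem PathFree.countP_add_countP_le {T : Finset V} {m : ℕ} {G : SimpleGraph V}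
    (hG : PathFree T m G) {P : List (Option V)} {x y : V} (hP : P.IsChain G.cone.Adj)
    (hnd : P.Nodup) (hx : P.head? = some (some x)) (hy : P.getLast? = some (some y))
    (hw : none ∈ P) (hT : ∀ v, some v ∈ P → v ∈ T) (hxy : ¬ G.Adj x y) (hm : m + 1 ≤ P.length)
    (hor : (G.Connected ∧ ∀ v, v ∈ T) ∨ P.length ≤ m + 1) :
    P.countP (G.cone.Adj (some x)) + P.countP (G.cone.Adj (some y)) ≤ m := by
  have hcr : ∀ P₁ v P₂ u P₃, P = P₁ ++ v :: (P₂ ++ u :: P₃) → G.cone.Adj (some y) v →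
      G.cone.Adj (some x) u →
      P.countP (G.cone.Adj (some x)) + P.countP (G.cone.Adj (some y)) ≤ m := by
    intro P₁ v P₂ u P₃ h hv hu
    obtain ⟨C, hC, hCP, hlen⟩ := exists_cycle_of_crossing hP hnd hx hy h hv hu
    have := hG.length_le_of_isCycleList hC fun v hv => hT v (hCP hv)
    omega
  rcases hor with ⟨hcon, huniv⟩ | hlen
  · by_cases hno : ∀ P₁ v P₂ u P₃, P = P₁ ++ v :: (P₂ ++ u :: P₃) → G.cone.Adj (some y) v →
      ¬ G.cone.Adj (some x) u
    · obtain ⟨C, hC, hlen⟩ := exists_cycle_of_no_crossing hcon hP hnd hx hy hw hno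
      have := hG.length_le_of_isCycleList hC fun v _ => huniv v
      omega
    · push Not at hno
      obtain ⟨P₁, v, P₂, u, P₃, h, hv, hu⟩ := hno
      exact hcr P₁ v P₂ u P₃ h hv hu
  · by_cases hch : P.IsChain fun a b => ¬ (G.cone.Adj (some y) a ∧ G.cone.Adj (some x) b)
    · cases P with
      | nil => simp at hx
      | cons a t =>
        simp only [List.head?_cons, Option.some.injEq] at hx
        subst hx
        have := List.countP_add_countP_le_of_getLast (G.cone.Adj (some x)) (G.cone.Adj (some y))
          hch.tail (by
            intro b hb
            have : (some x :: t).getLast? = some b := by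
              rw [List.getLast?_cons]
              simp only [List.tail_cons] at hb
              rw [hb]; rfl
            rw [hy] at this
            cases this
            simp)
        have h1 : ¬ G.Adj y x := fun h => hxy h.symm
        simp only [List.tail_cons, List.length_cons, List.countP_cons] at this hlen ⊢
        simp [h1]
        omega
    · rw [List.isChain_iff_forall_rel_of_append_cons_cons] at hch
      push Not at hch
      obtain ⟨a, b, l₁, l₂, h, ha, hb⟩ := hch
      exact hcr l₁ a [] b l₂ h ha hb

open Classical in
theorem card_add_one_le_countP {G : SimpleGraph V} {x : V} {S : Finset V} {P : List (Option V)}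
    (hS : ∀ v ∈ S, G.Adj x v ∧ some v ∈ P) (hw : none ∈ P) :
    S.card + 1 ≤ P.countP (G.cone.Adj (some x)) := by
  rw [← Finset.card_insertNone, List.countP_eq_length_filter]
  refine le_trans (Finset.card_le_card ?_) (List.toFinset_card_le _)
  intro a ha
  rw [List.mem_toFinset, List.mem_filter]
  cases a with
  | none => exact ⟨hw, by simp⟩
  | some v =>
    have := hS v (by simpa using ha)
    exact ⟨this.2, by simpa using this.1⟩

/-- The number of neighbours of `v` inside `T`. -/
noncomputable def degIn (G : SimpleGraph V) (T : Finset V) (v : V) : ℕ :=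
  open Classical in (T.filter (G.Adj v)).card

theorem degIn_mono {G Γ : SimpleGraph V} (h : G ≤ Γ) {S T : Finset V} (hST : S ⊆ T) (v : V) :
    degIn G S v ≤ degIn Γ T v := by
  classical
  refine Finset.card_le_card fun a ha => ?_
  simp only [Finset.mem_filter] at ha ⊢
  exact ⟨hST ha.1, h ha.2⟩

/-- If `x` and `y` have many neighbours in `A` and `B` respectively, for all `x ∈ A` and `y ∈ B`,
then in a connected edge-maximal path-free graph `A` and `B` are completely joined. -/
theorem adj_of_degIn_add_le [Fintype V] {m : ℕ} {G : SimpleGraph V} (hcon : G.Connected)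
    (hG : Maximal (PathFree Finset.univ m) G) {A B : Finset V} {a b : ℕ}
    (hA : ∀ x ∈ A, a ≤ degIn G A x) (hB : ∀ y ∈ B, b ≤ degIn G B y) (hab : m ≤ a + b + 1)
    {x y : V} (hx : x ∈ A) (hy : y ∈ B) (hxy : x ≠ y) : G.Adj x y := by
  classical
  by_contra hadj
  let good : ℕ → Prop := fun N => ∃ (P : List (Option V)) (x y : V), P.IsChain G.cone.Adj ∧
    P.Nodup ∧ P.head? = some (some x) ∧ P.getLast? = some (some y) ∧ none ∈ P ∧ m + 1 ≤ P.length ∧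
    x ∈ A ∧ y ∈ B ∧ x ≠ y ∧ ¬ G.Adj x y ∧ P.length = N
  have hbd : ∀ N, good N → N ≤ Fintype.card (Option V) := by
    rintro N ⟨P, x, y, -, hnd, -, -, -, -, -, -, -, -, rfl⟩
    exact hnd.length_le_card
  have hex : ∃ N, good N := by
    obtain ⟨P, h1, h2, h3, h4, h5, -, h7⟩ := exists_path_of_maximal hG hxy hadj
    exact ⟨_, P, x, y, h1, h2, h3, h4, h5, h7, hx, hy, hxy, hadj, rfl⟩
  obtain ⟨N₀, hN₀⟩ := hex
  have hmax := Nat.findGreatest_spec (P := good) (hbd N₀ hN₀) hN₀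
  have hgr : ∀ N, good N → N ≤ Nat.findGreatest good (Fintype.card (Option V)) :=
    fun N hN => Nat.le_findGreatest (hbd N hN) hN
  obtain ⟨P, x, y, hP, hnd, hhd, hlt, hw, hm, hx, hy, hxy, hadj, hPN⟩ := hmax
  rw [← hPN] at hgr
  have hxP : some x ∈ P := List.mem_of_mem_head? hhd
  have hyP : some y ∈ P := List.mem_of_getLast? hlt
  have hcyc : ∀ z : V, some z ∉ P → G.Adj x z → ¬ G.Adj y z := by
    intro z hz hxz hyz
    have : IsCycleList G.cone (some z :: P) := by
      refine ⟨List.IsChain.cons hP ?_, List.nodup_cons.2 ⟨hz, hnd⟩, ?_⟩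
      · rw [hhd]; rintro _ ⟨⟩; exact hxz.symm
      · rw [List.getLast?_cons, hlt]; simpa using hyz
    have := hG.1.length_le_of_isCycleList this (by simp)
    simp at this; omega
  have hAP : ∀ z ∈ A, G.Adj x z → some z ∈ P := by
    intro z hz hxz
    by_contra hzP
    have := hgr (P.length + 1) ⟨some z :: P, z, y, List.IsChain.cons hP (by
      rw [hhd]; rintro _ ⟨⟩; exact hxz.symm), List.nodup_cons.2 ⟨hzP, hnd⟩, by simp, by
      rw [List.getLast?_cons, hlt]; rfl, by simp [hw], by simp; omega, hz, hy, by
      rintro rfl; exact hzP hyP, fun h => hcyc z hzP hxz h.symm, by simp⟩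
    omega
  have hBP : ∀ z ∈ B, G.Adj y z → some z ∈ P := by
    intro z hz hyz
    by_contra hzP
    have := hgr (P.length + 1) ⟨P ++ [some z], x, z, List.IsChain.append hP (by simp) (by
      rw [hlt]; rintro _ ⟨⟩ _ ⟨⟩; exact hyz), by
      rw [List.nodup_append_comm]; exact List.nodup_cons.2 ⟨hzP, hnd⟩, by
      rw [List.head?_append, hhd]; rfl, by
      simp, by simp [hw], by simp; omega, hx, hz, by
      rintro rfl; exact hzP hxP, fun h => hcyc z hzP h hyz, by simp⟩
    omega
  have hs := hG.1.countP_add_countP_le hP hnd hhd hlt hw (by simp) hadj hm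
    (Or.inl ⟨hcon, by simp⟩)
  have c1 := card_add_one_le_countP (G := G) (x := x) (S := A.filter (G.Adj x)) (P := P)
    (by simpa using fun v hv h => ⟨h, hAP v hv h⟩) hw
  have c2 := card_add_one_le_countP (G := G) (x := y) (S := B.filter (G.Adj y)) (P := P)
    (by simpa using fun v hv h => ⟨h, hBP v hv h⟩) hw
  have d1 := hA x hx
  have d2 := hB y hy
  unfold degIn at d1 d2
  omega

/-- Ore's condition: in a graph on `T` that is edge-maximal without a path covering `T`,
nonadjacent vertices have small degree sum. -/
theorem degIn_add_degIn_lt {T : Finset V} {G : SimpleGraph V}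
    (hG : Maximal (PathFree T T.card) G) {x y : V} (hxy : x ≠ y)
    (hadj : ¬ G.Adj x y) : degIn G T x + degIn G T y + 2 ≤ T.card := by
  classical
  obtain ⟨P, h1, h2, h3, h4, h5, h6, h7⟩ := exists_path_of_maximal hG hxy hadj
  have hsub : P.toFinset ⊆ Finset.insertNone T := by
    intro a ha
    cases a with
    | none => simp
    | some v => simpa using h6 v (by simpa using ha)
  have hlen : P.toFinset.card = P.length := List.toFinset_card_of_nodup h2
  have heq : P.toFinset = Finset.insertNone T := by
    refine Finset.eq_of_subset_of_card_le hsub ?_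
    rw [Finset.card_insertNone, hlen]; exact h7
  have hT : ∀ v ∈ T, some v ∈ P := by
    intro v hv
    rw [← List.mem_toFinset, heq]; simpa using hv
  have hs := hG.1.countP_add_countP_le h1 h2 h3 h4 h5 h6 hadj h7 (Or.inr (by
    rw [← hlen, heq, Finset.card_insertNone]))
  have c1 := card_add_one_le_countP (G := G) (x := x) (S := T.filter (G.Adj x)) (P := P)
    (by simpa using fun v hv h => ⟨h, hT v hv⟩) h5
  have c2 := card_add_one_le_countP (G := G) (x := y) (S := T.filter (G.Adj y)) (P := P)
    (by simpa using fun v hv h => ⟨h, hT v hv⟩) h5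
  unfold degIn
  omega

end PathFree

section Tight

variable {V : Type*}

theorem PathFree.mono {T S : Finset V} {m : ℕ} {G : SimpleGraph V} (h : PathFree T m G)
    (hST : S ⊆ T) : PathFree S m G :=
  fun l h1 h2 h3 => h l h1 h2 fun v hv => hST (h3 v hv)

theorem PathFree.exists_not_adj {T : Finset V} {m : ℕ} {G : SimpleGraph V} (h : PathFree T m G)
    (hm : m ≤ T.card) : ∃ x ∈ T, ∃ y ∈ T, x ≠ y ∧ ¬ G.Adj x y := by
  by_contra! hcl
  have hp : T.toList.Pairwise G.Adj := T.nodup_toList.pairwise_of_forall_ne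
    fun a ha b hb hab => hcl a (by simpa using ha) b (by simpa using hb) hab
  have := h T.toList hp.isChain T.nodup_toList (by simp)
  rw [Finset.length_toList] at this
  omega

theorem card_le_degIn {G : SimpleGraph V} {S T : Finset V} (hST : S ⊆ T) {v : V}
    (h : ∀ w ∈ S, G.Adj v w) : S.card ≤ degIn G T v := by
  classical
  exact Finset.card_le_card fun w hw => Finset.mem_filter.2 ⟨hST hw, h w hw⟩

theorem card_le_degIn_add_one {G : SimpleGraph V} {S T : Finset V} (hST : S ⊆ T) {v : V}
    (h : ∀ w ∈ S, v ≠ w → G.Adj v w) : S.card ≤ degIn G T v + 1 := by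
  classical
  have h1 := card_le_degIn (G := G) (S := S.erase v) (T := T) (v := v)
    ((Finset.erase_subset _ _).trans hST)
    fun w hw => h w (Finset.mem_of_mem_erase hw) (Finset.ne_of_mem_erase hw).symm
  have := Finset.pred_card_le_card_erase (s := S) (a := v)
  omega

open Classical in
theorem degIn_eq_erase_add {G : SimpleGraph V} {T : Finset V} {y : V} (hy : y ∈ T) (v : V) :
    degIn G T v = degIn G (T.erase y) v + if G.Adj v y then 1 else 0 := by
  unfold degIn
  rw [Finset.filter_erase]
  split_ifs with h
  · rw [Finset.card_erase_add_one (by simp [hy, h])]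
  · rw [Finset.erase_eq_of_notMem (by simp [h]), add_zero]

/-- The sum of the degrees in the subgraph induced by `T`. -/
noncomputable def degSum (G : SimpleGraph V) (T : Finset V) : ℕ := ∑ v ∈ T, degIn G T v

open Classical in
theorem degSum_eq_erase_add {G : SimpleGraph V} {T : Finset V} {y : V} (hy : y ∈ T) :
    degSum G T = degSum G (T.erase y) + 2 * degIn G T y := by
  have h1 : ∑ v ∈ T.erase y, (if G.Adj v y then 1 else 0) = degIn G T y := by
    rw [degIn_eq_erase_add hy y, if_neg (G.loopless.irrefl y), add_zero, ← Finset.card_filter]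
    unfold degIn
    simp only [G.adj_comm]
  unfold degSum
  rw [← Finset.add_sum_erase T _ hy, Finset.sum_congr rfl fun v _ => degIn_eq_erase_add hy v,
    Finset.sum_add_distrib, h1]
  ring

open Classical in
theorem degSum_le {G : SimpleGraph V} (P : Finset V → Prop) (r d : ℕ)
    (h : ∀ T, P T → r < T.card → ∃ y ∈ T, degIn G T y ≤ d ∧ P (T.erase y)) (T : Finset V)
    (hT : P T) (hr : r ≤ T.card) : degSum G T + 2 * d * r ≤ r * (r - 1) + 2 * d * T.card := by
  induction hn : T.card generalizing T with
  | zero =>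
    obtain rfl := Finset.card_eq_zero.1 hn
    simp only [Finset.card_empty, Nat.le_zero] at hr
    simp [degSum, hr]
  | succ n ih =>
    rcases hr.lt_or_eq with hr' | hr'
    · obtain ⟨y, hy, hd, hP⟩ := h T hT hr'
      have hc := Finset.card_erase_of_mem hy
      have := ih (T.erase y) hP (by omega) (by omega)
      rw [degSum_eq_erase_add hy]
      linarith
    · rw [← hn, hr']
      have : degSum G T ≤ ∑ v ∈ T, (T.card - 1) := by
        refine Finset.sum_le_sum fun v hv => ?_
        rw [← Finset.card_erase_of_mem hv]
        refine Finset.card_le_card fun w hw => ?_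
        simp only [Finset.mem_filter] at hw
        exact Finset.mem_erase.2 ⟨hw.2.ne', hw.1⟩
      simp only [Finset.sum_const, smul_eq_mul] at this
      omega

/-- If `H` is a clique on `k + 2` of the `2k + 3` vertices of `T`, every other vertex of `T` has at
least `k` neighbours in `T`, and no path covers `T`, then all vertices of `T \ H` have the same
`k` neighbours. -/
theorem exists_common_neighbors [Finite V] {G : SimpleGraph V} {H T : Finset V} {k : ℕ}
    (hHT : H ⊆ T) (hH : ∀ x ∈ H, ∀ y ∈ H, x ≠ y → G.Adj x y) (hHc : H.card = k + 2)
    (hTc : T.card = 2 * k + 3) (hfree : PathFree T (2 * k + 3) G)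
    (hdeg : ∀ u ∈ T, u ∉ H → k ≤ degIn G T u)
    (hind : (∀ u ∈ T, u ∉ H → degIn G T u ≤ k) →
      ∀ u ∈ T, u ∉ H → ∀ v ∈ T, v ∉ H → ¬ G.Adj u v) :
    ∃ S ⊆ H, S.card = k ∧ ∀ u ∈ T, u ∉ H → ∀ v ∈ T, G.Adj u v ↔ v ∈ S := by
  classical
  rw [← hTc] at hfree
  obtain ⟨Γ, hle, hmax⟩ := hfree.exists_maximal
  have ore : ∀ x y, x ≠ y → ¬ Γ.Adj x y → degIn Γ T x + degIn Γ T y ≤ 2 * k + 1 := by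
    intro x y h1 h2
    have := degIn_add_degIn_lt hmax h1 h2
    omega
  have hHdeg : ∀ v ∈ H, k + 1 ≤ degIn Γ T v := by
    intro v hv
    have := card_le_degIn_add_one (G := Γ) hHT fun w hw hvw => hle (hH v hv w hw hvw)
    omega
  have hmin : ∀ v ∈ T, k ≤ degIn Γ T v := by
    intro v hv
    by_cases hvH : v ∈ H
    · exact (Nat.le_succ k).trans (hHdeg v hvH)
    · exact (hdeg v hv hvH).trans (degIn_mono hle subset_rfl v)
  set D := T.filter fun v => k + 2 ≤ degIn Γ T v with hD
  have hdom : ∀ v ∈ D, ∀ w ∈ T, v ≠ w → Γ.Adj v w := by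
    intro v hv w hw hvw
    by_contra hadj
    have := ore v w hvw hadj
    have := hmin w hw
    have := (Finset.mem_filter.1 hv).2
    omega
  have hDT : D ⊆ T := Finset.filter_subset _ _
  have hDk : D.card ≤ k := by
    by_contra! hDk
    obtain ⟨x, hx, y, hy, hxy, hadj⟩ := hmax.1.exists_not_adj le_rfl
    have hx' : x ∉ D := fun h => hadj (hdom x h y hy hxy)
    have hy' : y ∉ D := fun h => hadj (hdom y h x hx hxy.symm).symm
    have h1 := card_le_degIn (G := Γ) hDT (v := x)
      fun w hw => (hdom w hw x hx (by rintro rfl; exact hx' hw)).symm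
    have h2 := card_le_degIn (G := Γ) hDT (v := y)
      fun w hw => (hdom w hw y hy (by rintro rfl; exact hy' hw)).symm
    have := ore x y hxy hadj
    omega
  have hout : ∀ u ∈ T, u ∉ H → degIn Γ T u ≤ k := by
    intro u hu huH
    by_contra! hlt
    have hcl : ∀ x ∈ insert u H, ∀ y ∈ insert u H, x ≠ y → Γ.Adj x y := by
      have hge : ∀ x ∈ insert u H, k + 1 ≤ degIn Γ T x := by
        intro x hx
        rcases Finset.mem_insert.1 hx with rfl | hx
        · exact hlt
        · exact hHdeg x hx
      intro x hx y hy hxy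
      by_contra hadj
      have := ore x y hxy hadj
      have h1 := hge x hx
      have h2 := hge y hy
      omega
    have hsub : insert u H ⊆ T := Finset.insert_subset hu hHT
    have hcard : (insert u H).card = k + 3 := by rw [Finset.card_insert_of_notMem huH, hHc]
    have hDs : insert u H ⊆ D := by
      intro x hx
      have := card_le_degIn_add_one (G := Γ) hsub (v := x) (hcl x hx)
      exact Finset.mem_filter.2 ⟨hsub hx, by omega⟩
    have := Finset.card_le_card hDs
    omega
  have hDH : D ⊆ H := by
    intro v hv
    by_contra hvH
    have := hout v (hDT hv) hvH
    have := (Finset.mem_filter.1 hv).2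
    omega
  have hind' := hind fun u hu huH => (degIn_mono hle subset_rfl u).trans (hout u hu huH)
  have hnb : ∀ u ∈ T, u ∉ H → T.filter (G.Adj u) = D := by
    intro u hu huH
    have heq : T.filter (G.Adj u) = T.filter (Γ.Adj u) := by
      refine Finset.eq_of_subset_of_card_le ?_ ?_
      · intro v hv
        simp only [Finset.mem_filter] at hv ⊢
        exact ⟨hv.1, hle hv.2⟩
      · exact (hout u hu huH).trans (hdeg u hu huH)
    refine Finset.Subset.antisymm ?_ ?_
    · intro v hv
      obtain ⟨hvT, huv⟩ := Finset.mem_filter.1 hv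
      have hvH : v ∈ H := by
        by_contra hvH
        exact hind' u hu huH v hvT hvH huv
      have h1 := card_le_degIn_add_one (G := Γ) (S := insert u H) (v := v)
        (Finset.insert_subset hu hHT) (by
          intro w hw hvw
          rcases Finset.mem_insert.1 hw with rfl | hw
          · exact hle huv.symm
          · exact hle (hH v hvH w hw hvw))
      rw [Finset.card_insert_of_notMem huH] at h1
      exact Finset.mem_filter.2 ⟨hvT, by omega⟩
    · intro v hv
      rw [heq]
      refine Finset.mem_filter.2 ⟨hDT hv, (hdom v hv u hu ?_).symm⟩
      rintro rfl
      exact huH (hDH hv)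
  obtain ⟨u, hu, huH⟩ : ∃ u ∈ T, u ∉ H := by
    by_contra! h
    have := Finset.card_le_card (show T ⊆ H from h)
    omega
  refine ⟨D, hDH, ?_, ?_⟩
  · refine le_antisymm hDk ?_
    rw [← hnb u hu huH]
    exact hdeg u hu huH
  · intro u hu huH v hv
    rw [← hnb u hu huH]
    simp [hv]

theorem exists_common_neighbors_of_tight [Finite V] {G : SimpleGraph V} {H : Finset V} {k : ℕ}
    (hk : 1 ≤ k) (hH : ∀ x ∈ H, ∀ y ∈ H, x ≠ y → G.Adj x y) (hHc : H.card = k + 2)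
    (hcore : ∀ T, H ⊆ T → T ≠ H → ∃ y ∈ T, y ∉ H ∧ degIn G T y ≤ k) (T : Finset V)
    (hfree : PathFree T (2 * k + 3) G) (hHT : H ⊆ T) (hTc : 2 * k + 3 ≤ T.card)
    (htight : (k + 2) * (k + 1) + 2 * k * T.card ≤ degSum G T + 2 * k * (k + 2)) :
    ∃ S ⊆ H, S.card = k ∧ ∀ u ∈ T, u ∉ H → ∀ v ∈ T, G.Adj u v ↔ v ∈ S := by
  classical
  have hb : ∀ T, H ⊆ T → degSum G T + 2 * k * (k + 2) ≤ (k + 2) * (k + 1) + 2 * k * T.card := by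
    intro T hT
    refine degSum_le (H ⊆ ·) (k + 2) k ?_ T hT (hHc ▸ Finset.card_le_card hT)
    intro T hT hlt
    obtain ⟨y, hy, hyH, hd⟩ := hcore T hT (by rintro rfl; omega)
    refine ⟨y, hy, hd, fun v hv => Finset.mem_erase.2 ⟨?_, hT hv⟩⟩
    rintro rfl; exact hyH hv
  have herase : ∀ T : Finset V, H ⊆ T → ∀ y ∉ H, H ⊆ T.erase y := by
    intro T hT y hyH v hv
    refine Finset.mem_erase.2 ⟨?_, hT hv⟩
    rintro rfl; exact hyH hv
  have hdeg : ∀ T, H ⊆ T →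
      (k + 2) * (k + 1) + 2 * k * T.card ≤ degSum G T + 2 * k * (k + 2) →
      ∀ y ∈ T, y ∉ H → k ≤ degIn G T y := by
    intro T hT ht y hy hyH
    have h1 := hb _ (herase T hT y hyH)
    rw [degSum_eq_erase_add hy] at ht
    have h2 := Finset.card_erase_add_one hy
    rw [← h2] at ht
    linarith
  have htie : ∀ T,
      (k + 2) * (k + 1) + 2 * k * T.card ≤ degSum G T + 2 * k * (k + 2) →
      ∀ y ∈ T, y ∉ H → degIn G T y ≤ k →
      (k + 2) * (k + 1) + 2 * k * (T.erase y).card ≤ degSum G (T.erase y) + 2 * k * (k + 2) := by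
    intro T ht y hy hyH hd
    rw [degSum_eq_erase_add hy] at ht
    have h2 := Finset.card_erase_add_one hy
    rw [← h2] at ht
    linarith
  induction hn : T.card generalizing T with
  | zero => omega
  | succ n ih =>
    rcases hTc.lt_or_eq with hlt | heq
    · obtain ⟨y, hy, hyH, hd⟩ := hcore T hHT (by rintro rfl; omega)
      have hHy := herase T hHT y hyH
      have hc := Finset.card_erase_add_one hy
      obtain ⟨S, hSH, hSc, hS⟩ := ih (T.erase y) (hfree.mono (Finset.erase_subset _ _)) hHy
        (by omega) (htie T htight y hy hyH hd) (by omega)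
      obtain ⟨W, hW, hWT, hWc⟩ := Finset.exists_subsuperset_card_eq
        (s := H ∪ insert y (T.filter (G.Adj y))) (t := T) (n := 2 * k + 3)
        (Finset.union_subset hHT (Finset.insert_subset hy (Finset.filter_subset _ _))) (by
          refine (Finset.card_union_le _ _).trans ?_
          have := Finset.card_insert_le y (T.filter (G.Adj y))
          unfold degIn at hd
          omega) hlt.le
      have hHW : H ⊆ W := Finset.subset_union_left.trans hW
      have hyW : y ∈ W := hW (by simp)
      have hNW : T.filter (G.Adj y) ⊆ W := fun v hv =>
        hW (Finset.mem_union_right _ (Finset.mem_insert_of_mem hv))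
      have hSW : ∀ u ∈ W, u ∉ H → u ≠ y → ∀ v ∈ W, v ≠ y → (G.Adj u v ↔ v ∈ S) :=
        fun u hu huH huy v hv hvy => hS u (Finset.mem_erase.2 ⟨huy, hWT hu⟩) huH v
          (Finset.mem_erase.2 ⟨hvy, hWT hv⟩)
      have hyS : ∀ v ∈ H, v ≠ y := by rintro v hv rfl; exact hyH hv
      have hW' := exists_common_neighbors hHW hH hHc hWc (hfree.mono hWT) ?_ ?_
      · obtain ⟨S', hSH', hSc', hS'⟩ := hW'
        obtain ⟨z, hzW, hzH, hzy⟩ : ∃ z ∈ W, z ∉ H ∧ z ≠ y := by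
          by_contra! h
          have h1 : W ⊆ insert y H := by
            intro v hv
            by_cases hvH : v ∈ H
            · exact Finset.mem_insert_of_mem hvH
            · rw [h v hv hvH]; exact Finset.mem_insert_self _ _
          have h2 := Finset.card_le_card h1
          have h3 := Finset.card_insert_le y H
          omega
        have hSS : ∀ v ∈ H, v ∈ S ↔ v ∈ S' := fun v hv => by
          rw [← hSW z hzW hzH hzy v (hHW hv) (hyS v hv), hS' z hzW hzH v (hHW hv)]
        refine ⟨S, hSH, hSc, ?_⟩
        intro u hu huH v hv
        by_cases huy : u = y
        · subst huy
          constructor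
          · intro h
            have hvW : v ∈ W := hNW (Finset.mem_filter.2 ⟨hv, h⟩)
            have hvS := (hS' u hyW hyH v hvW).1 h
            exact (hSS v (hSH' hvS)).2 hvS
          · intro h
            exact (hS' u hyW hyH v (hHW (hSH h))).2 ((hSS v (hSH h)).1 h)
        · by_cases hvy : v = y
          · subst hvy
            constructor
            · intro h
              have huW : u ∈ W := hNW (Finset.mem_filter.2 ⟨hu, h.symm⟩)
              exact absurd (hSH' ((hS' v hyW hyH u huW).1 h.symm)) huH
            · intro h
              exact absurd (hSH h) hyH
          · exact hS u (Finset.mem_erase.2 ⟨huy, hu⟩) huH v (Finset.mem_erase.2 ⟨hvy, hv⟩)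
      · intro u hu huH
        by_cases huy : u = y
        · subst huy
          refine (hdeg T hHT htight u hy hyH).trans ?_
          exact card_le_degIn hNW fun w hw => (Finset.mem_filter.1 hw).2
        · rw [← hSc]
          exact card_le_degIn (hSH.trans hHW) fun w hw =>
            (hSW u hu huH huy w (hHW (hSH hw)) (hyS w (hSH hw))).2 hw
      · intro hle u hu huH v hv hvH huv
        have hno : ∀ u ∈ W, u ∉ H → u ≠ y → ¬ G.Adj u y := by
          intro u hu huH huy h
          have h1 := hle u hu huH
          have h2 := card_le_degIn (G := G) (S := insert y S) (T := W) (v := u)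
            (Finset.insert_subset hyW (hSH.trans hHW)) (by
              intro w hw
              rcases Finset.mem_insert.1 hw with rfl | hw
              · exact h
              · exact (hSW u hu huH huy w (hHW (hSH hw)) (hyS w (hSH hw))).2 hw)
          rw [Finset.card_insert_of_notMem fun h => hyH (hSH h)] at h2
          omega
        by_cases huy : u = y
        · subst huy
          exact hno v hv hvH huv.ne' huv.symm
        · by_cases hvy : v = y
          · subst hvy
            exact hno u hu huH huy huv
          · exact hvH (hSH ((hSW u hu huH huy v hv hvy).1 huv))
    · refine exists_common_neighbors hHT hH hHc heq.symm hfree (hdeg T hHT htight) ?_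
      intro hle u hu huH v hv hvH huv
      have h1 := hdeg _ (herase T hHT v hvH) (htie T htight v hv hvH (hle v hv hvH)) u
        (Finset.mem_erase.2 ⟨huv.ne, hu⟩) huH
      have h2 := hle u hu huH
      rw [degIn_eq_erase_add hv, if_pos huv] at h2
      omega

end Tight

section Structure

theorem exists_maximal_core {V : Type*} [Finite V] {G : SimpleGraph V} {k : ℕ}
    (h : ∃ A : Finset V, A.Nonempty ∧ ∀ v ∈ A, k + 1 ≤ degIn G A v) :
    ∃ H : Finset V, H.Nonempty ∧ (∀ v ∈ H, k + 1 ≤ degIn G H v) ∧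
      ∀ T, H ⊆ T → T ≠ H → ∃ y ∈ T, y ∉ H ∧ degIn G T y ≤ k := by
  obtain ⟨A, hA⟩ := h
  obtain ⟨H, -, hmax⟩ := Finite.exists_le_maximal
    (p := fun A : Finset V => A.Nonempty ∧ ∀ v ∈ A, k + 1 ≤ degIn G A v) hA
  refine ⟨H, hmax.1.1, hmax.1.2, fun T hT hne => ?_⟩
  by_contra! hcon
  refine hne (Finset.Subset.antisymm (hmax.2 ⟨hmax.1.1.mono hT, fun v hv => ?_⟩ hT) hT)
  by_cases hvH : v ∈ H
  · exact (hmax.1.2 v hvH).trans (degIn_mono le_rfl hT v)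
  · exact hcon v hv hvH

theorem degIn_lt_card {V : Type*} (G : SimpleGraph V) {T : Finset V} {v : V} (hv : v ∈ T) :
    degIn G T v < T.card := by
  classical
  refine Finset.card_lt_card (Finset.filter_ssubset.2 ⟨v, hv, G.loopless.irrefl v⟩)

theorem exists_structure_of_maximal {V : Type*} [Fintype V] {G : SimpleGraph V} {k : ℕ}
    (hk : 1 ≤ k) (hn : 5 * k + 4 < 2 * Fintype.card V) (hcon : G.Connected)
    (hG : Maximal (PathFree Finset.univ (2 * k + 3)) G)
    (hdeg : k * (k - 1) + 2 * k * (Fintype.card V - k) + 2 ≤ degSum G Finset.univ) :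
    ∃ S H : Finset V, S ⊆ H ∧ S.card = k ∧ H.card = k + 2 ∧
      (∀ x ∈ H, ∀ y ∈ H, x ≠ y → G.Adj x y) ∧ ∀ u ∉ H, ∀ v, G.Adj u v ↔ v ∈ S := by
  classical
  obtain ⟨m, hm⟩ : ∃ m, Fintype.card V = k + 2 + m := ⟨Fintype.card V - (k + 2), by omega⟩
  rw [hm] at hn hdeg
  have hdeg' : (k + 2) * (k + 1) + 2 * k * m ≤ degSum G Finset.univ := by
    rw [show k + 2 + m - k = m + 2 by omega] at hdeg
    obtain ⟨k, rfl⟩ : ∃ j, k = j + 1 := ⟨k - 1, by omega⟩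
    simp only [Nat.add_sub_cancel] at hdeg
    linarith
  obtain ⟨H, hHne, hHdeg, hcore⟩ : ∃ H : Finset V, H.Nonempty ∧ (∀ v ∈ H, k + 1 ≤ degIn G H v) ∧
      ∀ T, H ⊆ T → T ≠ H → ∃ y ∈ T, y ∉ H ∧ degIn G T y ≤ k := by
    refine exists_maximal_core ?_
    by_contra! hno
    have := degSum_le (G := G) (fun _ => True) k k (fun T _ hT => by
      obtain ⟨y, hy, hd⟩ := hno T (Finset.card_pos.1 (by omega))
      exact ⟨y, hy, by omega, trivial⟩) Finset.univ trivial (by rw [Finset.card_univ]; omega)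
    rw [Finset.card_univ, hm] at this
    rw [show k + 2 + m - k = m + 2 by omega] at hdeg
    linarith
  have hH : ∀ x ∈ H, ∀ y ∈ H, x ≠ y → G.Adj x y := fun x hx y hy hxy =>
    adj_of_degIn_add_le hcon hG hHdeg hHdeg (by omega) hx hy hxy
  have hHc : k + 2 ≤ H.card := by
    obtain ⟨x, hx⟩ := hHne
    have := hHdeg x hx
    have := degIn_lt_card G hx
    omega
  have hHself : ∀ x ∈ H, H.card ≤ degIn G H x + 1 := fun x hx =>
    card_le_degIn_add_one subset_rfl (hH x hx)
  have hout : ∀ T, H ⊆ T → T ≠ H → ∃ y ∈ T, y ∉ H ∧ degIn G T y ≤ 2 * k + 2 - H.card := by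
    intro T hHT hne
    obtain ⟨y, hy, hyH, hyk⟩ := hcore T hHT hne
    by_contra! hcon'
    have hyc := hcon' y hy hyH
    have hadj : ∀ x ∈ H, G.Adj x y := by
      intro x hx
      refine adj_of_degIn_add_le hcon hG (A := H) (B := T) (a := H.card - 1)
        (b := 2 * k + 2 - H.card + 1) ?_ ?_ (by omega) hx hy (by rintro rfl; exact hyH hx)
      · intro v hv
        have := hHself v hv
        omega
      · intro v hv
        by_cases hvH : v ∈ H
        · have := hHself v hvH
          have := degIn_mono (le_refl G) hHT v
          omega
        · exact hcon' v hv hvH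
    have := card_le_degIn (G := G) hHT (v := y) fun w hw => (hadj w hw).symm
    omega
  have hnot : H ≠ Finset.univ := by
    rintro rfl
    obtain ⟨x, -, y, -, hxy, hadj⟩ := hG.1.exists_not_adj (by rw [Finset.card_univ]; omega)
    exact hadj (hH x (Finset.mem_univ _) y (Finset.mem_univ _) hxy)
  have hHle : H.card ≤ 2 * k + 1 := by
    by_contra! hlt
    obtain ⟨y, -, -, hy⟩ := hout Finset.univ (Finset.subset_univ _) hnot.symm
    have : Nontrivial V := Fintype.one_lt_card_iff_nontrivial.1 (by omega)
    obtain ⟨z, hz⟩ := hcon.preconnected.exists_adj_of_nontrivial y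
    have := card_le_degIn (G := G) (S := {z}) (Finset.subset_univ _) (v := y) (by simpa using hz)
    simp at this
    omega
  have hHk : H.card = k + 2 := by
    have hle := degSum_le (G := G) (H ⊆ ·) H.card (2 * k + 2 - H.card) (fun T hT hlt => by
      obtain ⟨y, hy, hyH, hd⟩ := hout T hT (by rintro rfl; omega)
      refine ⟨y, hy, hd, fun v hv => Finset.mem_erase.2 ⟨?_, hT hv⟩⟩
      rintro rfl; exact hyH hv) Finset.univ (Finset.subset_univ _) (Finset.card_le_univ _)
    obtain ⟨j, hj⟩ : ∃ j, H.card = k + 2 + j := ⟨H.card - (k + 2), by omega⟩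
    obtain ⟨i, rfl⟩ : ∃ i, k = i + j + 1 := ⟨k - j - 1, by omega⟩
    rw [Finset.card_univ, hm, hj, show 2 * (i + j + 1) + 2 - (i + j + 1 + 2 + j) = i + 1 by omega,
      show i + j + 1 + 2 + j - 1 = i + j + 2 + j by omega] at hle
    rcases Nat.eq_zero_or_pos j with rfl | hjp
    · omega
    · exfalso
      nlinarith
  obtain ⟨S, hSH, hSc, hS⟩ := exists_common_neighbors_of_tight hk hH hHk hcore Finset.univ hG.1
    (Finset.subset_univ _) (by rw [Finset.card_univ]; omega) (by
      rw [Finset.card_univ, hm]; linarith)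
  exact ⟨S, H, hSH, hSc, hHk, hH, fun u hu v => hS u (Finset.mem_univ _) hu v (Finset.mem_univ _)⟩

theorem snkPlus_adj {n k : ℕ} (i j : Fin n) : (SnkPlus n k).Adj i j ↔ i ≠ j ∧
    ((i : ℕ) < k ∨ (j : ℕ) < k ∨ ((i : ℕ) = k ∧ (j : ℕ) = k + 1) ∨
      ((i : ℕ) = k + 1 ∧ (j : ℕ) = k)) := by
  simp only [SnkPlus, fromRel_adj]
  tauto

theorem nonempty_iso_snkPlus {V : Type*} [Fintype V] {G : SimpleGraph V} {k n : ℕ}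
    (hn : Fintype.card V = n) {S : Finset V} (hS : S.card = k) {p q : V} (hp : p ∉ S)
    (hq : q ∉ S) (hpq : p ≠ q) (hadj : ∀ u v, G.Adj u v ↔
      u ≠ v ∧ (u ∈ S ∨ v ∈ S ∨ (u = p ∧ v = q) ∨ (u = q ∧ v = p))) :
    Nonempty (G ≃g SnkPlus n k) := by
  classical
  set R : Finset V := Finset.univ \ insert p (insert q S) with hR
  set L : List V := S.toList ++ (p :: q :: R.toList) with hL
  have hnd : L.Nodup := by
    rw [hL, List.nodup_append]
    refine ⟨S.nodup_toList, ?_, ?_⟩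
    · simp [hR, hpq, Finset.nodup_toList]
    · intro a ha b hb
      simp only [Finset.mem_toList, List.mem_cons, hR, Finset.mem_sdiff] at ha hb
      rintro rfl
      rcases hb with rfl | rfl | hb
      · exact hp ha
      · exact hq ha
      · exact hb.2 (by simp [ha])
  have hall : ∀ x, x ∈ L := by
    intro x
    simp only [hL, List.mem_append, Finset.mem_toList, List.mem_cons, hR, Finset.mem_sdiff,
      Finset.mem_univ, Finset.mem_insert, true_and]
    tauto
  have hlen : L.length = n := by
    rw [← hn, ← Fintype.card_fin L.length]
    exact Fintype.card_congr (hnd.getEquivOfForallMemList L hall)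
  subst hlen
  have hSl : S.toList.length = k := by simp [hS]
  let e := hnd.getEquivOfForallMemList L hall
  have he : ∀ i : Fin L.length, e i = L[(i : ℕ)] := fun i => rfl
  have heS : ∀ i : Fin L.length, e i ∈ S ↔ (i : ℕ) < k := by
    intro i
    rw [he]
    constructor
    · intro h
      by_contra! hik
      have h2 : L[(i : ℕ)] ∈ p :: q :: R.toList := by
        simp only [hL]
        rw [List.getElem_append_right (by omega)]
        exact List.getElem_mem _
      rw [hL, List.nodup_append] at hnd
      exact hnd.2.2 _ (Finset.mem_toList.2 h) _ h2 rfl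
    · intro hik
      simp only [hL]
      rw [List.getElem_append_left (by omega)]
      exact Finset.mem_toList.1 (List.getElem_mem _)
  have hk2 : k + 2 ≤ L.length := by simp [hL, hS]
  have hep : ∀ i : Fin L.length, e i = p ↔ (i : ℕ) = k := by
    intro i
    have h1 : e ⟨k, by omega⟩ = p := by
      rw [he]
      simp [hL, List.getElem_append_right, hS]
    rw [← h1, e.injective.eq_iff, Fin.ext_iff]
  have heq : ∀ i : Fin L.length, e i = q ↔ (i : ℕ) = k + 1 := by
    intro i
    have h1 : e ⟨k + 1, by omega⟩ = q := by
      rw [he]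
      simp [hL, List.getElem_append_right, hS]
    rw [← h1, e.injective.eq_iff, Fin.ext_iff]
  refine ⟨(RelIso.mk e ?_ : SnkPlus L.length k ≃g G).symm⟩
  intro i j
  rw [hadj, snkPlus_adj, heS, heS, hep, hep, heq, heq, e.injective.ne_iff]

end Structure

section EdgeCount

theorem two_mul_edgeCount {V : Type*} [Fintype V] (G : SimpleGraph V) :
    2 * edgeCount G = degSum G Finset.univ := by
  classical
  have h := G.sum_degrees_eq_twice_card_edges
  rw [edgeCount, Nat.card_eq_fintype_card, ← edgeFinset_card, ← h, degSum]
  refine Finset.sum_congr rfl fun v _ => ?_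
  rw [← card_neighborFinset_eq_degree, neighborFinset_eq_filter]
  unfold degIn
  congr

theorem edgeCount_mono {V : Type*} [Finite V] {G Γ : SimpleGraph V} (h : G ≤ Γ) :
    edgeCount G ≤ edgeCount Γ :=
  Nat.card_mono (Set.toFinite _) (edgeSet_mono h)

theorem eq_of_le_of_edgeCount_le {V : Type*} [Finite V] {G Γ : SimpleGraph V} (h : G ≤ Γ)
    (hc : edgeCount Γ ≤ edgeCount G) : G = Γ :=
  edgeSet_injective (Set.eq_of_subset_of_ncard_le (edgeSet_mono h) hc)

theorem edgeCount_congr {V W : Type*} {G : SimpleGraph V} {Γ : SimpleGraph W} (e : G ≃g Γ) :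
    edgeCount G = edgeCount Γ :=
  Nat.card_congr e.mapEdgeSet

theorem le_degSum_snkPlus {n k : ℕ} (hk : k + 2 ≤ n) :
    k * (k - 1) + 2 * k * (n - k) + 2 ≤ degSum (SnkPlus n k) Finset.univ := by
  classical
  obtain ⟨m, rfl⟩ := Nat.exists_eq_add_of_le hk
  set S : Finset (Fin (k + 2 + m)) := Finset.univ.filter fun i => (i : ℕ) < k with hS
  have hSc : S.card = k := by
    rw [hS, Fin.card_filter_val_lt]; omega
  let g : ℕ → ℕ := fun i => if i < k then k + 1 + m else if i < k + 2 then k + 1 else k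
  have hg : ∀ i : Fin (k + 2 + m), g i ≤ degIn (SnkPlus _ k) Finset.univ i := by
    intro i
    simp only [g]
    split_ifs with h1 h2
    · have := card_le_degIn_add_one (G := SnkPlus (k + 2 + m) k) (Finset.subset_univ Finset.univ)
        (v := i) fun w _ hw => (snkPlus_adj i w).2 ⟨hw, Or.inl h1⟩
      simp at this
      omega
    · obtain ⟨j, hjk, hij⟩ : ∃ j : Fin (k + 2 + m), ¬ (j : ℕ) < k ∧ (SnkPlus _ k).Adj i j := by
        rcases Nat.lt_or_ge i (k + 1) with h3 | h3
        · exact ⟨⟨k + 1, by omega⟩, by simp, (snkPlus_adj _ _).2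
            ⟨by simp [Fin.ext_iff]; omega, by simp; omega⟩⟩
        · exact ⟨⟨k, by omega⟩, by simp, (snkPlus_adj _ _).2
            ⟨by simp [Fin.ext_iff]; omega, by simp; omega⟩⟩
      have := card_le_degIn (G := SnkPlus (k + 2 + m) k) (S := insert j S)
        (Finset.subset_univ _) (v := i) (by
          intro w hw
          rcases Finset.mem_insert.1 hw with rfl | hw
          · exact hij
          · have hw' : (w : ℕ) < k := (Finset.mem_filter.1 hw).2
            exact (snkPlus_adj _ _).2 ⟨by rintro rfl; omega, Or.inr (Or.inl hw')⟩)
      rw [Finset.card_insert_of_notMem (by simp [hS]; omega)] at this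
      omega
    · refine hSc.symm.le.trans (card_le_degIn (Finset.subset_univ _) fun w hw => ?_)
      have hw' : (w : ℕ) < k := (Finset.mem_filter.1 hw).2
      exact (snkPlus_adj _ _).2 ⟨by rintro rfl; omega, Or.inr (Or.inl hw')⟩
  have hsum : ∑ i : Fin (k + 2 + m), g i = k * (k + 1 + m) + 2 * (k + 1) + m * k := by
    rw [Fin.sum_univ_eq_sum_range, Finset.sum_range_add, Finset.sum_range_succ,
      Finset.sum_range_succ, Finset.sum_congr rfl (g := fun _ => k + 1 + m)
        fun i hi => if_pos (Finset.mem_range.1 hi),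
      Finset.sum_congr rfl (s₁ := Finset.range m) (g := fun _ => k) fun i hi => by
        simp only [g]
        rw [if_neg (by omega), if_neg (by omega)]]
    simp [g]
    ring
  have hle := Finset.sum_le_sum fun i (_ : i ∈ Finset.univ) => hg i
  rw [hsum] at hle
  refine le_trans ?_ hle
  rw [show k + 2 + m - k = m + 2 by omega]
  rcases Nat.eq_zero_or_pos k with rfl | hk'
  · simp
  · obtain ⟨j, rfl⟩ : ∃ j, k = j + 1 := ⟨k - 1, by omega⟩
    simp only [Nat.add_sub_cancel]
    linarith

end EdgeCount

theorem PathFree.of_not_hasPathOn {V : Type*} [Fintype V] {G : SimpleGraph V} {m : ℕ}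
    (hm : 1 ≤ m) (h : ¬ HasPathOn G m) : PathFree Finset.univ m G := by
  intro l hc hnd _
  by_contra! hlen
  have hlt : (l.take m).length = m := by rw [List.length_take]; omega
  have hne : l.take m ≠ [] := by
    rw [← List.length_pos_iff]; omega
  refine h ⟨_, _, Walk.ofSupport (l.take m) hne (hc.prefix (List.take_prefix _ _)), ?_, ?_⟩
  · rw [Walk.isPath_def, Walk.support_ofSupport]
    exact hnd.sublist (List.take_sublist _ _)
  · rw [Walk.support_ofSupport, hlt]

/-- Balister–Győri–Lehel–Schelp (ii): a connected graph of order `n > (5k+4)/2`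
with `e(G) ≥ e(S_{n,k}^+)` contains `P_{2k+3}` unless `G ≅ S_{n,k}^+`. -/
theorem stmt_13 (k n : ℕ) (hk : 1 ≤ k) (hn : 5 * k + 4 < 2 * n) (G : SimpleGraph (Fin n))
    (hconn : G.Connected) (he : edgeCount (SnkPlus n k) ≤ edgeCount G) :
    HasPathOn G (2 * k + 3) ∨ Nonempty (G ≃g SnkPlus n k) := by
  by_contra! hcon
  obtain ⟨hpath, hiso⟩ := hcon
  obtain ⟨Γ, hle, hmax⟩ := (PathFree.of_not_hasPathOn (by omega) hpath).exists_maximal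
  have hdeg : k * (k - 1) + 2 * k * (n - k) + 2 ≤ degSum Γ Finset.univ := by
    have h1 := le_degSum_snkPlus (n := n) (k := k) (by omega)
    rw [← two_mul_edgeCount] at h1 ⊢
    have := edgeCount_mono hle
    omega
  obtain ⟨S, H, hSH, hSc, hHc, hH, hS⟩ := exists_structure_of_maximal hk
    (by rwa [Fintype.card_fin]) (hconn.mono hle) hmax (by rwa [Fintype.card_fin])
  obtain ⟨p, q, hpq, hHS⟩ := Finset.card_eq_two.1
    (show (H \ S).card = 2 by rw [Finset.card_sdiff_of_subset hSH]; omega)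
  have hmem : ∀ v, v ∈ H ↔ v ∈ S ∨ v = p ∨ v = q := by
    intro v
    have h1 : v ∈ H \ S ↔ v = p ∨ v = q := by rw [hHS]; simp
    rw [← h1, Finset.mem_sdiff]
    have := @hSH v
    tauto
  have hp : p ∈ H \ S := by simp [hHS]
  have hq : q ∈ H \ S := by simp [hHS]
  obtain ⟨e⟩ : Nonempty (Γ ≃g SnkPlus n k) := by
    refine nonempty_iso_snkPlus (Fintype.card_fin n) hSc (Finset.mem_sdiff.1 hp).2
      (Finset.mem_sdiff.1 hq).2 hpq fun u v => ?_
    by_cases hu : u ∈ H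
    · by_cases hv : v ∈ H
      · constructor
        · intro h
          have := h.ne
          rw [hmem] at hu hv
          refine ⟨this, ?_⟩
          rcases hu with hu | rfl | rfl <;> rcases hv with hv | rfl | rfl <;> simp_all
        · exact fun h => hH u hu v hv h.1
      · rw [Γ.adj_comm, hS v hv u]
        have h1 : u ≠ v := by rintro rfl; exact hv hu
        rw [hmem] at hv
        tauto
    · rw [hS u hu v]
      constructor
      · intro h
        exact ⟨by rintro rfl; exact hu (hSH h), Or.inr (Or.inl h)⟩
      · rw [hmem] at hu
        tauto
  have hG : G = Γ := eq_of_le_of_edgeCount_le hle ((edgeCount_congr e).le.trans he)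
  subst hG
  exact hiso.false e
end

section
/- Let k ≥ 1, n ≥ 2^{4k+4}, and let G be a simple graph of order n. If μ(G) ≥ μ(S_{n,k}), then G contains a path on 2k+2 vertices as a subgraph, unless G is isomorphic to S_{n,k}. -/
open Matrix BigOperators

section PathsInGraphs

theorem hasPathOn_of_list {V : Type*} {G : SimpleGraph V} {l : List V} (hne : l ≠ [])
    (hc : l.IsChain G.Adj) (hd : l.Nodup) : HasPathOn G l.length := by
  refine ⟨_, _, SimpleGraph.Walk.ofSupport l hne hc, ?_, ?_⟩
  · rw [SimpleGraph.Walk.isPath_def, SimpleGraph.Walk.support_ofSupport]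
    exact hd
  · rw [SimpleGraph.Walk.support_ofSupport]

theorem exists_mem_notMem_list {V : Type*} {S : Finset V} {l : List V}
    (h : l.length < S.card) : ∃ v ∈ S, v ∉ l := by
  classical
  obtain ⟨v, hv, hl⟩ := Finset.exists_mem_notMem_of_card_lt_card
    (lt_of_le_of_lt (List.toFinset_card_le l) h)
  exact ⟨v, hv, by simpa using hl⟩

open scoped Classical in
theorem exists_mem_notMem_of_card_filter_lt {V : Type*} {S T : Finset V} {l : List V}
    (h : (S.filter (· ∈ l)).card < T.card) (hT : T ⊆ S) : ∃ v ∈ T, v ∉ l := by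
  obtain ⟨v, hv, hl⟩ := Finset.exists_mem_notMem_of_card_lt_card h
  exact ⟨v, hv, fun hvl => hl (Finset.mem_filter.2 ⟨hT hv, hvl⟩)⟩

open scoped Classical in
theorem card_filter_mem_cons_of_mem {V : Type*} {S : Finset V} {l : List V} {v : V}
    (hv : v ∈ S) (hl : v ∉ l) :
    (S.filter (· ∈ v :: l)).card = (S.filter (· ∈ l)).card + 1 := by
  rw [← Finset.card_insert_of_notMem (a := v) (s := S.filter (· ∈ l)) (by simp [hl])]
  congr 1
  ext u
  simp only [Finset.mem_filter, List.mem_cons, Finset.mem_insert]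
  constructor
  · tauto
  · rintro (rfl | h)
    · exact ⟨hv, Or.inl rfl⟩
    · tauto

open scoped Classical in
theorem filter_mem_cons_of_notMem {V : Type*} {S : Finset V} {l : List V} {v : V}
    (hv : v ∉ S) : S.filter (· ∈ v :: l) = S.filter (· ∈ l) := by
  ext u
  simp only [Finset.mem_filter, List.mem_cons]
  constructor
  · rintro ⟨hu, rfl | h⟩
    · exact absurd hu hv
    · exact ⟨hu, h⟩
  · tauto

theorem exists_nodup_chain_of_minDegree {V : Type*} {G : SimpleGraph V} {S : Finset V}
    {m : ℕ} [DecidableRel G.Adj] (hS : S.Nonempty)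
    (hdeg : ∀ v ∈ S, m ≤ (S.filter (G.Adj v)).card) {i : ℕ} (hi : i ≤ m) :
    ∃ v ∈ S, ∃ l : List V, (v :: l).IsChain G.Adj ∧ (v :: l).Nodup ∧ l.length = i := by
  induction i with
  | zero =>
    obtain ⟨v, hv⟩ := hS
    exact ⟨v, hv, [], by simp, by simp, rfl⟩
  | succ i ih =>
    obtain ⟨v, hv, l, hc, hd, hl⟩ := ih (by omega)
    have hlt : l.length < (S.filter (G.Adj v)).card := by
      have := hdeg v hv
      omega
    obtain ⟨w, hw, hwl⟩ := exists_mem_notMem_list hlt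
    rw [Finset.mem_filter] at hw
    refine ⟨w, hw.1, v :: l, ?_, ?_, by simp [hl]⟩
    · exact List.isChain_cons_cons.2 ⟨hw.2.symm, hc⟩
    · refine List.nodup_cons.2 ⟨?_, hd⟩
      rw [List.mem_cons, not_or]
      exact ⟨hw.2.ne', hwl⟩

open scoped Classical in
/-- A graph without paths on `m + 1` vertices is `(m - 1)`-degenerate. -/
theorem sum_card_filter_adj_le {V : Type*} {G : SimpleGraph V} {m : ℕ}
    (hP : ¬ HasPathOn G (m + 1)) (S : Finset V) :
    ∑ v ∈ S, (S.filter (G.Adj v)).card ≤ 2 * m * S.card := by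
  induction hs : S.card generalizing S with
  | zero => simp [Finset.card_eq_zero.1 hs]
  | succ s ih =>
    have hex : ∃ v ∈ S, (S.filter (G.Adj v)).card < m := by
      by_contra! hdeg
      obtain ⟨v, -, l, hc, hd, hl⟩ := exists_nodup_chain_of_minDegree
        (Finset.card_pos.1 (by omega)) hdeg le_rfl
      exact hP (by simpa [hl] using hasPathOn_of_list (by simp) hc hd)
    obtain ⟨v, hv, hvm⟩ := hex
    have hcard : (S.erase v).card = s := by rw [Finset.card_erase_of_mem hv]; omega
    have hrec := ih (S.erase v) hcard
    have hstep : ∀ w ∈ S.erase v, (S.filter (G.Adj w)).card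
        = ((S.erase v).filter (G.Adj w)).card + if G.Adj v w then 1 else 0 := by
      intro w _
      rw [Finset.filter_erase]
      split_ifs with h
      · rw [Finset.card_erase_add_one (Finset.mem_filter.2 ⟨hv, h.symm⟩)]
      · rw [Finset.erase_eq_of_notMem (by simp [hv, G.adj_comm, h]), add_zero]
    have hone : ∑ w ∈ S.erase v, (if G.Adj v w then 1 else 0) = (S.filter (G.Adj v)).card := by
      rw [← Finset.card_filter, Finset.filter_erase, Finset.erase_eq_of_notMem (by simp)]
    rw [← Finset.add_sum_erase S _ hv, Finset.sum_congr rfl hstep, Finset.sum_add_distrib, hone]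
    rw [mul_add]
    omega

open scoped Classical in
/-- Alternating paths in a bipartite pair `(L, R)` with large minimum degrees. -/
theorem exists_alternating_chain {V : Type*} {G : SimpleGraph V} {L R : Finset V} {k : ℕ}
    (hLR : Disjoint L R) (hR : R.Nonempty)
    (hdL : ∀ a ∈ L, 2 * k ≤ (R.filter (G.Adj a)).card)
    (hdR : ∀ w ∈ R, k ≤ (L.filter (G.Adj w)).card) {i : ℕ} (hi : i < k) :
    ∃ a ∈ L, ∃ l : List V, (a :: l).IsChain G.Adj ∧ (a :: l).Nodup ∧
      (a :: l).length = 2 * i + 2 ∧ (L.filter (· ∈ a :: l)).card = i + 1 := by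
  have extend : ∀ i < k, ∀ w ∈ R, ∀ l : List V, (w :: l).IsChain G.Adj → (w :: l).Nodup →
      (w :: l).length = 2 * i + 1 → (L.filter (· ∈ w :: l)).card = i →
      ∃ a ∈ L, ∃ l : List V, (a :: l).IsChain G.Adj ∧ (a :: l).Nodup ∧
        (a :: l).length = 2 * i + 2 ∧ (L.filter (· ∈ a :: l)).card = i + 1 := by
    intro i hi w hw l hc hd hl hf
    have hlt : (L.filter (· ∈ w :: l)).card < (L.filter (G.Adj w)).card := by
      have := hdR w hw
      omega
    obtain ⟨a, ha, hal⟩ := exists_mem_notMem_of_card_filter_lt hlt (Finset.filter_subset _ _)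
    rw [Finset.mem_filter] at ha
    refine ⟨a, ha.1, w :: l, List.isChain_cons_cons.2 ⟨ha.2.symm, hc⟩,
      List.nodup_cons.2 ⟨hal, hd⟩, by rw [List.length_cons, hl], ?_⟩
    rw [card_filter_mem_cons_of_mem ha.1 hal, hf]
  induction i with
  | zero =>
    obtain ⟨w, hw⟩ := hR
    refine extend 0 hi w hw [] (by simp) (by simp) (by simp) ?_
    rw [filter_mem_cons_of_notMem (Finset.disjoint_right.1 hLR hw)]
    simp
  | succ i ih =>
    obtain ⟨a, ha, l, hc, hd, hl, hf⟩ := ih (by omega)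
    have hlt : (a :: l).length < (R.filter (G.Adj a)).card := by
      have := hdL a ha
      omega
    obtain ⟨w, hw, hwl⟩ := exists_mem_notMem_list hlt
    rw [Finset.mem_filter] at hw
    refine extend (i + 1) hi w hw.1 (a :: l) (List.isChain_cons_cons.2 ⟨hw.2.symm, hc⟩)
      (List.nodup_cons.2 ⟨hwl, hd⟩) (by rw [List.length_cons, hl]; ring) ?_
    rw [filter_mem_cons_of_notMem (Finset.disjoint_right.1 hLR hw.1), hf]

open scoped Classical in
theorem exists_complete_pair_of_minDegree {V : Type*} {G : SimpleGraph V} {L R : Finset V} {k : ℕ}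
    (hk : 1 ≤ k) (hP : ¬ HasPathOn G (2 * k + 2)) (hLR : Disjoint L R) (hR : R.Nonempty)
    (hdL : ∀ a ∈ L, 4 * k + 2 ≤ (R.filter (G.Adj a)).card)
    (hdR : ∀ w ∈ R, k ≤ (L.filter (G.Adj w)).card) :
    ∃ A ⊆ L, ∃ B ⊆ R, A.card = k ∧ 2 * k + 2 ≤ B.card ∧ ∀ a ∈ A, ∀ b ∈ B, G.Adj a b := by
  obtain ⟨a, ha, l, hc, hd, hl, hf⟩ := exists_alternating_chain (i := k - 1) hLR hR
    (fun a ha => (by omega : 2 * k ≤ 4 * k + 2).trans (hdL a ha)) hdR (by omega)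
  refine ⟨L.filter (· ∈ a :: l), Finset.filter_subset _ _,
    (R.filter (G.Adj a)) \ (a :: l).toFinset,
    Finset.sdiff_subset.trans (Finset.filter_subset _ _), by omega, ?_, ?_⟩
  · have h1 := Finset.le_card_sdiff (a :: l).toFinset (R.filter (G.Adj a))
    have h2 := List.toFinset_card_le (a :: l)
    have h3 := hdL a ha
    omega
  · intro c hcA b hb
    simp only [Finset.mem_sdiff, Finset.mem_filter, List.mem_toFinset] at hb
    have hbc : (b :: a :: l).IsChain G.Adj := List.isChain_cons_cons.2 ⟨hb.1.2.symm, hc⟩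
    have hbd : (b :: a :: l).Nodup := List.nodup_cons.2 ⟨hb.2, hd⟩
    have hsub : L.filter (G.Adj b) ⊆ L.filter (· ∈ a :: l) := by
      intro e he
      rw [Finset.mem_filter] at he ⊢
      refine ⟨he.1, ?_⟩
      by_contra hel
      have hed : (e :: b :: a :: l).Nodup := by
        refine List.nodup_cons.2 ⟨?_, hbd⟩
        rw [List.mem_cons, not_or]
        exact ⟨he.2.ne', hel⟩
      have := hasPathOn_of_list (by simp) (List.isChain_cons_cons.2 ⟨he.2.symm, hbc⟩) hed
      rw [List.length_cons, List.length_cons, hl] at this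
      exact hP (by convert this using 1; omega)
    have heq := Finset.eq_of_subset_of_card_le hsub (by have := hdR b hb.1.1; omega)
    rw [← heq, Finset.mem_filter] at hcA
    exact hcA.2.symm

open scoped Classical in
/-- Either `(L, R)` contains a large complete bipartite subgraph, or it has few edges. -/
theorem exists_complete_pair_or_sum_card_le {V : Type*} {G : SimpleGraph V} {k : ℕ}
    (hk : 1 ≤ k) (hP : ¬ HasPathOn G (2 * k + 2)) (L R : Finset V) (hLR : Disjoint L R) :
    (∃ A ⊆ L, ∃ B ⊆ R, A.card = k ∧ 2 * k + 2 ≤ B.card ∧ ∀ a ∈ A, ∀ b ∈ B, G.Adj a b) ∨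
    ∑ a ∈ L, (R.filter (G.Adj a)).card ≤ (k - 1) * R.card + (4 * k + 1) * L.card := by
  induction hs : L.card + R.card generalizing L R with
  | zero =>
    right
    rw [Finset.card_eq_zero.1 (by omega : L.card = 0)]
    simp
  | succ s ih =>
    by_cases hL : ∃ a ∈ L, (R.filter (G.Adj a)).card < 4 * k + 2
    · obtain ⟨a, ha, hlt⟩ := hL
      have hc := Finset.card_erase_add_one ha
      rcases ih (L.erase a) R (hLR.mono_left (Finset.erase_subset _ _)) (by omega) with h | h
      · obtain ⟨A, hA, B, hB, h⟩ := h
        exact Or.inl ⟨A, hA.trans (Finset.erase_subset _ _), B, hB, h⟩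
      · right
        rw [← Finset.add_sum_erase L _ ha, ← hc, mul_add]
        omega
    by_cases hR : ∃ w ∈ R, (L.filter (G.Adj w)).card < k
    · obtain ⟨w, hw, hlt⟩ := hR
      have hc := Finset.card_erase_add_one hw
      rcases ih L (R.erase w) (hLR.mono_right (Finset.erase_subset _ _)) (by omega) with h | h
      · obtain ⟨A, hA, B, hB, h⟩ := h
        exact Or.inl ⟨A, hA, B, hB.trans (Finset.erase_subset _ _), h⟩
      · right
        have hstep : ∀ a ∈ L, (R.filter (G.Adj a)).card
            = ((R.erase w).filter (G.Adj a)).card + if G.Adj w a then 1 else 0 := by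
          intro a _
          rw [Finset.filter_erase]
          split_ifs with h
          · rw [Finset.card_erase_add_one (Finset.mem_filter.2 ⟨hw, h.symm⟩)]
          · rw [Finset.erase_eq_of_notMem (by simp [hw, G.adj_comm, h]), add_zero]
        have hone : ∑ a ∈ L, (if G.Adj w a then 1 else 0) = (L.filter (G.Adj w)).card := by
          rw [← Finset.card_filter]
        rw [Finset.sum_congr rfl hstep, Finset.sum_add_distrib, hone, ← hc, mul_add]
        omega
    push Not at hL hR
    have hRne : R.Nonempty := by
      by_contra hne
      rw [Finset.not_nonempty_iff_eq_empty] at hne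
      subst hne
      obtain ⟨a, ha⟩ := Finset.card_pos.1 (by simp at hs; omega : 0 < L.card)
      have := hL a ha
      simp at this
    exact Or.inl (exists_complete_pair_of_minDegree hk hP hLR hRne hL hR)

open scoped Classical in
/-- An edge hanging off a large complete bipartite subgraph creates a long path. -/
theorem hasPathOn_of_complete_pair {V : Type*} {G : SimpleGraph V} {k : ℕ} {A B : Finset V}
    (hA : A.card = k) (hB : 2 * k + 2 ≤ B.card) (hAB : ∀ a ∈ A, ∀ b ∈ B, G.Adj a b)
    {t w u : V} (ht : t ∈ A) (hw : w ∉ A) (hu : u ∉ A) (htw : G.Adj t w) (hwu : G.Adj w u) :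
    HasPathOn G (2 * k + 2) := by
  have hdisj : ∀ b ∈ B, b ∉ A := fun b hb hbA => (hAB b hbA b hb).ne rfl
  have key : ∀ i < k, ∃ a ∈ A, ∃ l : List V, (a :: l).IsChain G.Adj ∧ (a :: l).Nodup ∧
      (a :: l).length = 2 * i + 3 ∧ (A.filter (· ∈ a :: l)).card = i + 1 := by
    intro i
    induction i with
    | zero =>
      intro _
      refine ⟨t, ht, [w, u], by simp [htw, hwu], ?_, rfl, ?_⟩
      · have h1 : t ≠ u := fun h => hu (h ▸ ht)
        simp [htw.ne, hwu.ne, h1]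
      · rw [card_filter_mem_cons_of_mem ht, filter_mem_cons_of_notMem hw,
          filter_mem_cons_of_notMem hu]
        · simp
        · have h1 : t ≠ u := fun h => hu (h ▸ ht)
          simp [htw.ne, h1]
    | succ i ih =>
      intro hi
      obtain ⟨a, ha, l, hc, hd, hl, hf⟩ := ih (by omega)
      obtain ⟨b, hb, hbl⟩ := exists_mem_notMem_list (by omega : (a :: l).length < B.card)
      have hf' : (A.filter (· ∈ b :: a :: l)).card = i + 1 := by
        rw [filter_mem_cons_of_notMem (hdisj b hb), hf]
      obtain ⟨c, hcA, hcl⟩ := exists_mem_notMem_of_card_filter_lt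
        (by omega : (A.filter (· ∈ b :: a :: l)).card < A.card) subset_rfl
      refine ⟨c, hcA, b :: a :: l, ?_, ?_, by simp only [List.length_cons] at hl ⊢; omega, ?_⟩
      · exact List.isChain_cons_cons.2 ⟨hAB c hcA b hb,
          List.isChain_cons_cons.2 ⟨(hAB a ha b hb).symm, hc⟩⟩
      · exact List.nodup_cons.2 ⟨hcl, List.nodup_cons.2 ⟨hbl, hd⟩⟩
      · rw [card_filter_mem_cons_of_mem hcA hcl, hf']
  have hk : 1 ≤ k := hA ▸ Finset.card_pos.2 ⟨t, ht⟩
  obtain ⟨a, ha, l, hc, hd, hl, -⟩ := key (k - 1) (by omega)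
  obtain ⟨b, hb, hbl⟩ := exists_mem_notMem_list (by omega : (a :: l).length < B.card)
  have := hasPathOn_of_list (by simp) (List.isChain_cons_cons.2 ⟨(hAB a ha b hb).symm, hc⟩)
    (List.nodup_cons.2 ⟨hbl, hd⟩)
  rw [List.length_cons, hl] at this
  convert this using 1
  omega

open scoped Classical in
/-- The component of a large `K_{k,m}` in a graph without `P_{2k+2}` is covered by the small
side. -/
theorem mem_of_adj_of_complete_pair {V : Type*} {G : SimpleGraph V} {k : ℕ} {A B : Finset V}
    (hP : ¬ HasPathOn G (2 * k + 2)) (hA : A.card = k) (hB : 2 * k + 2 ≤ B.card) (hAB : ∀ a ∈ A, ∀ b ∈ B, G.Adj a b)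
    {z : V} (hz : ∃ a ∈ A, G.Reachable a z) {w u : V} (hw : G.Reachable z w) (hwA : w ∉ A)
    (hwu : G.Adj w u) : u ∈ A := by
  obtain ⟨a, ha, haz⟩ := hz
  have key : ∀ {x y : V}, G.Walk x y → (x ∈ A ∨ ∃ t ∈ A, G.Adj t x) →
      (y ∈ A ∨ ∃ t ∈ A, G.Adj t y) := by
    intro x y p
    induction p with
    | nil => exact id
    | @cons x v y h p ih =>
      intro hx
      refine ih ?_
      by_cases hxA : x ∈ A
      · exact Or.inr ⟨x, hxA, h⟩
      · obtain ⟨t, ht, htx⟩ := hx.resolve_left hxA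
        by_contra hv
        exact hP (hasPathOn_of_complete_pair hA hB hAB ht hxA (fun h => hv (Or.inl h)) htx h)
  obtain ⟨p⟩ := haz.trans hw
  obtain ⟨t, ht, htw⟩ := (key p (Or.inl ha)).resolve_left hwA
  by_contra hu
  exact hP (hasPathOn_of_complete_pair hA hB hAB ht hwA hu htw hwu)

end PathsInGraphs

section SpectralRadius

theorem adjMat_mulVec_apply {V : Type*} [Fintype V] (G : SimpleGraph V) [DecidableRel G.Adj]
    (x : V → ℝ) (v : V) : (adjMat G *ᵥ x) v = ∑ u with G.Adj v u, x u := by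
  rw [Finset.sum_filter]
  simp [adjMat, Matrix.mulVec, dotProduct, SimpleGraph.adjMatrix_apply]

theorem exists_eigenvector_muIndex {V : Type*} [Fintype V] [DecidableEq V] [Nonempty V]
    (G : SimpleGraph V) : ∃ x : V → ℝ, x ≠ 0 ∧ adjMat G *ᵥ x = muIndex G • x := by
  obtain ⟨i, hi⟩ := exists_eq_ciSup_of_finite (f := (adjMat_isHermitian G).eigenvalues)
  refine ⟨_, ?_, by rw [muIndex, ← hi]; exact (adjMat_isHermitian G).mulVec_eigenvectorBasis i⟩
  intro h
  exact (adjMat_isHermitian G).eigenvectorBasis.orthonormal.ne_zero i (by ext v; exact congrFun h v)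

theorem le_muIndex_of_eigenvector {V : Type*} [Fintype V] [DecidableEq V]
    (G : SimpleGraph V) {t : ℝ} {x : V → ℝ} (hx : x ≠ 0) (h : adjMat G *ᵥ x = t • x) :
    t ≤ muIndex G := by
  have ht : t ∈ spectrum ℝ (adjMat G) := by
    rw [← Matrix.spectrum_toLin', ← Module.End.hasEigenvalue_iff_mem_spectrum]
    exact Module.End.hasEigenvalue_of_hasEigenvector
      ⟨Module.End.mem_eigenspace_iff.2 (by rw [Matrix.toLin'_apply, h]), hx⟩
  rw [(adjMat_isHermitian G).spectrum_real_eq_range_eigenvalues] at ht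
  obtain ⟨i, rfl⟩ := ht
  exact le_ciSup (Set.finite_range _).bddAbove i

open scoped Classical in
/-- The absolute values of an eigenvector for `μ(G)` form a subeigenvector. -/
theorem exists_subeigenvector_muIndex {V : Type*} [Fintype V] [DecidableEq V] [Nonempty V]
    (G : SimpleGraph V) (hμ : 0 ≤ muIndex G) : ∃ x : V → ℝ, (∀ v, 0 ≤ x v) ∧ (∃ v, 0 < x v) ∧
      ∀ v, muIndex G * x v ≤ ∑ u with G.Adj v u, x u := by
  obtain ⟨y, hy, hev⟩ := exists_eigenvector_muIndex G
  refine ⟨fun v => |y v|, fun v => abs_nonneg _, ?_, fun v => ?_⟩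
  · obtain ⟨v, hv⟩ := Function.ne_iff.1 hy
    exact ⟨v, abs_pos.2 hv⟩
  · have := congrFun hev v
    rw [adjMat_mulVec_apply, Pi.smul_apply, smul_eq_mul] at this
    calc muIndex G * |y v| = |muIndex G * y v| := by rw [abs_mul, abs_of_nonneg hμ]
      _ = |∑ u with G.Adj v u, y u| := by rw [this]
      _ ≤ _ := Finset.abs_sum_le_sum_abs _ _

theorem snk_adj {n k : ℕ} (i j : Fin n) :
    (Snk n k).Adj i j ↔ i ≠ j ∧ ((i : ℕ) < k ∨ (j : ℕ) < k) := by
  rw [Snk, SimpleGraph.fromRel_adj]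
  tauto

open scoped Classical in
theorem le_muIndex_snk {n k : ℕ} (hk : 1 ≤ k) (hkn : k < n) {t : ℝ}
    (ht : t * t = (k - 1) * t + k * (n - k)) : t ≤ muIndex (Snk n k) := by
  have hk0 : (0 : ℝ) < k := by exact_mod_cast hk
  have hlt : (Finset.univ.filter (fun i : Fin n => (i : ℕ) < k)).card = k := by
    rw [Fin.card_filter_val_lt, min_eq_right hkn.le]
  have hge : (Finset.univ.filter (fun i : Fin n => ¬ (i : ℕ) < k)).card = n - k := by
    rw [Finset.filter_not, Finset.card_sdiff_of_subset (Finset.filter_subset _ _), hlt,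
      Finset.card_univ, Fintype.card_fin]
  let x : Fin n → ℝ := fun i => if (i : ℕ) < k then t else k
  have hsmall : ∑ i ∈ Finset.univ.filter (fun i : Fin n => (i : ℕ) < k), x i = k * t := by
    rw [Finset.sum_congr rfl (g := fun _ => t)
      (fun i hi => if_pos (Finset.mem_filter.1 hi).2), Finset.sum_const, hlt, nsmul_eq_mul]
  have hlarge : ∑ i ∈ Finset.univ.filter (fun i : Fin n => ¬ (i : ℕ) < k), x i
      = (n - k) * k := by
    rw [Finset.sum_congr rfl (g := fun _ => (k : ℝ))
      (fun i hi => if_neg (Finset.mem_filter.1 hi).2), Finset.sum_const, hge, nsmul_eq_mul,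
      Nat.cast_sub hkn.le]
  refine le_muIndex_of_eigenvector _ (x := x) ?_ ?_
  · intro h
    have := congrFun h ⟨k, hkn⟩
    simp [x] at this
    omega
  · funext i
    rw [adjMat_mulVec_apply, Pi.smul_apply, smul_eq_mul]
    by_cases hi : (i : ℕ) < k
    · have hset : (Finset.univ.filter ((Snk n k).Adj i)) = Finset.univ.erase i := by
        ext j
        simp [snk_adj, hi, eq_comm]
      rw [hset, Finset.sum_erase_eq_sub (Finset.mem_univ i),
        ← Finset.sum_filter_add_sum_filter_not _ (fun i : Fin n => (i : ℕ) < k), hsmall, hlarge]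
      simp only [x, if_pos hi]
      linarith
    · have hset : (Finset.univ.filter ((Snk n k).Adj i))
          = Finset.univ.filter (fun j : Fin n => (j : ℕ) < k) := by
        ext j
        simp only [snk_adj, hi, Finset.mem_filter, Finset.mem_univ, true_and, false_or]
        exact ⟨fun h => h.2, fun h => ⟨fun hij => hi (hij ▸ h), h⟩⟩
      rw [hset, hsmall]
      simp only [x, if_neg hi]
      ring

theorem muIndex_snk_quadratic {n k : ℕ} (hk : 1 ≤ k) (hkn : k < n) {r : ℝ}
    (hr : muIndex (Snk n k) ≤ r) :
    0 < r ∧ (k : ℝ) * (n - k) ≤ r * r - (k - 1) * r := by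
  have hk1 : (1 : ℝ) ≤ k := by exact_mod_cast hk
  have hkn' : (k : ℝ) < n := by exact_mod_cast hkn
  have hpos : 0 < (k : ℝ) * (n - k) := mul_pos (by linarith) (by linarith)
  set s := Real.sqrt (((k : ℝ) - 1) ^ 2 + 4 * (k * (n - k))) with hs
  have hss : s * s = ((k : ℝ) - 1) ^ 2 + 4 * (k * (n - k)) :=
    Real.mul_self_sqrt (by positivity)
  have hsk : (k : ℝ) - 1 < s := Real.lt_sqrt_of_sq_lt (by linarith)
  have ht := (le_muIndex_snk hk hkn (t := ((k - 1) + s) / 2) (by nlinarith)).trans hr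
  have hr0 : 0 < r := by linarith
  refine ⟨hr0, ?_⟩
  nlinarith

/-- If every subset `L` of a vertex set closed under adjacency has degree sum at most
`K + C * |L|`, then a subeigenvalue `r` whose vector peaks in that set satisfies `(r - C) * r ≤ K`. -/
theorem subeigenvalue_le_of_sum_le {V : Type*} [Fintype V] {G : SimpleGraph V}
    [DecidableRel G.Adj] [DecidableEq V]
    {W : Finset V} (hW : ∀ w ∈ W, ∀ u, G.Adj w u → u ∈ W) {x : V → ℝ} (hx : ∀ v, 0 ≤ x v)
    {r C K : ℝ} (hr : C ≤ r) (hsub : ∀ v, r * x v ≤ ∑ u with G.Adj v u, x u)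
    {z : V} (hz : z ∈ W) (hmax : ∀ v, x v ≤ x z) (hxz : 0 < x z)
    (hK : ∀ L ⊆ W, ∑ w ∈ L, ((Finset.univ.filter (G.Adj w)).card : ℝ) ≤ K + C * L.card) :
    (r - C) * r ≤ K := by
  have hswap : ∑ w ∈ W, ∑ u with G.Adj w u, x u
      = ∑ w ∈ W, ((Finset.univ.filter (G.Adj w)).card : ℝ) * x w := by
    have h1 : ∀ w ∈ W, ∑ u with G.Adj w u, x u = ∑ u ∈ W, if G.Adj w u then x u else 0 := by
      intro w hw
      rw [← Finset.sum_filter]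
      refine Finset.sum_congr ?_ fun _ _ => rfl
      ext u
      simp only [Finset.mem_filter, Finset.mem_univ, true_and]
      exact ⟨fun h => ⟨hW w hw u h, h⟩, fun h => h.2⟩
    rw [Finset.sum_congr rfl h1, Finset.sum_comm]
    refine Finset.sum_congr rfl fun u hu => ?_
    rw [← Finset.sum_filter, Finset.sum_const, nsmul_eq_mul]
    congr 3
    ext w
    simp only [Finset.mem_filter, Finset.mem_univ, true_and]
    exact ⟨fun h => h.2.symm, fun h => ⟨hW u hu w h, h.symm⟩⟩
  have hsum : r * ∑ w ∈ W, x w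
      ≤ ∑ w ∈ W, ((Finset.univ.filter (G.Adj w)).card : ℝ) * x w := by
    rw [Finset.mul_sum, ← hswap]
    exact Finset.sum_le_sum fun w _ => hsub w
  have hexc : ∑ w ∈ W, (((Finset.univ.filter (G.Adj w)).card : ℝ) - C) * x w ≤ K * x z := by
    set L := W.filter (fun w => C < ((Finset.univ.filter (G.Adj w)).card : ℝ)) with hL
    have hLK := hK L (Finset.filter_subset _ _)
    calc _ ≤ ∑ w ∈ L, (((Finset.univ.filter (G.Adj w)).card : ℝ) - C) * x w := by
          rw [hL, Finset.sum_filter]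
          refine Finset.sum_le_sum fun w _ => ?_
          split_ifs with h
          · exact le_rfl
          · exact mul_nonpos_of_nonpos_of_nonneg (by linarith) (hx w)
      _ ≤ ∑ w ∈ L, (((Finset.univ.filter (G.Adj w)).card : ℝ) - C) * x z := by
          refine Finset.sum_le_sum fun w hw => ?_
          have := (Finset.mem_filter.1 hw).2
          exact mul_le_mul_of_nonneg_left (hmax w) (by linarith)
      _ ≤ K * x z := by
          rw [← Finset.sum_mul]
          refine mul_le_mul_of_nonneg_right ?_ hxz.le
          rw [Finset.sum_sub_distrib, Finset.sum_const, nsmul_eq_mul]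
          linarith
  have hlow : r * x z ≤ ∑ w ∈ W, x w := by
    refine (hsub z).trans (Finset.sum_le_sum_of_subset_of_nonneg ?_ fun v _ _ => hx v)
    intro u hu
    exact hW z hz u (Finset.mem_filter.1 hu).2
  have hcomb : (r - C) * ∑ w ∈ W, x w ≤ K * x z := by
    simp only [sub_mul, Finset.sum_sub_distrib, ← Finset.mul_sum] at hexc ⊢
    linarith
  refine le_of_mul_le_mul_right ?_ hxz
  calc (r - C) * r * x z = (r - C) * (r * x z) := by ring
    _ ≤ (r - C) * ∑ w ∈ W, x w := mul_le_mul_of_nonneg_left hlow (by linarith)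
    _ ≤ K * x z := hcomb

open scoped Classical in
/-- A vertex set closed under adjacency either contains a large `K_{k,m}`, or all its subsets have
small degree sums. -/
theorem exists_complete_pair_or_sum_degree_le {V : Type*} [Fintype V] {G : SimpleGraph V} {k : ℕ}
    (hk : 1 ≤ k) (hP : ¬ HasPathOn G (2 * k + 2)) {W L : Finset V} (hLW : L ⊆ W)
    (hW : ∀ w ∈ W, ∀ u, G.Adj w u → u ∈ W) :
    (∃ A ⊆ W, ∃ B ⊆ W, A.card = k ∧ 2 * k + 2 ≤ B.card ∧ ∀ a ∈ A, ∀ b ∈ B, G.Adj a b) ∨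
    ∑ w ∈ L, (Finset.univ.filter (G.Adj w)).card
      ≤ (k - 1) * Fintype.card V + (8 * k + 3) * L.card := by
  rcases exists_complete_pair_or_sum_card_le hk hP L (W \ L) Finset.disjoint_sdiff with h | h
  · obtain ⟨A, hA, B, hB, h⟩ := h
    exact Or.inl ⟨A, hA.trans hLW, B, hB.trans Finset.sdiff_subset, h⟩
  · right
    have hin := sum_card_filter_adj_le hP L
    have hsplit : ∀ w ∈ L, (Finset.univ.filter (G.Adj w)).card
        = ((W \ L).filter (G.Adj w)).card + (L.filter (G.Adj w)).card := by
      intro w hw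
      rw [← Finset.card_union_of_disjoint (Finset.disjoint_filter_filter Finset.sdiff_disjoint),
        ← Finset.filter_union, Finset.sdiff_union_of_subset hLW]
      congr 1
      ext u
      simp only [Finset.mem_filter, Finset.mem_univ, true_and]
      exact ⟨fun h => ⟨hW w (hLW hw) u h, h⟩, fun h => h.2⟩
    have hcard : (k - 1) * (W \ L).card ≤ (k - 1) * Fintype.card V :=
      Nat.mul_le_mul_left _ (Finset.card_le_univ _)
    rw [Finset.sum_congr rfl hsplit, Finset.sum_add_distrib]
    linarith

theorem size_bound_contradiction {k n : ℕ} (hk : 1 ≤ k) (hn : 2 ^ (4 * k + 4) ≤ n) {r : ℝ}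
    (hr0 : 0 < r) (hr : (k : ℝ) * (n - k) ≤ r * r - (k - 1) * r) :
    (8 * k + 3 : ℝ) ≤ r ∧ ((k - 1) * n : ℝ) < (r - (8 * k + 3)) * r := by
  have hkn : 256 * k ^ 3 ≤ n := by
    refine le_trans ?_ hn
    clear hn hr
    induction k, hk using Nat.le_induction with
    | base => norm_num
    | succ k hk ih =>
      have h1 : 2 ^ (4 * (k + 1) + 4) = 16 * 2 ^ (4 * k + 4) := by ring
      rw [h1]
      nlinarith [Nat.pow_le_pow_left hk 2, Nat.pow_le_pow_left hk 3]
  have hkn' : (256 : ℝ) * k ^ 3 ≤ n := by exact_mod_cast hkn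
  have hk1 : (1 : ℝ) ≤ k := by exact_mod_cast hk
  have hk2 : (k : ℝ) ^ 2 ≤ k ^ 3 := pow_le_pow_right₀ hk1 (by norm_num)
  have hk4 : (k : ℝ) ^ 2 ≤ k ^ 4 := pow_le_pow_right₀ hk1 (by norm_num)
  have hn0 : (0 : ℝ) < n := by nlinarith
  have hkr : 0 ≤ ((k : ℝ) - 1) * r := mul_nonneg (by linarith) hr0.le
  have hrk : (11 : ℝ) * k ≤ r := by
    by_contra! hlt
    have h1 : r * r ≤ (11 * k) * (11 * k) := mul_self_le_mul_self hr0.le hlt.le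
    have h2 : (k : ℝ) * (256 * k ^ 3) ≤ k * n := mul_le_mul_of_nonneg_left hkn' (by linarith)
    nlinarith
  refine ⟨by linarith, ?_⟩
  by_contra! hle
  have hlin : (n : ℝ) - k ^ 2 ≤ 11 * (k * r) := by
    have : (n : ℝ) - k ^ 2 ≤ (7 * k + 4) * r := by linarith
    nlinarith
  have h1 : (n : ℝ) ≤ 111 / 10 * (k * r) := by linarith
  have h2 : 47 / 1000 * (n : ℝ) ≤ k * r - 11 * k ^ 2 := by linarith
  have h3 : (n : ℝ) / (111 / 10) * (47 / 1000 * n) ≤ (k * r) * (k * r - 11 * k ^ 2) :=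
    mul_le_mul (by linarith) h2 (by positivity) (by positivity)
  have h4 : (k * r) * (k * r - 11 * k ^ 2) ≤ (k : ℝ) ^ 2 * ((k - 1) * n) := by
    calc (k * r) * (k * r - 11 * k ^ 2) = (k : ℝ) ^ 2 * ((r - 11 * k) * r) := by ring
      _ ≤ (k : ℝ) ^ 2 * ((r - (8 * k + 3)) * r) := by
        refine mul_le_mul_of_nonneg_left (mul_le_mul_of_nonneg_right ?_ hr0.le) (by positivity)
        linarith
      _ ≤ _ := mul_le_mul_of_nonneg_left hle (by positivity)
  have h5 : (n : ℝ) * (256 * k ^ 3) ≤ n * n := mul_le_mul_of_nonneg_left hkn' hn0.le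
  have h6 : (0 : ℝ) < n * k ^ 2 := by positivity
  have h7 : (0 : ℝ) < n * k ^ 3 := by positivity
  nlinarith

/-- A subeigenvector supported on a set covered by `k` vertices attains the bound of `S_{n,k}`
only if those vertices are joined to everything. -/
theorem adj_of_covered {V : Type*} [Fintype V] [DecidableEq V] {G : SimpleGraph V}
    [DecidableRel G.Adj] {A W : Finset V} {k : ℕ}
    (hk : 1 ≤ k) (hA : A.card = k) (hkn : k < Fintype.card V) (hAW : A ⊆ W)
    (hW : ∀ w ∈ W, ∀ u, G.Adj w u → u ∈ W)
    (hcov : ∀ w ∈ W, w ∉ A → ∀ u, G.Adj w u → u ∈ A) {x : V → ℝ} (hx : ∀ v, 0 ≤ x v)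
    {r : ℝ} (hr0 : 0 < r) (hr : (k : ℝ) * (Fintype.card V - k) ≤ r * r - (k - 1) * r)
    (hsub : ∀ v, r * x v ≤ ∑ u with G.Adj v u, x u) {z : V} (hz : z ∈ W) (hxz : 0 < x z) :
    W = Finset.univ ∧ ∀ a ∈ A, ∀ u, u ≠ a → G.Adj a u := by
  have hk0 : (0 : ℝ) < k := by exact_mod_cast hk
  set σ := ∑ a ∈ A, x a with hσ
  set τ := ∑ w ∈ W \ A, x w with hτ
  have hinner : ∀ a ∈ A, ∑ u with G.Adj a u, x u ≤ σ - x a + τ := by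
    intro a ha
    have hsplit : ∑ u ∈ W.erase a, x u = σ - x a + τ := by
      rw [Finset.sum_erase_eq_sub (hAW ha), ← Finset.sum_sdiff hAW]
      ring
    rw [← hsplit]
    refine Finset.sum_le_sum_of_subset_of_nonneg ?_ fun v _ _ => hx v
    intro u hu
    have hau := (Finset.mem_filter.1 hu).2
    exact Finset.mem_erase.2 ⟨hau.ne', hW a (hAW ha) u hau⟩
  have houter : ∀ w ∈ W \ A, r * x w ≤ σ := by
    intro w hw
    rw [Finset.mem_sdiff] at hw
    refine (hsub w).trans (Finset.sum_le_sum_of_subset_of_nonneg ?_ fun v _ _ => hx v)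
    intro u hu
    exact hcov w hw.1 hw.2 u (Finset.mem_filter.1 hu).2
  have hσ0 : 0 < σ := by
    by_cases hzA : z ∈ A
    · exact lt_of_lt_of_le hxz (Finset.single_le_sum (fun v _ => hx v) hzA)
    · exact lt_of_lt_of_le (mul_pos hr0 hxz) (houter z (Finset.mem_sdiff.2 ⟨hz, hzA⟩))
  have hWcard : ((W \ A).card : ℝ) = W.card - k := by
    rw [Finset.card_sdiff_of_subset hAW, Nat.cast_sub (Finset.card_le_card hAW), hA]
  have hσle : r * σ ≤ (k - 1) * σ + k * τ := by
    calc r * σ = ∑ a ∈ A, r * x a := Finset.mul_sum _ _ _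
      _ ≤ ∑ a ∈ A, (σ - x a + τ) := Finset.sum_le_sum fun a ha => (hsub a).trans (hinner a ha)
      _ = (k - 1) * σ + k * τ := by
        rw [Finset.sum_add_distrib, Finset.sum_sub_distrib, Finset.sum_const, Finset.sum_const, hA,
          nsmul_eq_mul, nsmul_eq_mul]
        ring
  have hτle : r * τ ≤ (W.card - k) * σ := by
    calc r * τ = ∑ w ∈ W \ A, r * x w := Finset.mul_sum _ _ _
      _ ≤ ∑ w ∈ W \ A, σ := Finset.sum_le_sum houter
      _ = (W.card - k) * σ := by rw [Finset.sum_const, nsmul_eq_mul, hWcard]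
  have hWle : (W.card : ℝ) ≤ Fintype.card V := by exact_mod_cast Finset.card_le_univ W
  have hrσ : r * (r * σ) ≤ r * ((k - 1) * σ + k * τ) := mul_le_mul_of_nonneg_left hσle hr0.le
  have hkτ : (k : ℝ) * (r * τ) ≤ k * ((W.card - k) * σ) := mul_le_mul_of_nonneg_left hτle hk0.le
  have hrrσ : (k : ℝ) * (Fintype.card V - k) * σ ≤ (r * r - (k - 1) * r) * σ :=
    mul_le_mul_of_nonneg_right hr hσ0.le
  have hWge : (Fintype.card V : ℝ) ≤ W.card := by
    by_contra! hlt
    have : (k : ℝ) * σ * W.card < k * σ * Fintype.card V :=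
      mul_lt_mul_of_pos_left hlt (mul_pos hk0 hσ0)
    linarith
  have hWuniv : W = Finset.univ :=
    Finset.eq_univ_of_card W (le_antisymm (Finset.card_le_univ W) (by exact_mod_cast hWge))
  refine ⟨hWuniv, ?_⟩
  have hWeq : (W.card : ℝ) = Fintype.card V := le_antisymm hWle hWge
  rw [hWeq] at hτle hkτ
  have hτeq : r * τ = (Fintype.card V - k) * σ := by
    refine le_antisymm hτle (le_of_mul_le_mul_left ?_ hk0)
    linarith
  have hσeq : r * σ = (k - 1) * σ + k * τ := by
    refine le_antisymm hσle (le_of_mul_le_mul_left ?_ hr0)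
    have : (k : ℝ) * (r * τ) = k * ((Fintype.card V - k) * σ) := by rw [hτeq]
    linarith
  have houter_eq : ∀ w ∈ W \ A, r * x w = σ := by
    refine (Finset.sum_eq_sum_iff_of_le houter).1 ?_
    rw [← Finset.mul_sum, Finset.sum_const, nsmul_eq_mul, hWcard, hWeq]
    exact hτeq
  have hinner_eq : ∀ a ∈ A, r * x a = σ - x a + τ := by
    refine (Finset.sum_eq_sum_iff_of_le fun a ha => (hsub a).trans (hinner a ha)).1 ?_
    rw [← Finset.mul_sum, Finset.sum_add_distrib, Finset.sum_sub_distrib, Finset.sum_const,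
      Finset.sum_const, hA, nsmul_eq_mul, nsmul_eq_mul, ← hσ, hσeq]
    ring
  have hnk : (0 : ℝ) < Fintype.card V - k := sub_pos.2 (by exact_mod_cast hkn)
  have hτ0 : 0 < τ := pos_of_mul_pos_right (hτeq ▸ mul_pos hnk hσ0) hr0.le
  have hpos : ∀ v, 0 < x v := by
    intro v
    refine pos_of_mul_pos_right (a := r) ?_ hr0.le
    by_cases hv : v ∈ A
    · rw [hinner_eq v hv]
      have := Finset.single_le_sum (fun v _ => hx v) hv (f := x)
      linarith
    · rw [houter_eq v (Finset.mem_sdiff.2 ⟨hWuniv ▸ Finset.mem_univ v, hv⟩)]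
      exact hσ0
  intro a ha u hua
  by_contra hnadj
  have hlt : ∑ u with G.Adj a u, x u < ∑ u ∈ W.erase a, x u := by
    refine Finset.sum_lt_sum_of_subset (i := u) ?_ ?_ ?_ (hpos u) fun v _ _ => hx v
    · intro v hv
      have hav := (Finset.mem_filter.1 hv).2
      exact Finset.mem_erase.2 ⟨hav.ne', hW a (hAW ha) v hav⟩
    · exact Finset.mem_erase.2 ⟨hua, hWuniv ▸ Finset.mem_univ u⟩
    · simpa using hnadj
  have hsplit : ∑ u ∈ W.erase a, x u = σ - x a + τ := by
    rw [Finset.sum_erase_eq_sub (hAW ha), ← Finset.sum_sdiff hAW]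
    ring
  linarith [hsub a, hinner_eq a ha]

theorem nonempty_iso_snk {n k : ℕ} {G : SimpleGraph (Fin n)} {A : Finset (Fin n)}
    (hA : A.card = k) (hkn : k ≤ n) (hadj : ∀ a ∈ A, ∀ u, u ≠ a → G.Adj a u)
    (hcov : ∀ w, w ∉ A → ∀ u, G.Adj w u → u ∈ A) : Nonempty (G ≃g Snk n k) := by
  classical
  have hcard : Fintype.card {i : Fin n // i ∈ A} = Fintype.card {i : Fin n // (i : ℕ) < k} := by
    rw [Fintype.card_coe, hA, Fintype.card_subtype, Fin.card_filter_val_lt, min_eq_right hkn]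
  let e := Fintype.equivOfCardEq hcard
  have he : ∀ i, (e.extendSubtype i : ℕ) < k ↔ i ∈ A := fun i =>
    ⟨fun h => by_contra fun hi => e.extendSubtype_not_mem i hi h, e.extendSubtype_mem i⟩
  refine ⟨⟨e.extendSubtype, ?_⟩⟩
  intro i j
  rw [snk_adj, he, he, e.extendSubtype.injective.ne_iff]
  constructor
  · rintro ⟨hij, hi | hj⟩
    · exact hadj i hi j hij.symm
    · exact (hadj j hj i hij).symm
  · intro h
    refine ⟨h.ne, ?_⟩
    by_contra! hn
    exact hn.2 (hcov i hn.1 j h)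

end SpectralRadius

/-- Nikiforov: if `k ≥ 1`, `n ≥ 2^{4k+4}` and `μ(G) ≥ μ(S_{n,k})`, then
`P_{2k+2} ⊆ G` unless `G ≅ S_{n,k}`. -/
theorem stmt_14 (k n : ℕ) (hk : 1 ≤ k) (hn : 2 ^ (4 * k + 4) ≤ n) (G : SimpleGraph (Fin n))
    (hμ : muIndex (Snk n k) ≤ muIndex G) :
    HasPathOn G (2 * k + 2) ∨ Nonempty (G ≃g Snk n k) := by
  classical
  rw [or_iff_not_imp_left]
  intro hP
  have hkn : k < n := (Nat.lt_two_pow_self).trans_le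
    ((Nat.pow_le_pow_right (by norm_num) (by omega : k ≤ 4 * k + 4)).trans hn)
  have : Nonempty (Fin n) := ⟨⟨0, by omega⟩⟩
  obtain ⟨hr0, hr⟩ := muIndex_snk_quadratic hk hkn hμ
  obtain ⟨x, hx, ⟨v, hv⟩, hsub⟩ := exists_subeigenvector_muIndex G hr0.le
  obtain ⟨z, hmax⟩ := Finite.exists_max x
  have hxz : 0 < x z := hv.trans_le (hmax v)
  let W : Finset (Fin n) := Finset.univ.filter (G.Reachable z)
  have hmemW : ∀ w, w ∈ W ↔ G.Reachable z w := fun w => by simp [W]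
  have hW : ∀ w ∈ W, ∀ u, G.Adj w u → u ∈ W := fun w hw u h =>
    (hmemW u).2 (((hmemW w).1 hw).trans h.reachable)
  have hzW : z ∈ W := (hmemW z).2 (SimpleGraph.Reachable.refl z)
  obtain ⟨A, hAW, B, -, hA, hB, hAB⟩ : ∃ A ⊆ W, ∃ B ⊆ W,
      A.card = k ∧ 2 * k + 2 ≤ B.card ∧ ∀ a ∈ A, ∀ b ∈ B, G.Adj a b := by
    by_contra hno
    obtain ⟨hCr, hlt⟩ := size_bound_contradiction hk hn hr0 hr
    refine hlt.not_ge (subeigenvalue_le_of_sum_le hW hx hCr hsub hzW hmax hxz fun L hL => ?_)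
    have := (exists_complete_pair_or_sum_degree_le hk hP hL hW).resolve_left hno
    rw [Fintype.card_fin] at this
    have hcast : ((k - 1 : ℕ) : ℝ) = k - 1 := by rw [Nat.cast_sub hk, Nat.cast_one]
    rw [← hcast]
    exact_mod_cast this
  obtain ⟨a, ha⟩ := Finset.card_pos.1 (by omega : 0 < A.card)
  have hcov : ∀ w ∈ W, w ∉ A → ∀ u, G.Adj w u → u ∈ A := fun w hw hwA u h =>
    mem_of_adj_of_complete_pair hP hA hB hAB ⟨a, ha, ((hmemW a).1 (hAW ha)).symm⟩
      ((hmemW w).1 hw) hwA h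
  obtain ⟨hWuniv, hadj⟩ := adj_of_covered hk hA (by rwa [Fintype.card_fin]) hAW hW hcov hx hr0
    (by rwa [Fintype.card_fin]) hsub hzW hxz
  exact nonempty_iso_snk hA hkn.le hadj fun w => hcov w (hWuniv ▸ Finset.mem_univ w)
end
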